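/- arXiv:1303.0546 — 2 statements merged into one kernel-verified Lean document; each statement's English description precedes it below -/
import Mathlib

section
/- Let K be a field and let m, n be integers with 1 ≤ m ≤ n. In the polynomial ring R = K[X_{k,i} : 1 ≤ k ≤ 2n, 1 ≤ i ≤ m], the m(m−1)/2 quadratic polynomials x_{i,j} = Σ_{k=1}^{n} (X_{k,i} X_{n+k,j} − X_{n+k,i} X_{k,j}) for 1 ≤ i < j ≤ m form a regular sequence; in particular the quotient R/(x_{i,j} : i < j) is a complete intersection ring of Krull dimension 2nm − m(m−1)/2. -/
noncomputable section

open MvPolynomial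

/-- The symplectic quadric `x_{i,j} = ∑_{k=1}^{n} (X_{k,i} X_{n+k,j} − X_{n+k,i} X_{k,j})`
in the polynomial ring on the entries of a generic `2n × m` matrix (0-indexed). -/
def sympQuad (K : Type*) [Field K] (n m : ℕ) (i j : Fin m) :
    MvPolynomial (Fin (2 * n) × Fin m) K :=
  ∑ k : Fin n,
    (X (⟨k.1, by have := k.2; omega⟩, i) * X (⟨n + k.1, by have := k.2; omega⟩, j)
      - X (⟨n + k.1, by have := k.2; omega⟩, i) * X (⟨k.1, by have := k.2; omega⟩, j))

/-- The list of the quadrics `x_{i,j}` for `i < j`, in lexicographic order. -/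
def sympList (K : Type*) [Field K] (n m : ℕ) :
    List (MvPolynomial (Fin (2 * n) × Fin m) K) :=
  (List.finRange m).flatMap fun i =>
    ((List.finRange m).filter fun j => decide (i < j)).map fun j => sympQuad K n m i j

section CoprimePairs

variable {K σ ι : Type*} [CommRing K]

/-- The polynomials all of whose monomials have `w`-weight less than `d`. -/
def weightLT (K : Type*) [CommRing K] {σ : Type*} (w : σ → ℕ) (d : ℕ) :
    Submodule K (MvPolynomial σ K) :=
  restrictSupport K {γ | Finsupp.weight w γ < d}

lemma mem_weightLT {w : σ → ℕ} {d : ℕ} {g : MvPolynomial σ K} :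
    g ∈ weightLT K w d ↔ ∀ γ ∈ g.support, Finsupp.weight w γ < d :=
  Iff.rfl

lemma monomial_mem_weightLT {w : σ → ℕ} {d : ℕ} {γ : σ →₀ ℕ} (h : Finsupp.weight w γ < d)
    (c : K) : monomial γ c ∈ weightLT K w d :=
  (monomial_mem_restrictSupport K).2 (Or.inl h)

lemma weightLT_mono {w : σ → ℕ} {d e : ℕ} (h : d ≤ e) : weightLT K w d ≤ weightLT K w e :=
  restrictSupport_mono K fun _ hγ => lt_of_lt_of_le hγ h

lemma mul_mem_weightLT {w : σ → ℕ} {d e : ℕ} {g h : MvPolynomial σ K}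
    (hg : g ∈ weightLT K w d) (hh : h ∈ weightLT K w (e + 1)) : g * h ∈ weightLT K w (d + e) := by
  classical
  intro γ hγ
  obtain ⟨a, ha, b, hb, rfl⟩ := Finset.mem_add.1 (support_mul g h hγ)
  have h1 := hg ha
  have h2 := hh hb
  simp only [Set.mem_ofPred_eq, map_add] at h1 h2 ⊢
  omega

/-- `g` is the monomial with exponent `γ` plus terms of strictly smaller weight. -/
def HasLeadMonomial (w : σ → ℕ) (g : MvPolynomial σ K) (γ : σ →₀ ℕ) : Prop :=
  g - monomial γ 1 ∈ weightLT K w (Finsupp.weight w γ)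

lemma HasLeadMonomial.mem_weightLT {w : σ → ℕ} {g : MvPolynomial σ K} {γ : σ →₀ ℕ}
    (h : HasLeadMonomial w g γ) : g ∈ weightLT K w (Finsupp.weight w γ + 1) := by
  rw [← sub_add_cancel g (monomial γ 1)]
  exact add_mem (weightLT_mono (Nat.le_succ _) h) (monomial_mem_weightLT (Nat.lt_succ_self _) 1)

lemma hasLeadMonomial_monomial (w : σ → ℕ) (γ : σ →₀ ℕ) :
    HasLeadMonomial w (monomial γ (1 : K)) γ := by
  simp [HasLeadMonomial]

lemma HasLeadMonomial.mul {w : σ → ℕ} {g h : MvPolynomial σ K} {γ δ : σ →₀ ℕ}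
    (hg : HasLeadMonomial w g γ) (hh : HasLeadMonomial w h δ) :
    HasLeadMonomial w (g * h) (γ + δ) := by
  have key : g * h - monomial (γ + δ) 1 =
      (g - monomial γ 1) * h + (h - monomial δ 1) * monomial γ 1 := by
    rw [← one_mul (1 : K), ← monomial_mul, one_mul]; ring
  rw [HasLeadMonomial, key, map_add]
  refine add_mem (mul_mem_weightLT hg hh.mem_weightLT) ?_
  rw [add_comm]
  exact mul_mem_weightLT hh (monomial_mem_weightLT (Nat.lt_succ_self _) 1)

lemma HasLeadMonomial.pow {w : σ → ℕ} {g : MvPolynomial σ K} {γ : σ →₀ ℕ}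
    (hg : HasLeadMonomial w g γ) (k : ℕ) : HasLeadMonomial w (g ^ k) (k • γ) := by
  induction k with
  | zero => simpa using hasLeadMonomial_monomial w (0 : σ →₀ ℕ)
  | succ k ih => simpa only [pow_succ, succ_nsmul] using ih.mul hg

lemma HasLeadMonomial.prod {w : σ → ℕ} {g : ι → MvPolynomial σ K} {γ : ι → σ →₀ ℕ} (s : Finset ι)
    (h : ∀ i, HasLeadMonomial w (g i) (γ i)) :
    HasLeadMonomial w (∏ i ∈ s, g i) (∑ i ∈ s, γ i) := by
  classical
  induction s using Finset.induction_on with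
  | empty => simpa using hasLeadMonomial_monomial w (0 : σ →₀ ℕ)
  | insert a s ha ih => simpa only [Finset.prod_insert ha, Finset.sum_insert ha] using (h a).mul ih

/-- A linear endomorphism of a polynomial ring which preserves leading monomials is bijective. -/
lemma bijective_of_hasLeadMonomial {w : σ → ℕ} (L : MvPolynomial σ K →ₗ[K] MvPolynomial σ K)
    (hL : ∀ γ, HasLeadMonomial w (L (monomial γ 1)) γ) : Function.Bijective L := by
  have hN : ∀ d g, g ∈ weightLT K w (d + 1) → L g - g ∈ weightLT K w d := by
    intro d g hg
    have : L g - g = ∑ γ ∈ g.support, g.coeff γ • (L (monomial γ 1) - monomial γ 1) := by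
      conv_lhs => rw [g.as_sum]
      simp only [map_sum, ← Finset.sum_sub_distrib, smul_sub]
      refine Finset.sum_congr rfl fun γ _ => ?_
      rw [← map_smul, smul_monomial, smul_eq_mul, mul_one]
    rw [this]
    exact Submodule.sum_mem _ fun γ hγ => Submodule.smul_mem _ _
      (weightLT_mono (Nat.lt_succ_iff.1 (hg hγ)) (hL γ))
  have hex : ∀ g : MvPolynomial σ K, ∃ d, g ∈ weightLT K w d := fun g =>
    ⟨g.support.sup (Finsupp.weight w) + 1, fun γ hγ => Nat.lt_succ_of_le (Finset.le_sup hγ)⟩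
  have hz : ∀ g : MvPolynomial σ K, g ∈ weightLT K w 0 → g = 0 := fun g hg =>
    support_eq_empty.1 <| Finset.eq_empty_of_forall_notMem fun γ hγ => Nat.not_lt_zero _ (hg hγ)
  constructor
  · rw [injective_iff_map_eq_zero]
    intro g hg
    obtain ⟨d, hd⟩ := hex g
    induction d with
    | zero => exact hz g hd
    | succ d ih => exact ih (by simpa [hg] using hN d g hd)
  · intro g
    obtain ⟨d, hd⟩ := hex g
    induction d generalizing g with
    | zero => exact ⟨0, by rw [hz g hd, map_zero]⟩
    | succ d ih =>
      obtain ⟨h, hh⟩ := ih _ (hN d g hd)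
      exact ⟨g - h, by rw [map_sub, hh, sub_sub_cancel]⟩

/-- The exponent of `X (p i) * X (q i)`. -/
def pairExp (p q : ι → σ) (i : ι) : σ →₀ ℕ :=
  Finsupp.single (p i) 1 + Finsupp.single (q i) 1

/-- The exponent of the largest power of `X (p i) * X (q i)` dividing the monomial `γ`. -/
def pairMult (p q : ι → σ) (γ : σ →₀ ℕ) (i : ι) : ℕ :=
  min (γ (p i)) (γ (q i))

lemma pairExp_apply_eq_zero {p q : ι → σ} {i : ι} {z : σ} (hp : p i ≠ z) (hq : q i ≠ z) :
    pairExp p q i z = 0 := by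
  classical
  simp [pairExp, hp, hq]

lemma pairExp_apply_left {p q : ι → σ} (h : Function.Injective (Sum.elim p q)) (i j : ι)
    [Decidable (i = j)] : pairExp p q i (p j) = if i = j then 1 else 0 := by
  classical
  have h1 : p i = p j ↔ i = j := ⟨fun e => Sum.inl_injective (h (a₁ := .inl i) (a₂ := .inl j) e),
    fun e => e ▸ rfl⟩
  have h2 : q i ≠ p j := fun e => nomatch h (a₁ := .inr i) (a₂ := .inl j) e
  simp [pairExp, Finsupp.single_apply, h1, h2]

lemma pairExp_apply_right {p q : ι → σ} (h : Function.Injective (Sum.elim p q)) (i j : ι)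
    [Decidable (i = j)] : pairExp p q i (q j) = if i = j then 1 else 0 := by
  classical
  have h1 : q i = q j ↔ i = j := ⟨fun e => Sum.inr_injective (h (a₁ := .inr i) (a₂ := .inr j) e),
    fun e => e ▸ rfl⟩
  have h2 : p i ≠ q j := fun e => nomatch h (a₁ := .inl i) (a₂ := .inr j) e
  simp [pairExp, Finsupp.single_apply, h1, h2]

lemma pairMult_add_pairExp [DecidableEq ι] {p q : ι → σ} (h : Function.Injective (Sum.elim p q))
    (γ : σ →₀ ℕ) (j : ι) : pairMult p q (γ + pairExp p q j) = pairMult p q γ + Pi.single j 1 := by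
  ext i
  simp only [pairMult, Finsupp.add_apply, pairExp_apply_left h, pairExp_apply_right h,
    Pi.add_apply, Pi.single_apply, min_add_add_right, eq_comm]

variable [Fintype ι]

/-- The part of the exponent `γ` made of powers of the monomials `X (p i) * X (q i)`. -/
def pairPart (p q : ι → σ) (γ : σ →₀ ℕ) : σ →₀ ℕ :=
  ∑ i, pairMult p q γ i • pairExp p q i

lemma pairPart_le {p q : ι → σ} (h : Function.Injective (Sum.elim p q)) (γ : σ →₀ ℕ) :
    pairPart p q γ ≤ γ := by
  classical
  intro z
  simp only [pairPart, Finsupp.finsetSum_apply, Finsupp.smul_apply, smul_eq_mul]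
  by_cases hz : ∃ j, p j = z ∨ q j = z
  · obtain ⟨j, rfl | rfl⟩ := hz
    · simp [pairExp_apply_left h, pairMult]
    · simp [pairExp_apply_right h, pairMult]
  · push Not at hz
    simp [pairExp_apply_eq_zero (hz _).1 (hz _).2]

lemma pairPart_add_pairExp {p q : ι → σ} (h : Function.Injective (Sum.elim p q))
    (γ : σ →₀ ℕ) (j : ι) : pairPart p q (γ + pairExp p q j) = pairPart p q γ + pairExp p q j := by
  classical
  simp [pairPart, pairMult_add_pairExp h, add_smul, Finset.sum_add_distrib, Pi.single_apply]

/-- The linear map replacing each factor `X (p i) * X (q i)` of a monomial by `f i`. -/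
def substPairs (p q : ι → σ) (f : ι → MvPolynomial σ K) :
    MvPolynomial σ K →ₗ[K] MvPolynomial σ K :=
  (basisMonomials σ K).constr K fun γ =>
    monomial (γ - pairPart p q γ) 1 * ∏ i, f i ^ pairMult p q γ i

lemma substPairs_monomial (p q : ι → σ) (f : ι → MvPolynomial σ K) (γ : σ →₀ ℕ) :
    substPairs p q f (monomial γ 1) =
      monomial (γ - pairPart p q γ) 1 * ∏ i, f i ^ pairMult p q γ i := by
  simpa only [coe_basisMonomials, substPairs] using (basisMonomials σ K).constr_basis K
    (fun γ => monomial (γ - pairPart p q γ) 1 * ∏ i, f i ^ pairMult p q γ i) γ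

lemma substPairs_mul {p q : ι → σ} (h : Function.Injective (Sum.elim p q))
    (f : ι → MvPolynomial σ K) (j : ι) (g : MvPolynomial σ K) :
    substPairs p q f (g * monomial (pairExp p q j) 1) = substPairs p q f g * f j := by
  classical
  have : substPairs p q f ∘ₗ LinearMap.mulRight K (monomial (pairExp p q j) 1) =
      LinearMap.mulRight K (f j) ∘ₗ substPairs p q f := by
    refine (basisMonomials σ K).ext fun γ => ?_
    simp only [coe_basisMonomials, LinearMap.comp_apply, LinearMap.mulRight_apply, monomial_mul,
      mul_one, substPairs_monomial, pairPart_add_pairExp h, pairMult_add_pairExp h,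
      add_tsub_add_eq_tsub_right, Pi.add_apply, pow_add, Finset.prod_mul_distrib, mul_assoc]
    congr 2
    simp [Pi.single_apply, pow_ite]
  exact LinearMap.congr_fun this g

lemma substPairs_bijective {p q : ι → σ} (h : Function.Injective (Sum.elim p q)) {w : σ → ℕ}
    {f : ι → MvPolynomial σ K} (hf : ∀ i, HasLeadMonomial w (f i) (pairExp p q i)) :
    Function.Bijective (substPairs p q f) := by
  refine bijective_of_hasLeadMonomial (w := w) _ fun γ => ?_
  rw [substPairs_monomial]
  have := (hasLeadMonomial_monomial (K := K) w (γ - pairPart p q γ)).mul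
    (HasLeadMonomial.prod Finset.univ fun i => (hf i).pow (pairMult p q γ i))
  rwa [← pairPart, tsub_add_cancel_of_le (pairPart_le h γ)] at this

omit [Fintype ι] in
/-- Pairwise coprime monomials are nonzerodivisors modulo each other. -/
lemma mem_span_of_mul_monomial_pairExp_mem {p q : ι → σ} (h : Function.Injective (Sum.elim p q))
    {s : Set ι} {j : ι} (hj : j ∉ s) {g : MvPolynomial σ K}
    (hg : g * monomial (pairExp p q j) 1 ∈
      Ideal.span ((fun i => monomial (pairExp p q i) (1 : K)) '' s)) :
    g ∈ Ideal.span ((fun i => monomial (pairExp p q i) (1 : K)) '' s) := by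
  classical
  have e : (fun i => monomial (pairExp p q i) (1 : K)) '' s =
      (fun γ => monomial γ (1 : K)) '' (pairExp p q '' s) := by rw [Set.image_image]
  rw [e, mem_ideal_span_monomial_image] at hg ⊢
  intro γ hγ
  obtain ⟨_, ⟨i, hi, rfl⟩, hle⟩ := hg (γ + pairExp p q j) (by
    rw [mem_support_iff, coeff_mul_monomial, mul_one]; exact mem_support_iff.1 hγ)
  refine ⟨_, ⟨i, hi, rfl⟩, fun z => ?_⟩
  have hij : j ≠ i := fun e => hj (e ▸ hi)
  have := hle z
  rw [Finsupp.add_apply] at this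
  by_cases hz : p i = z ∨ q i = z
  · obtain rfl | rfl := hz
    · rwa [pairExp_apply_left h j i, if_neg hij, add_zero] at this
    · rwa [pairExp_apply_right h j i, if_neg hij, add_zero] at this
  · push Not at hz
    simp [pairExp_apply_eq_zero hz.1 hz.2]

/-- Polynomials whose leading monomials are pairwise coprime products of two variables are
nonzerodivisors modulo each other. -/
lemma mem_span_of_mul_mem {p q : ι → σ} (h : Function.Injective (Sum.elim p q)) {w : σ → ℕ}
    {f : ι → MvPolynomial σ K} (hf : ∀ i, HasLeadMonomial w (f i) (pairExp p q i))
    {s : Set ι} {j : ι} (hj : j ∉ s) {g : MvPolynomial σ K}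
    (hg : g * f j ∈ Ideal.span (f '' s)) : g ∈ Ideal.span (f '' s) := by
  have hL := substPairs_bijective h hf
  have key : ∀ g, substPairs p q f g ∈ Ideal.span (f '' s) ↔
      g ∈ Ideal.span ((fun i => monomial (pairExp p q i) (1 : K)) '' s) := by
    intro g
    constructor
    · suffices ∀ x ∈ Ideal.span (f '' s), ∀ a, ∃ y ∈ Ideal.span
          ((fun i => monomial (pairExp p q i) (1 : K)) '' s), substPairs p q f y = a * x by
        intro hg
        obtain ⟨y, hy, e⟩ := this _ hg 1
        rw [one_mul] at e
        exact hL.1 e ▸ hy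
      intro x hx
      induction hx using Submodule.span_induction with
      | mem x hx =>
        intro a
        obtain ⟨i, hi, rfl⟩ := hx
        obtain ⟨y, rfl⟩ := hL.2 a
        exact ⟨y * monomial (pairExp p q i) 1,
          Ideal.mul_mem_left _ _ (Ideal.subset_span ⟨i, hi, rfl⟩), substPairs_mul h f i y⟩
      | zero => exact fun a => ⟨0, zero_mem _, by simp⟩
      | add x y _ _ hx hy =>
        intro a
        obtain ⟨x', hx', ex⟩ := hx a
        obtain ⟨y', hy', ey⟩ := hy a
        exact ⟨x' + y', add_mem hx' hy', by rw [map_add, ex, ey, mul_add]⟩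
      | smul r x _ hx => exact fun a => by simpa only [smul_eq_mul, mul_assoc] using hx (a * r)
    · suffices ∀ y ∈ Ideal.span ((fun i => monomial (pairExp p q i) (1 : K)) '' s), ∀ a,
          substPairs p q f (a * y) ∈ Ideal.span (f '' s) from
        fun hg => by simpa using this g hg 1
      intro y hy
      induction hy using Submodule.span_induction with
      | mem y hy =>
        intro a
        obtain ⟨i, hi, rfl⟩ := hy
        rw [substPairs_mul h]
        exact Ideal.mul_mem_left _ _ (Ideal.subset_span ⟨i, hi, rfl⟩)
      | zero => simp
      | add x y _ _ hx hy =>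
        exact fun a => by simpa only [mul_add, map_add] using add_mem (hx a) (hy a)
      | smul r x _ hx => exact fun a => by simpa only [smul_eq_mul, mul_assoc] using hx (a * r)
  obtain ⟨g, rfl⟩ := hL.2 g
  rw [← substPairs_mul h, key] at hg
  exact (key g).2 (mem_span_of_mul_monomial_pairExp_mem h hj hg)

open RingTheory.Sequence in
lemma isWeaklyRegular_map_of_hasLeadMonomial {p q : ι → σ}
    (h : Function.Injective (Sum.elim p q)) {w : σ → ℕ} {f : ι → MvPolynomial σ K}
    (hf : ∀ i, HasLeadMonomial w (f i) (pairExp p q i)) {l : List ι} (hl : l.Nodup) :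
    IsWeaklyRegular (MvPolynomial σ K) (l.map f) := by
  refine ⟨fun k hk => ?_⟩
  have hk' : k < l.length := by simpa using hk
  have hI : (Ideal.ofList ((l.map f).take k) • ⊤ : Submodule (MvPolynomial σ K) _) =
      Ideal.span (f '' {i | i ∈ l.take k}) := by
    rw [smul_eq_mul, Ideal.mul_top, Ideal.ofList]
    congr 1
    ext x
    simp [← List.map_take]
  have hj : l[k] ∉ {i | i ∈ l.take k} := by
    intro hmem
    obtain ⟨i, hi, e⟩ := List.mem_take_iff_getElem.1 hmem
    have := (List.Nodup.getElem_inj_iff hl).1 e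
    omega
  rw [isSMulRegular_iff_right_eq_zero_of_smul]
  intro x hx
  obtain ⟨g, rfl⟩ := Submodule.Quotient.mk_surjective _ x
  rw [← Submodule.Quotient.mk_smul, Submodule.Quotient.mk_eq_zero, hI] at hx
  rw [Submodule.Quotient.mk_eq_zero, hI]
  refine mem_span_of_mul_mem h hf hj ?_
  rwa [List.getElem_map, smul_eq_mul, mul_comm] at hx

end CoprimePairs

section Dimension

lemma eq_natCast_sub_of_add_natCast_eq {d : WithBot ℕ∞} {a b : ℕ} (h : d + a = b) :
    d = (b - a : ℕ) := by
  induction d with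
  | bot => exact absurd h (by rw [WithBot.bot_add]; exact WithBot.bot_ne_coe)
  | coe d =>
    have h' : d + a = b := WithBot.coe_injective h
    induction d with
    | top => exact absurd h' (by rw [top_add]; exact ENat.top_ne_natCast b)
    | coe d =>
      have : d + a = b := ENat.natCast_inj.1 h'
      rw [← this, Nat.add_sub_cancel]
      rfl

open RingTheory.Sequence in
lemma supportDim_add_length_le_of_isWeaklyRegular {R : Type*} [CommRing R]
    {M : Type*} [AddCommGroup M] [Module R M] [Module.Finite R M] (rs : List R)
    (reg : IsWeaklyRegular M rs) :
    Module.supportDim R (M ⧸ Ideal.ofList rs • (⊤ : Submodule R M)) + rs.length ≤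
      Module.supportDim R M := by
  induction rs generalizing M with
  | nil =>
    rw [Ideal.ofList_nil, Submodule.bot_smul]
    simpa using (Module.supportDim_eq_of_equiv (Submodule.quotEquivOfEqBot ⊥ rfl)).le
  | cons x rs ih =>
    obtain ⟨hx, hrs⟩ := (isWeaklyRegular_cons_iff M x rs).1 reg
    rw [Module.supportDim_eq_of_equiv
      (Submodule.quotOfListConsSMulTopEquivQuotSMulTopInner M x rs), List.length_cons,
      Nat.cast_add, Nat.cast_one, ← add_assoc]
    exact (add_le_add_left (ih hrs) 1).trans
      (Module.supportDim_quotSMulTop_succ_le_of_notMem_minimalPrimes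
        fun _ => hx.notMem_of_mem_minimalPrimes)

lemma ringKrullDim_quotient_ofList_add_length_le {R : Type*} [CommRing R] (rs : List R)
    (reg : RingTheory.Sequence.IsWeaklyRegular R rs) :
    ringKrullDim (R ⧸ Ideal.ofList rs) + rs.length ≤ ringKrullDim R := by
  have eq : Ideal.ofList rs = Ideal.ofList rs • (⊤ : Ideal R) := by simp
  rw [ringKrullDim_eq_of_ringEquiv (Ideal.quotientEquivAlgOfEq R eq).toRingEquiv,
    ← Module.supportDim_quotient_eq_ringKrullDim, ← Module.supportDim_self_eq_ringKrullDim]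
  exact supportDim_add_length_le_of_isWeaklyRegular rs reg

variable {K σ : Type*} [Field K]

/-- Setting the variables in `s` to zero. -/
def killVars (K : Type*) [Field K] {σ : Type*} (s : Set σ) :
    MvPolynomial σ K →ₐ[K] MvPolynomial σ K :=
  open Classical in aeval fun i => if i ∈ s then 0 else X i

lemma card_le_height_ker_killVars (s : Finset σ) :
    (s.card : ℕ∞) ≤ (RingHom.ker (killVars K (s : Set σ))).height := by
  classical
  induction s using Finset.induction_on with
  | empty => simp
  | insert a s ha ih =>
    have hcomp : (killVars K (↑(insert a s) : Set σ)).comp (killVars K (s : Set σ)) =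
        killVars K (↑(insert a s) : Set σ) := by
      ext i : 1
      by_cases hi : i ∈ s <;> simp [killVars, hi]
    have hlt : RingHom.ker (killVars K (s : Set σ)) <
        RingHom.ker (killVars K (↑(insert a s) : Set σ)) := by
      refine lt_of_le_of_ne (fun g hg => ?_) fun e => ?_
      · rw [RingHom.mem_ker] at hg ⊢
        rw [← hcomp, AlgHom.comp_apply, hg, map_zero]
      · have : X a ∈ RingHom.ker (killVars K (s : Set σ)) := by
          rw [e, RingHom.mem_ker]
          simp [killVars]
        simp [killVars, ha] at this
    have := RingHom.ker_isPrime (killVars K (s : Set σ))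
    have := RingHom.ker_isPrime (killVars K (↑(insert a s) : Set σ))
    rw [Finset.card_insert_of_notMem ha, Nat.cast_add, Nat.cast_one]
    exact (add_le_add_left ih 1).trans (Ideal.height_add_one_le_of_lt_of_isPrime hlt)

/-- Cutting affine space by `r` hypersurfaces through the origin lowers the dimension by at
most `r`. -/
lemma card_le_ringKrullDim_quotient_ofList_add_length [Fintype σ] (rs : List (MvPolynomial σ K))
    (h : ∀ g ∈ rs, constantCoeff g = 0) :
    (Fintype.card σ : WithBot ℕ∞) ≤
      ringKrullDim (MvPolynomial σ K ⧸ Ideal.ofList rs) + rs.length := by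
  classical
  have hp := RingHom.ker_isPrime (killVars K (Set.univ : Set σ))
  have h1 := card_le_height_ker_killVars (K := K) (Finset.univ : Finset σ)
  rw [Finset.coe_univ, Finset.card_univ] at h1
  have h2 := Ideal.height_le_ringKrullDim_quotient_add_encard {g | g ∈ rs}
    (p := RingHom.ker (killVars K (Set.univ : Set σ))) (fun g hg => by
      have e : killVars K (Set.univ : Set σ) g = C (constantCoeff g) := by
        simp only [killVars, Set.mem_univ, if_true]
        exact aeval_zero' g
      simp [RingHom.mem_ker, e, h g hg])
  have h3 : {g | g ∈ rs}.encard ≤ rs.length := by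
    rw [← List.coe_toFinset, Set.encard_coe_eq_coe_finsetCard]
    exact_mod_cast rs.toFinset_card_le
  refine le_trans (by exact_mod_cast h1) (h2.trans ?_)
  exact add_le_add le_rfl (by exact_mod_cast h3)

end Dimension


section Symplectic

/-- The pairs `(i, j)` with `i < j`. -/
abbrev LtPair (m : ℕ) : Type := {x : Fin m × Fin m // x.1 < x.2}

/-- A weight for which `X (j - i, i) * X (n + (j - i), j)` is the leading monomial of
`sympQuad K n m i j`. -/
def sympWeight (n m : ℕ) (x : Fin (2 * n) × Fin m) : ℕ :=
  if x.1.1 < n then 2 * n * m - 2 * x.1.1 * x.2.1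
  else n ^ 2 - (x.1.1 - n) ^ 2 + 2 * (x.1.1 - n) * x.2.1

/-- The first variable of the leading monomial of a symplectic quadric. -/
def leadLeft {n m : ℕ} (hmn : m ≤ n) (x : LtPair m) : Fin (2 * n) × Fin m :=
  (⟨x.1.2.1 - x.1.1.1, by omega⟩, x.1.1)

/-- The second variable of the leading monomial of a symplectic quadric. -/
def leadRight {n m : ℕ} (hmn : m ≤ n) (x : LtPair m) : Fin (2 * n) × Fin m :=
  (⟨n + (x.1.2.1 - x.1.1.1), by omega⟩, x.1.2)

lemma injective_elim_leadLeft_leadRight {n m : ℕ} (hmn : m ≤ n) :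
    Function.Injective (Sum.elim (leadLeft hmn) (leadRight hmn)) := by
  rintro (⟨⟨a, b⟩, h⟩ | ⟨⟨a, b⟩, h⟩) (⟨⟨c, d⟩, h'⟩ | ⟨⟨c, d⟩, h'⟩) e <;>
    simp only [Sum.elim_inl, Sum.elim_inr, leadLeft, leadRight, Prod.mk.injEq, Fin.ext_iff,
      Sum.inl.injEq, Sum.inr.injEq, Subtype.mk.injEq, Fin.lt_def, reduceCtorEq]
      at e h h' ⊢ <;> omega

lemma cast_sympWeight_of_lt {n m k : ℕ} (i : Fin m) (hk : k < n) :
    (sympWeight n m (⟨k, by omega⟩, i) : ℤ) = 2 * n * m - 2 * k * i := by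
  have h : 2 * k * i.1 ≤ 2 * n * m := Nat.mul_le_mul (by omega) i.2.le
  simp only [sympWeight, hk, if_true]
  push_cast [h]
  ring

lemma cast_sympWeight_add {n m k : ℕ} (i : Fin m) (hk : k < n) :
    (sympWeight n m (⟨n + k, by omega⟩, i) : ℤ) = n ^ 2 - k ^ 2 + 2 * k * i := by
  have h : k ^ 2 ≤ n ^ 2 := Nat.pow_le_pow_left hk.le 2
  simp [sympWeight, h]

lemma hasLeadMonomial_sympQuad (K : Type*) [Field K] {n m : ℕ} (hmn : m ≤ n) (x : LtPair m) :
    HasLeadMonomial (sympWeight n m) (sympQuad K n m x.1.1 x.1.2)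
      (pairExp (leadLeft hmn) (leadRight hmn) x) := by
  classical
  obtain ⟨⟨i, j⟩, hij⟩ := x
  simp only [Fin.lt_def] at hij
  let k₀ : Fin n := ⟨j - i, by omega⟩
  have hk₀ : (k₀ : ℤ) = j - i := by simp only [k₀]; push_cast [hij.le]; rfl
  have hlead : monomial (pairExp (leadLeft hmn) (leadRight hmn) ⟨(i, j), hij⟩) (1 : K) =
      X (⟨k₀.1, by omega⟩, i) * X (⟨n + k₀.1, by omega⟩, j) := by
    simp only [pairExp, X, monomial_mul, mul_one]
    rfl
  have hX : ∀ a b : Fin (2 * n) × Fin m,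
      sympWeight n m a + sympWeight n m b <
        Finsupp.weight (sympWeight n m) (pairExp (leadLeft hmn) (leadRight hmn) ⟨(i, j), hij⟩) →
      (X a * X b : MvPolynomial _ K) ∈ weightLT K (sympWeight n m)
        (Finsupp.weight (sympWeight n m)
          (pairExp (leadLeft hmn) (leadRight hmn) ⟨(i, j), hij⟩)) := by
    intro a b hab
    rw [X, X, monomial_mul, mul_one]
    exact monomial_mem_weightLT (by simpa [Finsupp.weight_single] using hab) 1
  have hw : (Finsupp.weight (sympWeight n m)
      (pairExp (leadLeft hmn) (leadRight hmn) ⟨(i, j), hij⟩) : ℤ) =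
      2 * n * m + n ^ 2 + ((j : ℤ) - i) ^ 2 := by
    simp only [pairExp, map_add, Finsupp.weight_single, one_smul, Nat.cast_add]
    have h1 := cast_sympWeight_of_lt (n := n) i k₀.2
    have h2 := cast_sympWeight_add (n := n) j k₀.2
    rw [hk₀] at h1 h2
    refine (congrArg₂ (· + ·) h1 h2).trans ?_
    ring
  rw [HasLeadMonomial, hlead, sympQuad, Finset.sum_sub_distrib,
    ← Finset.add_sum_erase _ _ (Finset.mem_univ k₀), sub_right_comm, add_sub_cancel_left]
  refine sub_mem (Submodule.sum_mem _ fun k hk => hX _ _ ?_)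
    (Submodule.sum_mem _ fun k _ => hX _ _ ?_)
  · zify
    rw [hw, cast_sympWeight_of_lt i k.2, cast_sympWeight_add j k.2]
    have hne : (k : ℤ) - (j - i) ≠ 0 := by
      rw [← hk₀, sub_ne_zero]
      exact fun e => Finset.ne_of_mem_erase hk (Fin.ext (by exact_mod_cast e))
    nlinarith [pow_pos (abs_pos.2 hne) 2, sq_abs ((k : ℤ) - (j - i))]
  · zify
    rw [hw, cast_sympWeight_add i k.2, cast_sympWeight_of_lt j k.2]
    have h1 : (0 : ℤ) < j - i := by omega
    have h2 : (0 : ℤ) ≤ k := by positivity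
    nlinarith [mul_nonneg h2 h1.le]

lemma mem_sympList {K : Type*} [Field K] {n m : ℕ} {g : MvPolynomial (Fin (2 * n) × Fin m) K} :
    g ∈ sympList K n m ↔ ∃ i j : Fin m, i < j ∧ g = sympQuad K n m i j := by
  simp [sympList, eq_comm]

lemma constantCoeff_sympQuad (K : Type*) [Field K] (n m : ℕ) (i j : Fin m) :
    constantCoeff (sympQuad K n m i j) = 0 := by
  simp [sympQuad]

lemma exists_sympList_eq_map (K : Type*) [Field K] (n m : ℕ) :
    ∃ l : List (LtPair m), l.Nodup ∧ l.length = m * (m - 1) / 2 ∧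
      sympList K n m = l.map fun x => sympQuad K n m x.1.1 x.1.2 := by
  classical
  let l₀ : List (Fin m × Fin m) := (List.finRange m).flatMap fun i =>
    ((List.finRange m).filter fun j => decide (i < j)).map fun j => (i, j)
  have hmem : ∀ x, x ∈ l₀ ↔ x.1 < x.2 := by
    rintro ⟨a, b⟩
    simp [l₀]
  have hl₀ : l₀.Nodup := by
    refine List.nodup_flatMap.2 ⟨fun i _ => ?_, ?_⟩
    · exact ((List.nodup_finRange m).filter _).map fun a b e => (Prod.mk.inj e).2
    · refine (List.nodup_finRange m).imp fun {a b} hab => ?_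
      simp only [Function.onFun, List.disjoint_left, List.mem_map, not_exists]
      rintro _ ⟨c, -, rfl⟩ d ⟨-, e⟩
      exact hab (Prod.mk.inj e).1.symm
  have hlist : sympList K n m = l₀.map fun x => sympQuad K n m x.1 x.2 := by
    simp [sympList, l₀, List.map_flatMap, Function.comp_def]
  have hlen : l₀.length = m * (m - 1) / 2 := by
    simp only [l₀, List.length_flatMap, List.length_map]
    have : ∀ i : Fin m, ((List.finRange m).filter fun j => decide (i < j)).length = m - 1 - i := by
      intro i
      rw [← Fin.card_Ioi, ← List.toFinset_card_of_nodup ((List.nodup_finRange m).filter _)]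
      congr 1
      ext j
      simp
    simp only [this]
    rw [← Fin.sum_univ_def, Fin.sum_univ_eq_sum_range (fun i => m - 1 - i) m,
      Finset.sum_range_reflect (fun i => i) m, Finset.sum_range_id]
  lift l₀ to List (LtPair m) using fun x hx => (hmem x).1 hx with l hl
  refine ⟨l, ?_, ?_, ?_⟩
  · exact hl₀.of_map _
  · rw [← hlen, List.length_map]
  · rw [hlist, List.map_map]
    rfl

end Symplectic

/-- The `m(m−1)/2` symplectic quadrics `x_{i,j}` (`i < j`) form a regular sequence in
`K[X_{k,i}]`, and the quotient by the ideal they generate (a complete intersection) has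
Krull dimension `2nm − m(m−1)/2`. -/
theorem statement0 (K : Type*) [Field K] (m n : ℕ) (hm : 1 ≤ m) (hmn : m ≤ n) :
    RingTheory.Sequence.IsRegular (MvPolynomial (Fin (2 * n) × Fin m) K) (sympList K n m) ∧
      ringKrullDim ((MvPolynomial (Fin (2 * n) × Fin m) K) ⧸
          Ideal.span {p : MvPolynomial (Fin (2 * n) × Fin m) K |
            ∃ i j : Fin m, i < j ∧ p = sympQuad K n m i j}) =
        (2 * n * m - m * (m - 1) / 2 : ℕ) := by
  obtain ⟨l, hl, hlen, hmap⟩ := exists_sympList_eq_map K n m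
  have hw : RingTheory.Sequence.IsWeaklyRegular (MvPolynomial (Fin (2 * n) × Fin m) K)
      (sympList K n m) := by
    rw [hmap]
    exact isWeaklyRegular_map_of_hasLeadMonomial (injective_elim_leadLeft_leadRight hmn)
      (hasLeadMonomial_sympQuad K hmn) hl
  have hlen' : (sympList K n m).length = m * (m - 1) / 2 := by rw [hmap, List.length_map, hlen]
  have hcc : ∀ g ∈ sympList K n m, constantCoeff g = 0 := by
    intro g hg
    obtain ⟨i, j, -, rfl⟩ := mem_sympList.1 hg
    exact constantCoeff_sympQuad K n m i j
  refine ⟨⟨hw, fun htop => ?_⟩, ?_⟩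
  · have hle : Ideal.ofList (sympList K n m) ≤ RingHom.ker constantCoeff :=
      Ideal.span_le.2 fun g hg => hcc g hg
    rw [smul_eq_mul, Ideal.mul_top] at htop
    have h1 : (1 : MvPolynomial (Fin (2 * n) × Fin m) K) ∈ Ideal.ofList (sympList K n m) :=
      htop ▸ Submodule.mem_top
    simpa using hle h1
  · have hset : {p | ∃ i j : Fin m, i < j ∧ p = sympQuad K n m i j} =
        {p | p ∈ sympList K n m} := Set.ext fun _ => mem_sympList.symm
    rw [hset]
    have hcard : Fintype.card (Fin (2 * n) × Fin m) = 2 * n * m := by simp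
    have upper := ringKrullDim_quotient_ofList_add_length_le _ hw
    have lower := card_le_ringKrullDim_quotient_ofList_add_length _ hcc
    rw [MvPolynomial.ringKrullDim_of_isNoetherianRing, ringKrullDim_eq_zero_of_field, zero_add,
      Nat.card_eq_fintype_card] at upper
    have heq := le_antisymm upper lower
    rw [hcard, hlen'] at heq
    exact eq_natCast_sub_of_add_natCast_eq heq
end
end

section
/- Let K be a field and let r, m, n be integers with 0 ≤ r ≤ m ≤ n. Let I_{r,m,n} ⊆ R = K[X_{k,i} : 1 ≤ k ≤ 2n, 1 ≤ i ≤ m] be the ideal generated by the quadrics x_{i,j} = Σ_{k=1}^{n} (X_{k,i} X_{n+k,j} − X_{n+k,i} X_{k,j}) for 1 ≤ i < j ≤ m together with all (r+1) × (r+1) minors of the generic matrix (X_{k,i}). Then I_{r,m,n} is a prime ideal of height (m−r)(2n−r) + r(r−1)/2, and the quotient ring R/I_{r,m,n} is an integrally closed domain. -/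
noncomputable section

open MvPolynomial

/-- The generic `N × m` matrix whose entries are the variables `X_{k,i}`. -/
def genMatrix (K : Type*) [Field K] (N m : ℕ) :
    Matrix (Fin N) (Fin m) (MvPolynomial (Fin N × Fin m) K) :=
  Matrix.of fun k i => X (k, i)

/-- The ideal `I_{r,m,n}` generated by the symplectic quadrics `x_{i,j}` (`i < j`) together
with all `(r+1) × (r+1)` minors of the generic matrix. -/
def sympIdeal (K : Type*) [Field K] (r m n : ℕ) :
    Ideal (MvPolynomial (Fin (2 * n) × Fin m) K) :=
  Ideal.span
    ({p | ∃ i j : Fin m, i < j ∧ p = sympQuad K n m i j} ∪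
      {d | ∃ (f : Fin (r + 1) → Fin (2 * n)) (g : Fin (r + 1) → Fin m),
        Function.Injective f ∧ Function.Injective g ∧
        d = ((genMatrix K (2 * n) m).submatrix f g).det})

namespace IsotropicMaps

section LinearAlgebra

variable {L : Type*} [Field L]

theorem minors_eq_zero_iff_finrank_span_le {ι κ : Type*} [Finite ι] (v : κ → ι → L) (S : Set κ)
    (q : ℕ) :
    (∀ (f : Fin (q + 1) → ι) (g : Fin (q + 1) → κ), (∀ i, g i ∈ S) →
      (Matrix.of fun i j => v (g j) (f i)).det = 0) ↔
      Module.finrank L (Submodule.span L (v '' S)) ≤ q := by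
  have := Fintype.ofFinite ι
  constructor
  · intro h
    by_contra! hq
    obtain ⟨b, hbS, -, hb⟩ := Submodule.exists_fun_fin_finrank_span_eq L (v '' S)
    choose g hgS hg using fun i : Fin (q + 1) => hbS (Fin.castLE hq i)
    have hvg : LinearIndependent L fun i => v (g i) := by
      simp only [hg]
      exact hb.comp _ (Fin.castLE_injective hq)
    let N : Matrix (Fin (q + 1)) ι L := Matrix.of fun i => v (g i)
    have hN : N.transpose.rank = q + 1 := by
      rw [Matrix.rank_transpose]
      have := LinearIndependent.rank_matrix (M := N) hvg
      simpa using this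
    rw [Matrix.rank_eq_finrank_span_row] at hN
    obtain ⟨c, hc, -, hcl⟩ := Submodule.exists_fun_fin_finrank_span_eq L
      (Set.range N.transpose.row)
    choose f hf using fun i : Fin (q + 1) => hc (Fin.cast hN.symm i)
    have hrows : LinearIndependent L (Matrix.of fun i j => v (g j) (f i)).row := by
      have : (Matrix.of fun i j => v (g j) (f i)).row = c ∘ Fin.cast hN.symm := by
        ext i j
        rw [Function.comp_apply, ← hf i]
        rfl
      rw [this]
      exact hcl.comp _ (Fin.cast_injective _)
    rw [Matrix.linearIndependent_rows_iff_isUnit, Matrix.isUnit_iff_isUnit_det, h f g hgS] at hrows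
    exact not_isUnit_zero hrows
  · intro h f g hg
    by_contra hdet
    have hu : IsUnit (Matrix.of fun i j => v (g j) (f i)) := by
      rw [Matrix.isUnit_iff_isUnit_det]
      exact isUnit_iff_ne_zero.mpr hdet
    rw [← Matrix.linearIndependent_cols_iff_isUnit] at hu
    have hvg : LinearIndependent L fun i => v (g i) :=
      LinearIndependent.of_comp (LinearMap.funLeft L L f) hu
    have h1 := finrank_span_eq_card hvg
    have h2 : Module.finrank L (Submodule.span L (Set.range fun i => v (g i))) ≤
        Module.finrank L (Submodule.span L (v '' S)) := by
      apply Submodule.finrank_mono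
      apply Submodule.span_mono
      rintro _ ⟨i, rfl⟩
      exact ⟨g i, hg i, rfl⟩
    simp only [Fintype.card_fin] at h1
    omega

/-- A flag of subspaces `W l ≤ X l` with `dim W l ≤ l` is generated by vectors adapted to the
flag `X`, when each step of `X` has codimension at most one. -/
theorem exists_adapted_vectors {V : Type*} [AddCommGroup V] [Module L V] [FiniteDimensional L V]
    (X : ℕ → Submodule L V) (hX : ∀ l, ∃ q, X (l + 1) ≤ X l ⊔ Submodule.span L {q})
    (r : ℕ) (W : ℕ → Submodule L V) (hW : ∀ l, l < r → W l ≤ W (l + 1))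
    (hWX : ∀ l, l ≤ r → W l ≤ X l) (hd : ∀ l, l ≤ r → Module.finrank L (W l) ≤ l) :
    ∃ u : ℕ → V, (∀ l, l < r → u l ∈ X (l + 1)) ∧
      ∀ l, l ≤ r → W l ≤ Submodule.span L (u '' Set.Iio l) := by
  classical
  induction r generalizing W with
  | zero =>
    refine ⟨0, by simp, fun l hl => ?_⟩
    obtain rfl : l = 0 := by omega
    have := hd 0 le_rfl
    rw [Nat.le_zero, Submodule.finrank_eq_zero] at this
    simp [this]
  | succ r ih =>
    obtain ⟨Z, y, hZY, hWZ, hZX, hZr, hy, hYZ⟩ : ∃ (Z : Submodule L V) (y : V),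
        Z ≤ W (r + 1) ∧ W r ≤ Z ∧ Z ≤ X r ∧ Module.finrank L Z ≤ r ∧ y ∈ W (r + 1) ∧
          W (r + 1) ≤ Z ⊔ Submodule.span L {y} := by
      have hr1 := hd (r + 1) le_rfl
      have hWW := hW r (by omega)
      rcases (inf_le_left : W (r + 1) ⊓ X r ≤ W (r + 1)).lt_or_eq with hlt | heq
      · obtain ⟨y, hyW, hy⟩ := SetLike.exists_of_lt hlt
        have hyX : y ∉ X r := fun h => hy ⟨hyW, h⟩
        refine ⟨W (r + 1) ⊓ X r, y, inf_le_left, le_inf hWW (hWX r (by omega)), inf_le_right,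
          ?_, hyW, ?_⟩
        · have := Submodule.finrank_lt_finrank_of_lt hlt
          omega
        · intro z hz
          obtain ⟨q, hq⟩ := hX r
          obtain ⟨y', hy', b, hb, hyb⟩ := Submodule.mem_sup.mp (hq (hWX _ le_rfl hyW))
          obtain ⟨z', hz', a, ha, hza⟩ := Submodule.mem_sup.mp (hq (hWX _ le_rfl hz))
          obtain ⟨b, rfl⟩ := Submodule.mem_span_singleton.mp hb
          obtain ⟨a, rfl⟩ := Submodule.mem_span_singleton.mp ha
          have hb0 : b ≠ 0 := by
            rintro rfl
            apply hyX
            rw [← hyb]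
            simpa using hy'
          have hmem : z - (a / b) • y ∈ W (r + 1) ⊓ X r := by
            refine ⟨sub_mem hz (Submodule.smul_mem _ _ hyW), ?_⟩
            have : z - (a / b) • y = z' - (a / b) • y' := by
              rw [← hyb, ← hza, smul_add, smul_smul, div_mul_cancel₀ _ hb0]
              abel
            rw [this]
            exact sub_mem hz' (Submodule.smul_mem _ _ hy')
          rw [← sub_add_cancel z ((a / b) • y)]
          exact Submodule.add_mem_sup hmem
            (Submodule.smul_mem _ _ (Submodule.mem_span_singleton_self y))
      · by_cases hdim : Module.finrank L (W (r + 1)) ≤ r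
        · exact ⟨W (r + 1), 0, le_rfl, hWW, inf_eq_left.mp heq, hdim, zero_mem _, le_sup_left⟩
        · have hne : W r < W (r + 1) := by
            refine lt_of_le_of_ne hWW fun h => hdim ?_
            rw [← h]
            exact hd r (by omega)
          obtain ⟨Z, hWZ, hZ⟩ := exists_le_covBy_of_lt hne
          obtain ⟨y, hyW, hy⟩ := SetLike.exists_of_lt hZ.lt
          refine ⟨Z, y, hZ.le, hWZ, hZ.le.trans (inf_eq_left.mp heq), ?_, hyW, ?_⟩
          · have := Submodule.finrank_lt_finrank_of_lt hZ.lt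
            omega
          · have h1 : Z < Z ⊔ Submodule.span L {y} := by
              refine lt_of_le_of_ne le_sup_left fun h => hy ?_
              rw [h]
              exact Submodule.mem_sup_right (Submodule.mem_span_singleton_self y)
            have h2 : Z ⊔ Submodule.span L {y} ≤ W (r + 1) :=
              sup_le hZ.le ((Submodule.span_singleton_le_iff_mem _ _).mpr hyW)
            exact (eq_of_le_of_not_lt h2 (hZ.2 h1)).ge
    obtain ⟨u, huX, hu⟩ := ih (fun l => if l = r then Z else W l)
      (by
        intro l hl
        have h1 := hW l (by omega)
        rw [if_neg (by omega)]
        split_ifs with h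
        · subst h; exact h1.trans hWZ
        · exact h1)
      (by
        intro l hl
        split_ifs with h
        · subst h; exact hZX
        · exact hWX l (by omega))
      (by
        intro l hl
        by_cases h : l = r
        · rw [if_pos h, h]; exact hZr
        · rw [if_neg h]; exact hd l (by omega))
    refine ⟨fun l => if l = r then y else u l, ?_, ?_⟩
    · intro l hl
      dsimp only
      split_ifs with h
      · subst h; exact hWX _ le_rfl hy
      · exact huX l (by omega)
    · have himg : ∀ l ≤ r, (fun l => if l = r then y else u l) '' Set.Iio l = u '' Set.Iio l := by
        intro l hl
        apply Set.image_congr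
        intro i hi
        have : i < l := hi
        rw [if_neg (by omega)]
      intro l hl
      rcases Nat.lt_or_ge r l with h | h
      · obtain rfl : l = r + 1 := by omega
        refine hYZ.trans (sup_le ?_ ?_)
        · have := hu r le_rfl
          rw [if_pos rfl, ← himg r le_rfl] at this
          exact this.trans (Submodule.span_mono (Set.image_mono
            (Set.Iio_subset_Iio (Nat.le_succ r))))
        · rw [Submodule.span_singleton_le_iff_mem]
          exact Submodule.subset_span ⟨r, by simp, by simp⟩
      · rw [himg l h]
        have := hu l h
        refine le_trans ?_ this
        split_ifs with h
        · subst h; exact hWZ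
        · exact le_rfl

end LinearAlgebra

section Symp

variable {n : ℕ} {A B : Type*} [CommRing A] [CommRing B]

/-- The standard symplectic form, with rows indexed by `Fin n ⊕ Fin n`. -/
def symp : (Fin n ⊕ Fin n → A) →ₗ[A] (Fin n ⊕ Fin n → A) →ₗ[A] A :=
  LinearMap.mk₂ A
    (fun u w => ∑ k, (u (Sum.inl k) * w (Sum.inr k) - u (Sum.inr k) * w (Sum.inl k)))
    (fun u u' w => by
      rw [← Finset.sum_add_distrib]
      exact Finset.sum_congr rfl fun k _ => by simp only [Pi.add_apply]; ring)
    (fun c u w => by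
      rw [smul_eq_mul, Finset.mul_sum]
      exact Finset.sum_congr rfl fun k _ => by simp only [Pi.smul_apply, smul_eq_mul]; ring)
    (fun u w w' => by
      rw [← Finset.sum_add_distrib]
      exact Finset.sum_congr rfl fun k _ => by simp only [Pi.add_apply]; ring)
    (fun c u w => by
      rw [smul_eq_mul, Finset.mul_sum]
      exact Finset.sum_congr rfl fun k _ => by simp only [Pi.smul_apply, smul_eq_mul]; ring)

theorem symp_apply (u w : Fin n ⊕ Fin n → A) :
    symp u w = ∑ k, (u (Sum.inl k) * w (Sum.inr k) - u (Sum.inr k) * w (Sum.inl k)) :=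
  rfl

@[simp]
theorem symp_self (u : Fin n ⊕ Fin n → A) : symp u u = 0 := by
  rw [symp_apply]
  exact Finset.sum_eq_zero fun k _ => by ring

theorem symp_swap (u w : Fin n ⊕ Fin n → A) : symp u w = -symp w u := by
  rw [symp_apply, symp_apply, ← Finset.sum_neg_distrib]
  exact Finset.sum_congr rfl fun k _ => by ring

theorem symp_map (φ : A →+* B) (u w : Fin n ⊕ Fin n → A) :
    symp (fun r => φ (u r)) (fun r => φ (w r)) = φ (symp u w) := by
  simp [symp_apply]

theorem symp_single_inr (u : Fin n ⊕ Fin n → A) (p : Fin n) :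
    symp u (Pi.single (Sum.inr p) 1) = u (Sum.inl p) := by
  rw [symp_apply, Finset.sum_eq_single p]
  · simp
  · intro b _ hb
    simp [hb]
  · simp

theorem symp_single_inl (u : Fin n ⊕ Fin n → A) (p : Fin n) :
    symp u (Pi.single (Sum.inl p) 1) = -u (Sum.inr p) := by
  rw [symp_apply, Finset.sum_eq_single p]
  · simp
  · intro b _ hb
    simp [hb]
  · simp

/-- The index of the hyperbolic pair to which a row belongs. -/
def pairIdx : Fin n ⊕ Fin n → ℕ :=
  Sum.elim Fin.val Fin.val

@[simp]
theorem pairIdx_inl (k : Fin n) : pairIdx (Sum.inl k : Fin n ⊕ Fin n) = k := rfl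

@[simp]
theorem pairIdx_inr (k : Fin n) : pairIdx (Sum.inr k : Fin n ⊕ Fin n) = k := rfl

theorem pairIdx_lt (r : Fin n ⊕ Fin n) : pairIdx r < n := by
  cases r <;> simp

/-- The vectors supported on the first `p` hyperbolic pairs. -/
def low (n : ℕ) (A : Type*) [CommRing A] (p : ℕ) : Submodule A (Fin n ⊕ Fin n → A) where
  carrier := {u | ∀ r, p ≤ pairIdx r → u r = 0}
  add_mem' hu hw r hr := by simp [hu r hr, hw r hr]
  zero_mem' := by simp
  smul_mem' c u hu r hr := by simp [hu r hr]

theorem mem_low {p : ℕ} {u : Fin n ⊕ Fin n → A} :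
    u ∈ low n A p ↔ ∀ r, p ≤ pairIdx r → u r = 0 :=
  Iff.rfl

/-- Truncation of a vector to the first `p` hyperbolic pairs. -/
def trunc (p : ℕ) : (Fin n ⊕ Fin n → A) →ₗ[A] (Fin n ⊕ Fin n → A) :=
  LinearMap.pi fun r => if pairIdx r < p then LinearMap.proj r else 0

theorem trunc_apply (p : ℕ) (u : Fin n ⊕ Fin n → A) (r : Fin n ⊕ Fin n) :
    trunc p u r = if pairIdx r < p then u r else 0 := by
  rw [trunc, LinearMap.pi_apply]
  split_ifs <;> rfl

theorem trunc_inl (p : ℕ) (u : Fin n ⊕ Fin n → A) (k : Fin n) :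
    trunc p u (Sum.inl k) = if (k : ℕ) < p then u (Sum.inl k) else 0 := by
  rw [trunc_apply]
  rfl

theorem trunc_inr (p : ℕ) (u : Fin n ⊕ Fin n → A) (k : Fin n) :
    trunc p u (Sum.inr k) = if (k : ℕ) < p then u (Sum.inr k) else 0 := by
  rw [trunc_apply]
  rfl

theorem trunc_mem_low (p : ℕ) (u : Fin n ⊕ Fin n → A) : trunc p u ∈ low n A p := by
  intro r hr
  rw [trunc_apply, if_neg (by omega)]

theorem symp_trunc_right {p : ℕ} {u : Fin n ⊕ Fin n → A} (hu : u ∈ low n A p)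
    (w : Fin n ⊕ Fin n → A) : symp u (trunc p w) = symp u w := by
  simp only [symp_apply, trunc_inl, trunc_inr]
  refine Finset.sum_congr rfl fun k _ => ?_
  split_ifs with h
  · rfl
  · rw [hu (Sum.inl k) (by simpa using h), hu (Sum.inr k) (by simpa using h)]
    ring

theorem symp_trunc_left {p : ℕ} {w : Fin n ⊕ Fin n → A} (hw : w ∈ low n A p)
    (u : Fin n ⊕ Fin n → A) : symp (trunc p u) w = symp u w := by
  rw [symp_swap, symp_trunc_right hw, ← symp_swap]

/-- The form of vectors supported on the first `p + 1` pairs, with the last pair split off. -/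
theorem symp_eq_of_mem_low (P : Fin n) {u : Fin n ⊕ Fin n → A} (hu : u ∈ low n A (P + 1))
    (w : Fin n ⊕ Fin n → A) :
    symp u w = u (Sum.inl P) * w (Sum.inr P) - u (Sum.inr P) * w (Sum.inl P) +
      symp (trunc P u) (trunc P w) := by
  simp only [symp_apply, trunc_inl, trunc_inr]
  rw [← Finset.add_sum_erase _ _ (Finset.mem_univ P), ← Finset.add_sum_erase (a := P) _
    (fun k : Fin n => _ - _) (Finset.mem_univ P)]
  rw [if_neg (lt_irrefl _), zero_mul, if_neg (lt_irrefl _), zero_mul, sub_zero, zero_add]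
  congr 1
  refine Finset.sum_congr rfl fun k hk => ?_
  have hkP : (k : ℕ) ≠ P := fun h => (Finset.mem_erase.mp hk).1 (Fin.ext h)
  split_ifs with h
  · rfl
  · rw [hu (Sum.inl k) (by simp; omega), hu (Sum.inr k) (by simp; omega)]
    ring

end Symp

section Points

variable {n m : ℕ} {A B : Type*} [CommRing A] [CommRing B]

/-- A matrix, given by its columns `v j`, satisfying the equations of the degeneracy condition:
the columns are pairwise orthogonal, the `(ρ l + 1)`-minors of the first `l` columns vanish,
and so do the entries in the set `Z`. -/
structure IsPoint (ρ : ℕ → ℕ) (Z : Set ((Fin n ⊕ Fin n) × Fin m))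
    (v : Fin m → Fin n ⊕ Fin n → A) : Prop where
  isotropic : ∀ i j, symp (v i) (v j) = 0
  minors : ∀ (l : ℕ) (f : Fin (ρ l + 1) → Fin n ⊕ Fin n) (g : Fin (ρ l + 1) → Fin m),
    (∀ i, (g i : ℕ) < l) → (Matrix.of fun i j => v (g j) (f i)).det = 0
  zero : ∀ s ∈ Z, v s.2 s.1 = 0

theorem det_map_of {q : ℕ} (φ : A →+* B) (v : Fin m → Fin n ⊕ Fin n → A)
    (f : Fin q → Fin n ⊕ Fin n) (g : Fin q → Fin m) :
    (Matrix.of fun i j => φ (v (g j) (f i))).det = φ (Matrix.of fun i j => v (g j) (f i)).det := by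
  rw [RingHom.map_det]
  rfl

theorem IsPoint.map {ρ : ℕ → ℕ} {Z : Set ((Fin n ⊕ Fin n) × Fin m)}
    {v : Fin m → Fin n ⊕ Fin n → A} (h : IsPoint ρ Z v) (φ : A →+* B) :
    IsPoint ρ Z fun j r => φ (v j r) where
  isotropic i j := by rw [symp_map, h.isotropic, map_zero]
  minors l f g hg := by rw [det_map_of, h.minors l f g hg, map_zero]
  zero s hs := by rw [h.zero s hs, map_zero]

theorem IsPoint.mono {ρ : ℕ → ℕ} {Z Z' : Set ((Fin n ⊕ Fin n) × Fin m)} (hZ : Z ⊆ Z')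
    {v : Fin m → Fin n ⊕ Fin n → A} (h : IsPoint ρ Z' v) : IsPoint ρ Z v :=
  ⟨h.isotropic, h.minors, fun s hs => h.zero s (hZ hs)⟩

/-- Over a field the minor conditions are rank conditions. -/
theorem isPoint_iff {L : Type*} [Field L] {ρ : ℕ → ℕ} {Z : Set ((Fin n ⊕ Fin n) × Fin m)}
    {v : Fin m → Fin n ⊕ Fin n → L} :
    IsPoint ρ Z v ↔ (∀ i j, symp (v i) (v j) = 0) ∧
      (∀ l, Module.finrank L (Submodule.span L (v '' {j | (j : ℕ) < l})) ≤ ρ l) ∧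
      ∀ s ∈ Z, v s.2 s.1 = 0 := by
  constructor
  · intro h
    exact ⟨h.isotropic,
      fun l => (minors_eq_zero_iff_finrank_span_le v {j | (j : ℕ) < l} (ρ l)).mp (h.minors l),
      h.zero⟩
  · rintro ⟨h1, h2, h3⟩
    exact ⟨h1, fun l =>
      (minors_eq_zero_iff_finrank_span_le v {j | (j : ℕ) < l} (ρ l)).mpr (h2 l), h3⟩

variable (K : Type*) [Field K]

/-- The ideal of the locus described by `IsPoint ρ Z`. -/
def locusIdeal (ρ : ℕ → ℕ) (Z : Set ((Fin n ⊕ Fin n) × Fin m)) :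
    Ideal (MvPolynomial ((Fin n ⊕ Fin n) × Fin m) K) :=
  Ideal.span
    ({p | ∃ i j : Fin m, p = symp (fun r => X (r, i)) (fun r => X (r, j))} ∪
      {p | ∃ (l : ℕ) (f : Fin (ρ l + 1) → Fin n ⊕ Fin n) (g : Fin (ρ l + 1) → Fin m),
        (∀ i, (g i : ℕ) < l) ∧ p = (Matrix.of fun i j => X (f i, g j)).det} ∪
      X '' Z)

variable {K} {ρ : ℕ → ℕ} {Z : Set ((Fin n ⊕ Fin n) × Fin m)}

theorem locusIdeal_le_iff (I : Submodule (MvPolynomial ((Fin n ⊕ Fin n) × Fin m) K)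
      (MvPolynomial ((Fin n ⊕ Fin n) × Fin m) K)) :
    locusIdeal K ρ Z ≤ I ↔
      (∀ i j : Fin m, symp (fun r => X (r, i)) (fun r => X (r, j)) ∈ I) ∧
      (∀ (l : ℕ) (f : Fin (ρ l + 1) → Fin n ⊕ Fin n) (g : Fin (ρ l + 1) → Fin m),
        (∀ i, (g i : ℕ) < l) → (Matrix.of fun i j => X (f i, g j)).det ∈ I) ∧
      ∀ s ∈ Z, X s ∈ I := by
  rw [locusIdeal, Ideal.span, Submodule.span_le]
  constructor
  · intro h
    refine ⟨fun i j => h (Or.inl (Or.inl ⟨i, j, rfl⟩)),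
      fun l f g hg => h (Or.inl (Or.inr ⟨l, f, g, hg, rfl⟩)),
      fun s hs => h (Or.inr ⟨s, hs, rfl⟩)⟩
  · rintro ⟨h1, h2, h3⟩ p ((⟨i, j, rfl⟩ | ⟨l, f, g, hg, rfl⟩) | ⟨s, hs, rfl⟩)
    · exact h1 i j
    · exact h2 l f g hg
    · exact h3 s hs

theorem locusIdeal_le_ker_iff (φ : MvPolynomial ((Fin n ⊕ Fin n) × Fin m) K →+* A) :
    locusIdeal K ρ Z ≤ RingHom.ker φ ↔ IsPoint ρ Z fun j r => φ (X (r, j)) := by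
  rw [locusIdeal_le_iff]
  simp only [RingHom.mem_ker]
  constructor
  · rintro ⟨h1, h2, h3⟩
    refine ⟨fun i j => ?_, fun l f g hg => ?_, h3⟩
    · rw [symp_map, h1]
    · rw [det_map_of φ (fun j r => X (r, j)), h2 l f g hg]
  · intro h
    refine ⟨fun i j => ?_, fun l f g hg => ?_, h.zero⟩
    · rw [← symp_map]
      exact h.isotropic i j
    · rw [← det_map_of φ (fun j r => X (r, j))]
      exact h.minors l f g hg

theorem isPoint_mk {I : Ideal (MvPolynomial ((Fin n ⊕ Fin n) × Fin m) K)}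
    (hI : locusIdeal K ρ Z ≤ I) :
    IsPoint ρ Z fun j r => Ideal.Quotient.mk I (X (r, j)) := by
  rw [← locusIdeal_le_ker_iff, Ideal.mk_ker]
  exact hI

attribute [local instance] MvPolynomial.gradedAlgebra

theorem locusIdeal_isHomogeneous (ρ : ℕ → ℕ) (Z : Set ((Fin n ⊕ Fin n) × Fin m)) :
    (locusIdeal K ρ Z).IsHomogeneous (homogeneousSubmodule ((Fin n ⊕ Fin n) × Fin m) K) := by
  apply Ideal.homogeneous_span
  rintro p ((⟨i, j, rfl⟩ | ⟨l, f, g, hg, rfl⟩) | ⟨s, hs, rfl⟩)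
  · refine ⟨2, ?_⟩
    rw [mem_homogeneousSubmodule, symp_apply]
    refine IsHomogeneous.sum _ _ _ fun k _ => IsHomogeneous.sub ?_ ?_ <;>
    exact (isHomogeneous_X _ _).mul (isHomogeneous_X _ _)
  · refine ⟨ρ l + 1, ?_⟩
    rw [mem_homogeneousSubmodule, Matrix.det_apply]
    refine IsHomogeneous.sum _ _ _ fun σ _ => ?_
    have h := IsHomogeneous.prod (R := K) (Finset.univ : Finset (Fin (ρ l + 1)))
      (fun i => X (f (σ i), g i)) (fun _ => 1) (fun i _ => isHomogeneous_X _ _)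
    rw [Units.smul_def]
    have h' := Submodule.smul_of_tower_mem (homogeneousSubmodule ((Fin n ⊕ Fin n) × Fin m) K
      (ρ l + 1)) ((Equiv.Perm.sign σ : ℤˣ) : ℤ) ((mem_homogeneousSubmodule _ _).mpr
        (by simpa using h))
    exact (mem_homogeneousSubmodule _ _).mp h'
  · exact ⟨1, (mem_homogeneousSubmodule _ _).mpr (isHomogeneous_X _ _)⟩

end Points

section Radical

universe u

variable {σ : Type*} {K : Type u} [Field K]

theorem homogeneousComponent_X_mul (i : σ) (q : MvPolynomial σ K) (d : ℕ) :
    homogeneousComponent (d + 1) (X i * q) = X i * homogeneousComponent d q := by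
  classical
  ext s
  rw [coeff_homogeneousComponent, coeff_X_mul', coeff_X_mul', coeff_homogeneousComponent]
  by_cases hs : i ∈ s.support
  · have h1 : Finsupp.single i 1 ≤ s := by
      rw [Finsupp.single_le_iff, Nat.one_le_iff_ne_zero]
      exact Finsupp.mem_support_iff.mp hs
    have h2 : s.degree = (s - Finsupp.single i 1).degree + 1 := by
      conv_lhs => rw [← tsub_add_cancel_of_le h1]
      simp
    simp [hs, h2]
  · simp [hs]

attribute [local instance] MvPolynomial.gradedAlgebra

/-- A homogeneous ideal with prime radical is radical if it becomes radical after adding a variable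
outside of its radical. -/
theorem isRadical_of_isHomogeneous {J : Ideal (MvPolynomial σ K)}
    (hJ : J.IsHomogeneous (homogeneousSubmodule σ K)) (hP : J.radical.IsPrime) {i : σ}
    (hi : X i ∉ J.radical) (hrad : (J ⊔ Ideal.span {X i}).IsRadical) : J.IsRadical := by
  have key : ∀ d, ∀ u ∈ J.radical, u.IsHomogeneous d → u ∈ J := by
    intro d
    induction d with
    | zero =>
      intro u hu hd
      rw [← totalDegree_zero_iff_isHomogeneous, totalDegree_eq_zero_iff_eq_C] at hd
      by_contra hne
      refine hP.ne_top ((Ideal.eq_top_iff_one _).mpr ?_)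
      have h0 : coeff 0 u ≠ 0 := by
        intro h0
        apply hne
        rw [hd, h0, C_0]
        exact zero_mem _
      have : (1 : MvPolynomial σ K) = C (coeff 0 u)⁻¹ * u := by
        conv_rhs => rw [hd]
        rw [coeff_zero_C, ← C_mul, inv_mul_cancel₀ h0, C_1]
      rw [this]
      exact Ideal.mul_mem_left _ _ hu
    | succ d ih =>
      intro u hu hd
      have h1 : u ∈ J ⊔ Ideal.span {X i} :=
        hrad.radical ▸ Ideal.radical_mono le_sup_left hu
      obtain ⟨j, hj, y, hy, hjy⟩ := Submodule.mem_sup.mp h1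
      obtain ⟨q, rfl⟩ := Ideal.mem_span_singleton.mp hy
      have h2 : u = homogeneousComponent (d + 1) j + X i * homogeneousComponent d q := by
        rw [← homogeneousComponent_X_mul, ← map_add, hjy]
        exact (homogeneousComponent_of_mem ((mem_homogeneousSubmodule _ _).mpr hd)).symm ▸
          (if_pos rfl).symm
      have h3 : homogeneousComponent (d + 1) j ∈ J := by
        have := hJ (d + 1) hj
        rwa [← decomposition.decompose'_apply]
      have h4 : X i * homogeneousComponent d q ∈ J.radical := by
        rw [← sub_eq_iff_eq_add'.mpr h2]
        exact sub_mem hu (Ideal.le_radical h3)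
      have h5 := ih _ ((hP.mem_or_mem h4).resolve_left hi) (homogeneousComponent_isHomogeneous _ _)
      rw [h2]
      exact add_mem h3 (Ideal.mul_mem_left _ _ h5)
  intro u hu
  rw [← sum_homogeneousComponent u]
  refine sum_mem fun d _ => key d _ ?_ (homogeneousComponent_isHomogeneous _ _)
  have := hJ.radical d hu
  rwa [← decomposition.decompose'_apply]

theorem isRadical_of_mul_mem {R : Type*} [CommRing R] {J J' : Ideal R} (hJJ : J ≤ J')
    (hP : J'.IsPrime) {x : R} (hx : x ∉ J') (hmul : ∀ y ∈ J', x * y ∈ J)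
    (hrad : (J ⊔ Ideal.span {x}).IsRadical) : J.IsRadical := by
  intro f hf
  have h1 : f ∈ J ⊔ Ideal.span {x} := hrad.radical ▸ Ideal.radical_mono le_sup_left hf
  have h2 : f ∈ J' := hP.isRadical.radical ▸ Ideal.radical_mono hJJ hf
  obtain ⟨j, hj, y, hy, hjy⟩ := Submodule.mem_sup.mp h1
  obtain ⟨q, rfl⟩ := Ideal.mem_span_singleton.mp hy
  have h3 : x * q ∈ J' := by
    rw [← sub_eq_iff_eq_add'.mpr hjy.symm]
    exact sub_mem h2 (hJJ hj)
  rw [← hjy]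
  exact add_mem hj (hmul _ ((hP.mem_or_mem h3).resolve_left hx))

theorem mem_radical_of_forall_field {τ : Type} {J : Ideal (MvPolynomial τ K)}
    {f : MvPolynomial τ K}
    (h : ∀ (L : Type u) [Field L] [Algebra K L] (v : MvPolynomial τ K →ₐ[K] L),
      J ≤ RingHom.ker (v : MvPolynomial τ K →+* L) → v f = 0) : f ∈ J.radical := by
  rw [Ideal.radical_eq_sInf, Ideal.mem_sInf]
  rintro P ⟨hJP, hP⟩
  let v : MvPolynomial τ K →ₐ[K] FractionRing (MvPolynomial τ K ⧸ P) :=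
    (IsScalarTower.toAlgHom K (MvPolynomial τ K ⧸ P) _).comp (Ideal.Quotient.mkₐ K P)
  have hv : ∀ g, v g = 0 ↔ g ∈ P := by
    intro g
    have : v g = algebraMap (MvPolynomial τ K ⧸ P) (FractionRing (MvPolynomial τ K ⧸ P))
      (Ideal.Quotient.mk P g) := rfl
    rw [this, map_eq_zero_iff _ (IsFractionRing.injective _ _), Ideal.Quotient.eq_zero_iff_mem]
  rw [← hv]
  exact h _ v fun g hg => (hv g).mpr (hJP hg)

/-- The radical of an ideal is prime if its zero locus has a generic point. -/
theorem radical_eq_ker_of_generic {τ : Type} {J : Ideal (MvPolynomial τ K)} {D : Type u}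
    [CommRing D] [IsDomain D] [Algebra K D] (Φ : MvPolynomial τ K →ₐ[K] D)
    (hΦ : J ≤ RingHom.ker (Φ : MvPolynomial τ K →+* D))
    (h : ∀ (L : Type u) [Field L] [Algebra K L] (v : MvPolynomial τ K →ₐ[K] L),
      J ≤ RingHom.ker (v : MvPolynomial τ K →+* L) → ∀ f, Φ f = 0 → v f = 0) :
    J.radical = RingHom.ker (Φ : MvPolynomial τ K →+* D) := by
  refine le_antisymm ?_ fun f hf => mem_radical_of_forall_field fun L _ _ v hv => h L v hv f hf
  rw [← (RingHom.ker_isPrime (Φ : MvPolynomial τ K →+* D)).isRadical.radical]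
  exact Ideal.radical_mono hΦ

end Radical

section Minors

variable {ι κ A : Type*} [CommRing A]

/-- All `q`-minors of the columns `v j`, `j ∈ S`, vanish. -/
def MinorsVanish (v : κ → ι → A) (q : ℕ) (S : Set κ) : Prop :=
  ∀ (f : Fin q → ι) (g : Fin q → κ), (∀ i, g i ∈ S) → (Matrix.of fun i j => v (g j) (f i)).det = 0

theorem MinorsVanish.insert {v : κ → ι → A} {q : ℕ} {S : Set κ} (h : MinorsVanish v q S) (a : κ) :
    MinorsVanish v (q + 1) (insert a S) := by
  intro f g hg
  have expand : ∀ j₀, (∀ j, j ≠ j₀ → g j ∈ S) →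
      (Matrix.of fun i j => v (g j) (f i)).det = 0 := by
    intro j₀ hj
    rw [Matrix.det_succ_column _ j₀]
    refine Finset.sum_eq_zero fun i _ => ?_
    have := h (fun i' => f (i.succAbove i')) (fun j => g (j₀.succAbove j))
      fun j => hj _ (Fin.succAbove_ne _ _)
    have h' : ((Matrix.of fun i j => v (g j) (f i)).submatrix i.succAbove j₀.succAbove).det = 0 :=
      this
    rw [h', mul_zero]
  by_cases h0 : ∃ j₀, g j₀ ∉ S
  · obtain ⟨j₀, hj₀⟩ := h0
    by_cases h1 : ∃ j₁, j₁ ≠ j₀ ∧ g j₁ ∉ S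
    · obtain ⟨j₁, hne, hj₁⟩ := h1
      refine Matrix.det_zero_of_column_eq hne fun i => ?_
      have e0 := (hg j₀).resolve_right hj₀
      have e1 := (hg j₁).resolve_right hj₁
      simp [e0, e1]
    · push Not at h1
      exact expand j₀ h1
  · push Not at h0
    exact expand 0 fun j _ => h0 j

theorem MinorsVanish.mono {v : κ → ι → A} {q : ℕ} {S T : Set κ} (h : MinorsVanish v q S)
    (hT : T ⊆ S) : MinorsVanish v q T :=
  fun f g hg => h f g fun i => hT (hg i)

theorem MinorsVanish.of_le {v : κ → ι → A} {q q' : ℕ} {S : Set κ} (h : MinorsVanish v q S)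
    (hq : q ≤ q') : MinorsVanish v q' S := by
  induction q', hq using Nat.le_induction with
  | base => exact h
  | succ p _ ih =>
    intro f g hg
    exact (ih.insert (g 0)).mono (Set.subset_insert _ _) f g hg

theorem MinorsVanish.add_columns {m : ℕ} {v : Fin m → ι → A} {q k : ℕ}
    (h : MinorsVanish v q {j | (j : ℕ) < k}) (d : ℕ) :
    MinorsVanish v (q + d) {j | (j : ℕ) < k + d} := by
  induction d with
  | zero => exact h
  | succ d ih =>
    by_cases hk : k + d < m
    · refine (ih.insert ⟨k + d, hk⟩).mono fun j hj => ?_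
      have hj' : (j : ℕ) < k + (d + 1) := hj
      by_cases hjk : (j : ℕ) = k + d
      · exact Or.inl (Fin.ext hjk)
      · exact Or.inr (show (j : ℕ) < k + d by omega)
    · refine (ih.of_le (Nat.le_succ _)).mono fun j hj => ?_
      have := j.2
      exact (show (j : ℕ) < k + d by omega)

end Minors

theorem minorsVanish_of_eq_sum {D : Type*} [CommRing D] [IsDomain D] {ι κ : Type*} [Finite ι]
    {v : κ → ι → D} {S : Set κ} {q : ℕ} (U : ℕ → ι → D) (c : κ → ℕ → D)
    (h : ∀ j ∈ S, ∃ t ≤ q, v j = ∑ l ∈ Finset.range t, c j l • U l) :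
    MinorsVanish v (q + 1) S := by
  classical
  let F := FractionRing D
  let w : κ → ι → F := fun j r => algebraMap D F (v j r)
  have hw : Module.finrank F (Submodule.span F (w '' S)) ≤ q := by
    let U' : Fin q → ι → F := fun l r => algebraMap D F (U l r)
    have h1 : Submodule.span F (w '' S) ≤ Submodule.span F (Set.range U') := by
      rw [Submodule.span_le]
      rintro _ ⟨j, hj, rfl⟩
      obtain ⟨t, ht, hv⟩ := h j hj
      have : w j = ∑ l ∈ Finset.range t, algebraMap D F (c j l) •
          fun r => algebraMap D F (U l r) := by
        ext r
        simp [w, hv, Finset.sum_apply, Algebra.smul_def, map_mul]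
      rw [this]
      refine sum_mem fun l hl => Submodule.smul_mem _ _ (Submodule.subset_span ?_)
      exact ⟨⟨l, (Finset.mem_range.mp hl).trans_le ht⟩, rfl⟩
    have := Fintype.ofFinite ι
    refine (Submodule.finrank_mono h1).trans ?_
    have h2 := finrank_range_le_card (R := F) U'
    rwa [Fintype.card_fin] at h2
  rw [← minors_eq_zero_iff_finrank_span_le] at hw
  intro f g hg
  apply IsFractionRing.injective D F
  rw [map_zero, RingHom.map_det]
  exact hw f g hg

/-- An isotropic frame of `p + 1` vectors gives rise to a family of points of the degeneracy locus
containing all points whose columns lie in the span of a specialization of the frame. -/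
theorem exists_generic_of_frame {K : Type u} [Field K] {n m p : ℕ} {ρ : ℕ → ℕ}
    (hρ : Monotone ρ) (h0 : ρ 0 = 0) {k s : ℕ} (hk : ρ k = s)
    (hk1 : ρ (k + 1) = s + 1) (Z : Set ((Fin n ⊕ Fin n) × Fin m)) {D : Type u} [CommRing D]
    [IsDomain D] [Algebra K D] (q : Option (Fin p) → Fin n ⊕ Fin n → D)
    (hq : ∀ a b, symp (q a) (q b) = 0) (hZ : ∀ x ∈ Z, ∀ i, q (some i) x.1 = 0)
    (hZ' : ∀ x ∈ Z, k ≤ (x.2 : ℕ) → q none x.1 = 0) :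
    ∃ (D' : Type u) (_ : CommRing D') (_ : IsDomain D') (_ : Algebra K D')
      (A : Fin m → Fin n ⊕ Fin n → D'), IsPoint ρ Z A ∧
      ∀ (L : Type u) [Field L] [Algebra K L] (φ : D →ₐ[K] L) (v : Fin m → Fin n ⊕ Fin n → L),
        IsPoint ρ Z v →
        (∀ j : Fin m, (j : ℕ) < k →
          v j ∈ Submodule.span L (Set.range fun i r => φ (q (some i) r))) →
        (∀ j, v j ∈ Submodule.span L (Set.range fun o r => φ (q o r))) →
        ∃ ψ : D' →ₐ[K] L, ∀ j r, ψ (A j r) = v j r := by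
  classical
  let D' := MvPolynomial ((ℕ × Option (Fin p)) ⊕ (Fin m × ℕ)) D
  let c : ℕ → Option (Fin p) → D' := fun l o =>
    if o = none ∧ l < s then 0 else X (Sum.inl (l, o))
  let U : ℕ → Fin n ⊕ Fin n → D' := fun l => ∑ o, c l o • fun r => C (q o r)
  let A : Fin m → Fin n ⊕ Fin n → D' := fun j =>
    ∑ l ∈ Finset.range (ρ (j + 1)), (X (Sum.inr (j, l)) : D') • U l
  refine ⟨D', inferInstance, inferInstance, inferInstance, A, ⟨?_, ?_, ?_⟩, ?_⟩
  · intro i j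
    have hU : ∀ l l', symp (U l) (U l') = 0 := by
      intro l l'
      simp [U, map_sum, LinearMap.sum_apply, symp_map, hq]
    simp [A, map_sum, LinearMap.sum_apply, hU]
  · intro l
    exact minorsVanish_of_eq_sum (S := {j : Fin m | (j : ℕ) < l}) U
      (fun j l => X (Sum.inr (j, l))) fun j hj => ⟨ρ (j + 1), hρ hj, rfl⟩
  · intro x hx
    simp only [A, U, Finset.sum_apply, Pi.smul_apply, smul_eq_mul]
    refine Finset.sum_eq_zero fun l hl => ?_
    rw [Finset.sum_eq_zero, mul_zero]
    rintro (_ | i) _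
    · by_cases hkx : k ≤ (x.2 : ℕ)
      · rw [hZ' x hx hkx, C_0, mul_zero]
      · have hl' : l < s := by
          have h1 := Finset.mem_range.mp hl
          have h2 : ρ (x.2 + 1) ≤ ρ k := hρ (by omega)
          omega
        simp [c, hl']
    · rw [hZ x hx i, C_0, mul_zero]
  · intro L _ _ φ v hv hvk hvall
    obtain ⟨hvi, hvr, hvZ⟩ := isPoint_iff.mp hv
    let q' : Option (Fin p) → Fin n ⊕ Fin n → L := fun o r => φ (q o r)
    let Xs : ℕ → Submodule L (Fin n ⊕ Fin n → L) := fun l =>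
      if l ≤ s then Submodule.span L (Set.range fun i => q' (some i))
      else Submodule.span L (Set.range q')
    have hXs : ∀ l, ∃ y, Xs (l + 1) ≤ Xs l ⊔ Submodule.span L {y} := by
      intro l
      refine ⟨q' none, ?_⟩
      have hall : Submodule.span L (Set.range q') ≤
          Submodule.span L (Set.range fun i => q' (some i)) ⊔ Submodule.span L {q' none} := by
        rw [Submodule.span_le]
        rintro _ ⟨(_ | i), rfl⟩
        · exact Submodule.mem_sup_right (Submodule.mem_span_singleton_self _)
        · exact Submodule.mem_sup_left (Submodule.subset_span ⟨i, rfl⟩)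
      by_cases h1 : l + 1 ≤ s
      · simp only [Xs]
        rw [if_pos h1, if_pos (by omega)]
        exact le_sup_left
      · by_cases h2 : l ≤ s
        · simp only [Xs]
          rw [if_neg h1, if_pos h2]
          exact hall
        · simp only [Xs]
          rw [if_neg h1, if_neg h2]
          exact le_sup_left
    let W : ℕ → Submodule L (Fin n ⊕ Fin n → L) := fun l =>
      Submodule.span L (v '' {j | ρ (j + 1) ≤ l})
    obtain ⟨y, hyX, hyW⟩ := exists_adapted_vectors Xs hXs (ρ m) W
      (fun l _ => Submodule.span_mono (Set.image_mono fun j hj => le_trans hj (Nat.le_succ l)))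
      (by
        intro l _
        rw [Submodule.span_le]
        rintro _ ⟨j, hj, rfl⟩
        have hj' : ρ (j + 1) ≤ l := hj
        simp only [Xs]
        split_ifs with hl
        · refine hvk j ?_
          by_contra hjk
          have : ρ (k + 1) ≤ ρ (j + 1) := hρ (by omega)
          omega
        · exact hvall j)
      (by
        intro l _
        have hJ := Nat.findGreatest_spec (P := fun J => ρ J ≤ l) (n := m) (Nat.zero_le m)
          (by rw [h0]; exact Nat.zero_le l)
        refine le_trans ?_ ((hvr (Nat.findGreatest (fun J => ρ J ≤ l) m)).trans hJ)
        refine Submodule.finrank_mono (Submodule.span_mono (Set.image_mono fun j hj => ?_))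
        exact Nat.le_findGreatest (P := fun J => ρ J ≤ l) (n := m) j.2 hj)
    have ha : ∀ l, ∃ a : Option (Fin p) → L, (l < ρ m → y l = ∑ o, a o • q' o) ∧
        (l < s → a none = 0) := by
      intro l
      by_cases hl : l < ρ m
      · have hyl := hyX l hl
        simp only [Xs] at hyl
        split_ifs at hyl with hls
        · obtain ⟨a, ha⟩ := (Submodule.mem_span_range_iff_exists_fun L).mp hyl
          refine ⟨fun o => o.elim 0 a, fun _ => ?_, fun _ => rfl⟩
          rw [← ha, Fintype.sum_option]
          simp
        · obtain ⟨a, ha⟩ := (Submodule.mem_span_range_iff_exists_fun L).mp hyl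
          exact ⟨a, fun _ => ha.symm, fun h => absurd h (by omega)⟩
      · exact ⟨0, fun h => absurd h hl, fun _ => rfl⟩
    choose a ha ha0 using ha
    have hb : ∀ j : Fin m, ∃ b : ℕ → L, ∑ l ∈ Finset.range (ρ (j + 1)), b l • y l = v j := by
      intro j
      have h1 : v j ∈ W (ρ (j + 1)) := Submodule.subset_span ⟨j, le_refl (ρ (j + 1)), rfl⟩
      have h2 := hyW _ (hρ j.2) h1
      rw [← Finset.coe_range] at h2
      obtain ⟨b, hb⟩ := (Submodule.mem_span_image_finset_iff_exists_fun L).mp h2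
      refine ⟨fun l => if h : l ∈ Finset.range (ρ (j + 1)) then b ⟨l, h⟩ else 0, ?_⟩
      rw [← hb, ← Finset.sum_coe_sort]
      exact Finset.sum_congr rfl fun l _ => by simp only [l.2, dif_pos]
    choose b hb using hb
    let ψ : D' →ₐ[K] L := aevalTower φ
      (Sum.elim (fun x => a x.1 x.2) (fun x => b x.1 x.2))
    have hψC : ∀ d, ψ (C d) = φ d := fun d => aevalTower_C _ _ _
    have hψX : ∀ x, ψ (X x) = Sum.elim (fun x => a x.1 x.2) (fun x => b x.1 x.2) x :=
      fun x => aevalTower_X _ _ _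
    have hψc : ∀ l o, ψ (c l o) = a l o := by
      intro l o
      simp only [c]
      split_ifs with h
      · rw [map_zero, h.1, ha0 l h.2]
      · rw [hψX]
        rfl
    refine ⟨ψ, fun j r => ?_⟩
    rw [← hb j]
    simp only [A, U, Finset.sum_apply, Pi.smul_apply, smul_eq_mul, map_sum, map_mul, hψC, hψX, hψc]
    refine Finset.sum_congr rfl fun l hl => ?_
    rw [ha l ((Finset.mem_range.mp hl).trans_le (hρ j.2))]
    simp [Finset.sum_apply, q']

section Transvection

variable {n : ℕ} {A B : Type*} [CommRing A] [CommRing B]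

/-- The symplectic transvection `u ↦ u + c ω(u, d) d`. -/
def transvec (c : A) (d : Fin n ⊕ Fin n → A) : (Fin n ⊕ Fin n → A) →ₗ[A] (Fin n ⊕ Fin n → A) :=
  LinearMap.id + c • (symp.flip d).smulRight d

theorem transvec_apply (c : A) (d u : Fin n ⊕ Fin n → A) :
    transvec c d u = u + (c * symp u d) • d := by
  simp [transvec, smul_smul]

theorem symp_transvec (c : A) (d u w : Fin n ⊕ Fin n → A) :
    symp (transvec c d u) (transvec c d w) = symp u w := by
  simp only [transvec_apply, map_add, map_smul, LinearMap.add_apply, LinearMap.smul_apply,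
    symp_self, smul_eq_mul]
  rw [symp_swap d w]
  ring

theorem transvec_neg (c : A) (d u : Fin n ⊕ Fin n → A) :
    transvec (-c) d (transvec c d u) = u := by
  ext r
  simp [transvec_apply]

theorem transvec_mem {U : Submodule A (Fin n ⊕ Fin n → A)} (c : A) {d u : Fin n ⊕ Fin n → A}
    (hd : d ∈ U) (hu : u ∈ U) : transvec c d u ∈ U := by
  rw [transvec_apply]
  exact add_mem hu (U.smul_mem _ hd)

theorem transvec_map (φ : A →+* B) (c : A) (d u : Fin n ⊕ Fin n → A) (r : Fin n ⊕ Fin n) :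
    φ (transvec c d u r) = transvec (φ c) (fun r => φ (d r)) (fun r => φ (u r)) r := by
  simp [transvec_apply, symp_map]

theorem map_mem_low {p : ℕ} (φ : A →+* B) {u : Fin n ⊕ Fin n → A} (hu : u ∈ low n A p) :
    (fun r => φ (u r)) ∈ low n B p := by
  intro r hr
  change φ (u r) = 0
  rw [hu r hr, map_zero]

theorem low_mono {p q : ℕ} (h : p ≤ q) : low n A p ≤ low n A q :=
  fun _ hu r hr => hu r (h.trans hr)

theorem trunc_eq_self {p : ℕ} {u : Fin n ⊕ Fin n → A} (hu : u ∈ low n A p) : trunc p u = u := by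
  ext r
  rw [trunc_apply]
  split_ifs with h
  · rfl
  · rw [hu r (not_lt.mp h)]

theorem trunc_map (φ : A →+* B) (p : ℕ) (u : Fin n ⊕ Fin n → A) (r : Fin n ⊕ Fin n) :
    φ (trunc p u r) = trunc p (fun r => φ (u r)) r := by
  rw [trunc_apply, trunc_apply]
  split_ifs <;> simp

theorem single_inr_mem_low (P : Fin n) :
    (Pi.single (Sum.inr P) 1 : Fin n ⊕ Fin n → A) ∈ low n A (P + 1) := by
  intro r hr
  rw [Pi.single_apply, if_neg]
  rintro rfl
  simp at hr

theorem single_inl_mem_low (P : Fin n) :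
    (Pi.single (Sum.inl P) 1 : Fin n ⊕ Fin n → A) ∈ low n A (P + 1) := by
  intro r hr
  rw [Pi.single_apply, if_neg]
  rintro rfl
  simp at hr

theorem eq_trunc_add_single {P : Fin n} {u : Fin n ⊕ Fin n → A} (hu : u ∈ low n A (P + 1))
    (hP : u (Sum.inl P) = 0) :
    u = trunc P u + u (Sum.inr P) • Pi.single (Sum.inr P) 1 := by
  ext r
  rw [Pi.add_apply, trunc_apply, Pi.smul_apply]
  rcases lt_trichotomy (pairIdx r) P with h | h | h
  · rw [if_pos h, Pi.single_apply, if_neg (by rintro rfl; simp at h)]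
    simp
  · rw [if_neg (by omega)]
    rcases r with r | r
    · obtain rfl : r = P := Fin.ext h
      simp [hP]
    · obtain rfl : r = P := Fin.ext h
      simp
  · rw [if_neg (by omega), hu r h, Pi.single_apply, if_neg (by rintro rfl; simp at h)]
    simp

end Transvection

variable {K : Type u} [Field K] {n : ℕ}

/-- A family of isotropic frames whose specializations span every isotropic subspace. -/
structure IsUniversalFrame (K : Type u) [Field K] {n p : ℕ} {D : Type u} [CommRing D]
    [Algebra K D] (Q : Fin p → Fin n ⊕ Fin n → D) : Prop where
  mem_low : ∀ i, Q i ∈ low n D p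
  symp_eq_zero : ∀ i j, symp (Q i) (Q j) = 0
  exists_hom : ∀ (L : Type u) [Field L] [Algebra K L] (U : Submodule L (Fin n ⊕ Fin n → L)),
    U ≤ low n L p → (∀ u ∈ U, ∀ w ∈ U, symp u w = 0) →
    ∃ φ : D →ₐ[K] L, U ≤ Submodule.span L (Set.range fun i r => φ (Q i r))

/-- The chart of isotropic subspaces containing a vector outside of the hyperplane on which the
coordinate `Sum.inl P` vanishes. -/
theorem IsUniversalFrame.exists_chart {P : Fin n} {D : Type u} [CommRing D] [IsDomain D]
    [Algebra K D] {Q : Fin (P : ℕ) → Fin n ⊕ Fin n → D} (hQ : IsUniversalFrame K Q) :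
    ∃ (D' : Type u) (_ : CommRing D') (_ : IsDomain D') (_ : Algebra K D')
      (q : Option (Fin (P : ℕ)) → Fin n ⊕ Fin n → D'),
      (∀ o, q o ∈ low n D' (P + 1)) ∧ (∀ i, q (some i) (Sum.inl P) = 0) ∧
      (∀ a b, symp (q a) (q b) = 0) ∧
      ∀ (L : Type u) [Field L] [Algebra K L] (U : Submodule L (Fin n ⊕ Fin n → L)),
        U ≤ low n L (P + 1) → (∀ u ∈ U, ∀ w ∈ U, symp u w = 0) →
        ∀ u₀ ∈ U, u₀ (Sum.inl P) ≠ 0 →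
        ∃ φ : D' →ₐ[K] L,
          (∀ u ∈ U, u (Sum.inl P) = 0 →
            u ∈ Submodule.span L (Set.range fun i r => φ (q (some i) r))) ∧
          ∀ u ∈ U, u ∈ Submodule.span L (Set.range fun o r => φ (q o r)) := by
  let D' := MvPolynomial (Fin n ⊕ Fin n) D
  let CQ : Fin (P : ℕ) → Fin n ⊕ Fin n → D' := fun i r => C (Q i r)
  have hCQ : ∀ i, CQ i ∈ low n D' P := fun i => map_mem_low C (hQ.mem_low i)
  have hCQ' : ∀ i, CQ i ∈ low n D' (P + 1) := fun i => low_mono (Nat.le_succ _) (hCQ i)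
  have hCQP : ∀ i, CQ i (Sum.inl P) = 0 := fun i => hCQ i _ (by simp)
  have hCQs : ∀ i j, symp (CQ i) (CQ j) = 0 := fun i j => by
    simp only [CQ, symp_map, hQ.symp_eq_zero, map_zero]
  let q : Option (Fin (P : ℕ)) → Fin n ⊕ Fin n → D' := fun o =>
    o.elim (trunc (P + 1) X) fun i =>
      (X (Sum.inl P) : D') • CQ i - symp X (CQ i) • Pi.single (Sum.inr P) 1
  have hqn : q none = trunc (P + 1) X := rfl
  have hqs : ∀ i, q (some i) =
    (X (Sum.inl P) : D') • CQ i - symp X (CQ i) • Pi.single (Sum.inr P) 1 := fun _ => rfl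
  have h0s : ∀ i, symp (q none) (q (some i)) = 0 := by
    intro i
    rw [hqn, hqs, map_sub, map_smul, map_smul, symp_single_inr, symp_trunc_left (hCQ' i),
      trunc_inl, if_pos (Nat.lt_succ_self _), smul_eq_mul, smul_eq_mul]
    ring
  refine ⟨D', inferInstance, inferInstance, inferInstance, q, ?_, ?_, ?_, ?_⟩
  · rintro (_ | i)
    · exact trunc_mem_low _ _
    · rw [hqs]
      exact sub_mem (Submodule.smul_mem _ _ (hCQ' i))
        (Submodule.smul_mem _ _ (single_inr_mem_low P))
  · intro i
    simp [hqs, hCQP]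
  · rintro (_ | i) (_ | j)
    · exact symp_self _
    · exact h0s j
    · rw [symp_swap, h0s, neg_zero]
    · have h1 : ∀ i, symp (CQ i) (Pi.single (Sum.inr P) 1) = 0 := fun i => by
        rw [symp_single_inr, hCQP]
      have h2 : ∀ i, symp (Pi.single (Sum.inr P) 1) (CQ i) = 0 := fun i => by
        rw [symp_swap, h1, neg_zero]
      simp only [hqs, map_sub, map_smul, LinearMap.sub_apply, LinearMap.smul_apply, hCQs, h1, h2,
        symp_self, smul_zero, sub_zero]
  · intro L _ _ U hU hiso u₀ hu₀ hx
    let H : Submodule L (Fin n ⊕ Fin n → L) := LinearMap.ker (LinearMap.proj (Sum.inl P))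
    have hH : ∀ u : Fin n ⊕ Fin n → L, u ∈ H ↔ u (Sum.inl P) = 0 := fun u => Iff.rfl
    obtain ⟨φ₀, hφ₀⟩ := hQ.exists_hom L ((U ⊓ H).map (trunc P))
      (by
        rintro _ ⟨u, -, rfl⟩
        exact trunc_mem_low _ _)
      (by
        rintro _ ⟨u, hu, rfl⟩ _ ⟨w, hw, rfl⟩
        have h1 := symp_eq_of_mem_low P (hU hu.1) w
        rw [hiso u hu.1 w hw.1, (hH u).mp hu.2, (hH w).mp hw.2] at h1
        simpa using h1.symm)
    let φ : D' →ₐ[K] L := aevalTower φ₀ u₀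
    have hφC : ∀ d, φ (C d) = φ₀ d := fun d => aevalTower_C _ _ _
    have hφX : ∀ r, φ (X r) = u₀ r := fun r => aevalTower_X _ _ _
    let Qφ : Fin (P : ℕ) → Fin n ⊕ Fin n → L := fun i r => φ₀ (Q i r)
    have hsymp : ∀ i, φ (symp X (CQ i)) = symp u₀ (Qφ i) := by
      intro i
      have := symp_map (φ : D' →+* L) X (CQ i)
      simp only [RingHom.coe_coe, hφX, CQ, hφC] at this
      exact this.symm
    have hqφ : ∀ i, (fun r => φ (q (some i) r)) =
        u₀ (Sum.inl P) • Qφ i - symp u₀ (Qφ i) • Pi.single (Sum.inr P) 1 := by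
      intro i
      ext r
      simp only [hqs, Pi.sub_apply, Pi.smul_apply, smul_eq_mul, map_sub, map_mul, hφX, hsymp, CQ,
        hφC, Qφ, Pi.single_apply]
      split_ifs <;> simp
    have hqn' : (fun r => φ (q none r)) = u₀ := by
      rw [hqn]
      ext r
      have := trunc_map (φ : D' →+* L) (P + 1) X r
      simp only [RingHom.coe_coe, hφX] at this
      rw [this]
      exact congrFun (trunc_eq_self (hU hu₀)) r
    have main : ∀ u ∈ U, u (Sum.inl P) = 0 →
        u ∈ Submodule.span L (Set.range fun i r => φ (q (some i) r)) := by
      intro u hu huP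
      obtain ⟨c, hc⟩ := (Submodule.mem_span_range_iff_exists_fun L).mp
        (hφ₀ (Submodule.mem_map_of_mem ⟨hu, huP⟩))
      have hc' : ∑ i, c i • Qφ i = trunc P u := hc
      have h1 := symp_eq_of_mem_low P (hU hu₀) u
      rw [hiso u₀ hu₀ u hu, huP, mul_zero, sub_zero, symp_trunc_left (trunc_mem_low _ _)] at h1
      refine (Submodule.mem_span_range_iff_exists_fun L).mpr
        ⟨fun i => (u₀ (Sum.inl P))⁻¹ * c i, ?_⟩
      have h2 : ∀ i, ((u₀ (Sum.inl P))⁻¹ * c i) • (fun r => φ (q (some i) r)) =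
          c i • Qφ i - ((u₀ (Sum.inl P))⁻¹ * symp u₀ (c i • Qφ i)) • Pi.single (Sum.inr P) 1 := by
        intro i
        rw [hqφ, smul_sub, smul_smul, smul_smul, map_smul, smul_eq_mul]
        congr 2
        · field_simp
        · ring
      rw [Finset.sum_congr rfl fun i _ => h2 i, Finset.sum_sub_distrib, hc', ← Finset.sum_smul,
        ← Finset.mul_sum, ← map_sum, hc']
      conv_rhs => rw [eq_trunc_add_single (hU hu) huP]
      rw [sub_eq_add_neg, ← neg_smul]
      congr 2
      rw [eq_neg_of_add_eq_zero_right h1.symm]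
      field_simp
    refine ⟨φ, main, fun u hu => ?_⟩
    have hsub : u - (u (Sum.inl P) / u₀ (Sum.inl P)) • u₀ ∈ U :=
      sub_mem hu (U.smul_mem _ hu₀)
    have h1 := main _ hsub (by simp [hx])
    rw [← sub_add_cancel u ((u (Sum.inl P) / u₀ (Sum.inl P)) • u₀)]
    refine add_mem (Submodule.span_mono ?_ h1) (Submodule.smul_mem _ _ (Submodule.subset_span ?_))
    · rintro _ ⟨i, rfl⟩
      exact ⟨some i, rfl⟩
    · exact ⟨none, hqn'⟩

theorem exists_isUniversalFrame (K : Type u) [Field K] (n p : ℕ) (hp : p ≤ n) :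
    ∃ (D : Type u) (_ : CommRing D) (_ : IsDomain D) (_ : Algebra K D)
      (Q : Fin p → Fin n ⊕ Fin n → D), IsUniversalFrame K Q := by
  induction p with
  | zero =>
    refine ⟨K, inferInstance, inferInstance, inferInstance, fun _ => 0,
      fun i => i.elim0, fun i => i.elim0, fun L _ _ U hU _ => ⟨Algebra.ofId K L, ?_⟩⟩
    intro u hu
    have : u = 0 := by
      ext r
      exact hU hu r (Nat.zero_le _)
    rw [this]
    exact zero_mem _
  | succ p ih =>
    obtain ⟨D, _, _, _, Q, hQ⟩ := ih (by omega)
    let P : Fin n := ⟨p, hp⟩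
    obtain ⟨D₁, _, _, _, q, hlow, hq0, hsymp, hchart⟩ :=
      IsUniversalFrame.exists_chart (P := P) hQ
    let D₂ := MvPolynomial (Option (Fin n ⊕ Fin n)) D₁
    let d : Fin n ⊕ Fin n → D₂ := trunc (p + 1) fun r => X (some r)
    let q₂ : Option (Fin p) → Fin n ⊕ Fin n → D₂ := fun o =>
      transvec (X none) d fun r => C (q o r)
    have hq₂ : ∀ (L : Type u) [Field L] [Algebra K L] (U : Submodule L (Fin n ⊕ Fin n → L)),
        U ≤ low n L (p + 1) → (∀ u ∈ U, ∀ w ∈ U, symp u w = 0) →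
        ∃ φ : D₂ →ₐ[K] L, U ≤ Submodule.span L (Set.range fun i r => φ (q₂ i r)) := by
      intro L _ _ U hU hiso
      have key : ∀ d' ∈ low n L (p + 1), ∀ u₀ ∈ U, transvec 1 d' u₀ (Sum.inl P) ≠ 0 →
          ∃ φ : D₂ →ₐ[K] L, U ≤ Submodule.span L (Set.range fun i r => φ (q₂ i r)) := by
        intro d' hd' u₀ hu₀ hne
        obtain ⟨φ₁, -, hφ₁⟩ := hchart L (U.map (transvec 1 d'))
          (by
            rintro _ ⟨u, hu, rfl⟩
            exact transvec_mem _ hd' (hU hu))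
          (by
            rintro _ ⟨u, hu, rfl⟩ _ ⟨w, hw, rfl⟩
            rw [symp_transvec]
            exact hiso u hu w hw)
          _ (Submodule.mem_map_of_mem hu₀) hne
        let φ : D₂ →ₐ[K] L := aevalTower φ₁ fun o => o.elim (-1) d'
        have hφC : ∀ d, φ (C d) = φ₁ d := fun d => aevalTower_C _ _ _
        have hφX : ∀ r, φ (X r) = r.elim (-1) d' := fun r => aevalTower_X _ _ _
        have hd : (fun r => φ (d r)) = d' := by
          ext r
          have := trunc_map (φ : D₂ →+* L) (p + 1) (fun r => X (some r)) r
          simp only [RingHom.coe_coe, hφX] at this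
          rw [this]
          exact congrFun (trunc_eq_self hd') r
        have hφq : ∀ o, (fun r => φ (q₂ o r)) = transvec (-1) d' fun r => φ₁ (q o r) := by
          intro o
          ext r
          have := transvec_map (φ : D₂ →+* L) (X none) d (fun r => C (q o r)) r
          simp only [RingHom.coe_coe, hφX, hφC, hd] at this
          exact this
        refine ⟨φ, fun u hu => ?_⟩
        have h1 := hφ₁ _ (Submodule.mem_map_of_mem hu)
        have h2 := Submodule.mem_map_of_mem (f := transvec (-1) d') h1
        rw [transvec_neg, Submodule.map_span, ← Set.range_comp] at h2
        rw [show (fun o r => φ (q₂ o r)) = fun o => transvec (-1) d' fun r => φ₁ (q o r) from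
          funext hφq]
        exact h2
      by_cases hbot : U = ⊥
      · obtain ⟨φ₁, -, -⟩ := hchart L (Submodule.span L {Pi.single (Sum.inl P) 1})
          (by
            rw [Submodule.span_singleton_le_iff_mem]
            exact single_inl_mem_low P)
          (by
            intro u hu w hw
            obtain ⟨a, rfl⟩ := Submodule.mem_span_singleton.mp hu
            obtain ⟨b, rfl⟩ := Submodule.mem_span_singleton.mp hw
            simp)
          _ (Submodule.mem_span_singleton_self _) (by simp)
        exact ⟨aevalTower φ₁ 0, by rw [hbot]; exact bot_le⟩
      · obtain ⟨u, hu, hu0⟩ := (Submodule.ne_bot_iff U).mp hbot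
        by_cases hx : u (Sum.inl P) = 0
        · suffices ∃ d' ∈ low n L (p + 1), symp u d' ≠ 0 ∧ d' (Sum.inl P) ≠ 0 by
            obtain ⟨d', hd', h1, h2⟩ := this
            refine key d' hd' u hu ?_
            rw [transvec_apply]
            simp [hx, h1, h2]
          obtain ⟨d₁, hd₁, hud₁⟩ : ∃ d₁ ∈ low n L (p + 1), symp u d₁ ≠ 0 := by
            obtain ⟨r, hr⟩ := Function.ne_iff.mp hu0
            rcases r with r | r
            · refine ⟨trunc (p + 1) (Pi.single (Sum.inr r) 1), trunc_mem_low _ _, ?_⟩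
              rw [symp_trunc_right (hU hu), symp_single_inr]
              exact hr
            · refine ⟨trunc (p + 1) (Pi.single (Sum.inl r) 1), trunc_mem_low _ _, ?_⟩
              rw [symp_trunc_right (hU hu), symp_single_inl]
              exact neg_ne_zero.mpr hr
          by_cases h1 : d₁ (Sum.inl P) = 0
          · have he : (Pi.single (Sum.inl P) 1 : Fin n ⊕ Fin n → L) ∈ low n L (p + 1) :=
              single_inl_mem_low P
            by_cases h2 : symp u (Pi.single (Sum.inl P) 1) = 0
            · refine ⟨d₁ + Pi.single (Sum.inl P) 1, add_mem hd₁ he, ?_, ?_⟩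
              · rwa [map_add, h2, add_zero]
              · simp [h1]
            · exact ⟨_, he, h2, by simp⟩
          · exact ⟨d₁, hd₁, hud₁, h1⟩
        · refine key 0 (zero_mem _) u hu ?_
          rw [transvec_apply]
          simpa using hx
    refine ⟨D₂, inferInstance, inferInstance, inferInstance,
      fun i => q₂ (finSuccEquiv p i), fun i => ?_, fun i j => ?_, fun L _ _ U hU hiso => ?_⟩
    · exact transvec_mem _ (trunc_mem_low _ _) (map_mem_low C (hlow _))
    · rw [symp_transvec, symp_map, hsymp, map_zero]
    · obtain ⟨φ, hφ⟩ := hq₂ L U hU hiso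
      refine ⟨φ, hφ.trans (Submodule.span_mono ?_)⟩
      rintro _ ⟨o, rfl⟩
      exact ⟨(finSuccEquiv p).symm o, by simp⟩

/-- Isotropic subspaces of a `2p`-dimensional symplectic space have dimension at most `p`. -/
theorem finrank_le_of_isotropic {L : Type u} [Field L] {p : ℕ} (hp : p ≤ n)
    {U : Submodule L (Fin n ⊕ Fin n → L)} (hU : U ≤ low n L p)
    (hiso : ∀ u ∈ U, ∀ w ∈ U, symp u w = 0) : Module.finrank L U ≤ p := by
  obtain ⟨D, _, _, _, Q, hQ⟩ := exists_isUniversalFrame L n p hp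
  obtain ⟨φ, hφ⟩ := hQ.exists_hom L U hU hiso
  refine (Submodule.finrank_mono hφ).trans ?_
  have h := finrank_range_le_card (R := L) fun i r => φ (Q i r)
  rwa [Fintype.card_fin] at h

section Specialization

variable {K : Type u} [Field K] {n m : ℕ}

/-- The entries `v` satisfy every polynomial relation over `K` satisfied by the entries `A`. -/
def Specializes (K : Type u) [Field K] {D : Type*} [CommRing D] [Algebra K D]
    (A : Fin m → Fin n ⊕ Fin n → D) {L : Type*} [CommRing L] [Algebra K L]
    (v : Fin m → Fin n ⊕ Fin n → L) : Prop :=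
  ∀ f : MvPolynomial ((Fin n ⊕ Fin n) × Fin m) K,
    aeval (fun s => A s.2 s.1) f = 0 → aeval (fun s => v s.2 s.1) f = 0

theorem aeval_map_entries {B B' : Type*} [CommRing B] [CommRing B'] [Algebra K B] [Algebra K B']
    (φ : B →ₐ[K] B') (v : Fin m → Fin n ⊕ Fin n → B)
    (f : MvPolynomial ((Fin n ⊕ Fin n) × Fin m) K) :
    aeval (fun s => φ (v s.2 s.1)) f = φ (aeval (fun s => v s.2 s.1) f) := by
  rw [← AlgHom.comp_apply, comp_aeval]

theorem Specializes.of_hom {D L : Type*} [CommRing D] [Algebra K D] [CommRing L] [Algebra K L]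
    {A : Fin m → Fin n ⊕ Fin n → D} {v : Fin m → Fin n ⊕ Fin n → L} (ψ : D →ₐ[K] L)
    (h : ∀ j r, ψ (A j r) = v j r) : Specializes K A v := by
  intro f hf
  simp only [← h]
  rw [aeval_map_entries, hf, map_zero]

/-- Specialization of a one-parameter family at the origin. -/
theorem Specializes.of_family {D L : Type*} [CommRing D] [Algebra K D] [Field L] [Algebra K L]
    {A : Fin m → Fin n ⊕ Fin n → D} {v : Fin m → Fin n ⊕ Fin n → L}
    (B : Fin m → Fin n ⊕ Fin n → Polynomial L) (hB : ∀ j r, (B j r).eval 0 = v j r)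
    (h : Specializes K A fun j r => algebraMap (Polynomial L) (FractionRing (Polynomial L))
      (B j r)) : Specializes K A v := by
  intro f hf
  have h1 := h f hf
  have h2 := aeval_map_entries (K := K) (IsScalarTower.toAlgHom K (Polynomial L)
    (FractionRing (Polynomial L))) B f
  simp only [IsScalarTower.toAlgHom_apply] at h2
  rw [h2, map_eq_zero_iff _ (IsFractionRing.injective _ _)] at h1
  have h3 := aeval_map_entries (K := K) ((Polynomial.aeval (0 : L)).restrictScalars K) B f
  rw [h1, map_zero] at h3
  simp only [AlgHom.coe_restrictScalars', Polynomial.coe_aeval_eq_eval, hB] at h3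
  exact h3

end Specialization

section Shear

variable {n : ℕ} {A B : Type*} [CommRing A] [CommRing B]

/-- The linear map `u ↦ u + c ω(u, d) b`. -/
def shear (c : A) (d b : Fin n ⊕ Fin n → A) : (Fin n ⊕ Fin n → A) →ₗ[A] (Fin n ⊕ Fin n → A) :=
  LinearMap.id + c • (symp.flip d).smulRight b

theorem shear_apply (c : A) (d b u : Fin n ⊕ Fin n → A) :
    shear c d b u = u + (c * symp u d) • b := by
  simp [shear, smul_smul]

theorem shear_map (φ : A →+* B) (c : A) (d b u : Fin n ⊕ Fin n → A) (r : Fin n ⊕ Fin n) :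
    φ (shear c d b u r) =
      shear (φ c) (fun r => φ (d r)) (fun r => φ (b r)) (fun r => φ (u r)) r := by
  simp [shear_apply, symp_map]

theorem exists_symp_eq (f : (Fin n ⊕ Fin n → A) →ₗ[A] A) : ∃ w, ∀ u, symp u w = f u := by
  refine ⟨Sum.elim (fun k => -f (Pi.single (Sum.inr k) 1)) fun k => f (Pi.single (Sum.inl k) 1),
    fun u => ?_⟩
  rw [symp_apply]
  have h : f u = ∑ r, u r * f (Pi.single r 1) := by
    conv_lhs => rw [pi_eq_sum_univ' u]
    simp [map_sum]
  rw [h, Fintype.sum_sum_type, ← Finset.sum_add_distrib]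
  exact Finset.sum_congr rfl fun k _ => by simp

theorem exists_mem_low_symp_eq (p : ℕ) (f : (Fin n ⊕ Fin n → A) →ₗ[A] A) :
    ∃ w ∈ low n A p, ∀ u ∈ low n A p, symp u w = f u := by
  obtain ⟨w, hw⟩ := exists_symp_eq f
  exact ⟨trunc p w, trunc_mem_low _ _, fun u hu => by rw [symp_trunc_right hu, hw]⟩

end Shear

section Points

variable {n m : ℕ} {ρ : ℕ → ℕ} {Z : Set ((Fin n ⊕ Fin n) × Fin m)}

theorem IsPoint.linearMap {L : Type*} [Field L] {v : Fin m → Fin n ⊕ Fin n → L}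
    (h : IsPoint ρ Z v) (T : (Fin n ⊕ Fin n → L) →ₗ[L] (Fin n ⊕ Fin n → L))
    (hiso : ∀ i j, symp (T (v i)) (T (v j)) = 0) (hzero : ∀ s ∈ Z, T (v s.2) s.1 = 0) :
    IsPoint ρ Z fun j => T (v j) := by
  obtain ⟨-, h2, -⟩ := isPoint_iff.mp h
  refine isPoint_iff.mpr ⟨hiso, fun l => ?_, hzero⟩
  rw [show (fun j => T (v j)) = T ∘ v from rfl, Set.image_comp, ← Submodule.map_span]
  exact (Submodule.finrank_map_le _ _).trans (h2 l)

/-- The entries above the first `P + 1` pairs, and those in row `Sum.inl P` and a column `< k`. -/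
def deadX (m : ℕ) (P : Fin n) (k : ℕ) : Set ((Fin n ⊕ Fin n) × Fin m) :=
  {s | (P : ℕ) < pairIdx s.1 ∨ s.1 = Sum.inl P ∧ (s.2 : ℕ) < k}

/-- The entries above the first `P + 1` pairs, those in row `Sum.inl P`, and those in row
`Sum.inr P` and a column `< k`. -/
def deadY (m : ℕ) (P : Fin n) (k : ℕ) : Set ((Fin n ⊕ Fin n) × Fin m) :=
  {s | (P : ℕ) < pairIdx s.1 ∨ s.1 = Sum.inl P ∨ s.1 = Sum.inr P ∧ (s.2 : ℕ) < k}

theorem exists_mem_orthogonal_notMem {L : Type*} [Field L] {p : ℕ} (hp : p ≤ n)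
    (F : Submodule L (Fin n ⊕ Fin n → L)) (hF : Module.finrank L F < p) :
    ∃ b ∈ low n L p, (∀ u ∈ F, symp u b = 0) ∧ b ∉ F := by
  let E : (Fin p ⊕ Fin p → L) →ₗ[L] (Fin n ⊕ Fin n → L) :=
    { toFun := fun u => Sum.elim
        (fun k => if h : (k : ℕ) < p then u (Sum.inl ⟨k, h⟩) else 0)
        (fun k => if h : (k : ℕ) < p then u (Sum.inr ⟨k, h⟩) else 0)
      map_add' := fun u w => by
        ext (r | r) <;> simp only [Pi.add_apply, Sum.elim_inl, Sum.elim_inr] <;> split_ifs <;> simp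
      map_smul' := fun c u => by
        ext (r | r) <;> simp only [Pi.smul_apply, Sum.elim_inl, Sum.elim_inr] <;> split_ifs <;>
          simp }
  have hE : Function.Injective E := by
    intro u w huw
    ext (r | r)
    · have := congrFun huw (Sum.inl ⟨r, r.2.trans_le hp⟩)
      simpa [E] using this
    · have := congrFun huw (Sum.inr ⟨r, r.2.trans_le hp⟩)
      simpa [E] using this
  have hElow : ∀ u, E u ∈ low n L p := by
    rintro u (r | r) hr
    · exact dif_neg (not_lt.mpr hr)
    · exact dif_neg (not_lt.mpr hr)
  let g : (Fin p ⊕ Fin p → L) →ₗ[L] Module.Dual L F :=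
    (Module.Dual.transpose F.subtype).comp (symp.flip.comp E)
  by_contra! hcon
  have h1 : (LinearMap.ker g).map E ≤ F := by
    rintro _ ⟨u, hu, rfl⟩
    refine hcon _ (hElow u) fun w hw => ?_
    exact LinearMap.congr_fun hu ⟨w, hw⟩
  have h2 := Submodule.finrank_mono h1
  rw [← (Submodule.equivMapOfInjective E hE _).finrank_eq] at h2
  have h3 := LinearMap.finrank_range_add_finrank_ker g
  have h4 := (LinearMap.range g).finrank_le
  rw [Subspace.dual_finrank_eq] at h4
  simp at h3
  omega

variable {K : Type u} [Field K]

/-- If all points admitting an orthogonal vector outside of the hyperplane on which the coordinate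
`Sum.inl P` vanishes are specializations of `A`, then so are the points for which the orthogonal
complement of the first `k` columns contains such a vector. -/
theorem specializes_of_orthogonal_first {P : Fin n} {k : ℕ} {D : Type u} [CommRing D] [Algebra K D]
    {A : Fin m → Fin n ⊕ Fin n → D}
    (hgood : ∀ (L : Type u) [Field L] [Algebra K L] (v : Fin m → Fin n ⊕ Fin n → L),
      IsPoint ρ (deadX m P k) v → (∃ q₀ ∈ low n L (P + 1), q₀ (Sum.inl P) ≠ 0 ∧
        ∀ j, symp (v j) q₀ = 0) → Specializes K A v)
    {L : Type u} [Field L] [Algebra K L] {v : Fin m → Fin n ⊕ Fin n → L}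
    (hv : IsPoint ρ (deadX m P k) v) (hP : ∀ j, v j (Sum.inl P) = 0)
    {w : Fin n ⊕ Fin n → L} (hw : w ∈ low n L (P + 1)) (hwP : w (Sum.inl P) ≠ 0)
    (hwv : ∀ j : Fin m, (j : ℕ) < k → symp (v j) w = 0) : Specializes K A v := by
  let E := FractionRing (Polynomial L)
  let ι : L →+* E := (algebraMap (Polynomial L) E).comp Polynomial.C
  let ε : E := algebraMap (Polynomial L) E Polynomial.X
  have hε : ε ≠ 0 := by
    rw [Ne, map_eq_zero_iff _ (IsFractionRing.injective _ _)]
    exact Polynomial.X_ne_zero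
  let wE : Fin n ⊕ Fin n → E := fun r => ι (w r)
  have hwE : wE ∈ low n E (P + 1) := map_mem_low ι hw
  refine Specializes.of_family (fun j r => transvec Polynomial.X (fun r => Polynomial.C (w r))
    (fun r => Polynomial.C (v j r)) r) (fun j r => ?_) ?_
  · have := transvec_map (Polynomial.evalRingHom (0 : L)) Polynomial.X
      (fun r => Polynomial.C (w r)) (fun r => Polynomial.C (v j r)) r
    simp only [Polynomial.coe_evalRingHom, Polynomial.eval_X, Polynomial.eval_C] at this
    rw [this, transvec_apply]
    simp
  simp only [transvec_map]
  have hvE := hv.map ι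
  have hlow : ∀ j, (fun r => ι (v j r)) ∈ low n E (P + 1) := fun j r hr => hvE.zero (r, j) (Or.inl hr)
  refine hgood E _ (hvE.linearMap (transvec ε wE) (fun i j => ?_) ?_)
    ⟨transvec ε wE (Pi.single (Sum.inr P) 1), transvec_mem _ hwE (single_inr_mem_low P), ?_, ?_⟩
  · rw [symp_transvec, hvE.isotropic]
  · rintro ⟨r, j⟩ (h | ⟨h, hj⟩)
    · exact transvec_mem ε hwE (hlow j) r h
    · rw [transvec_apply, symp_map, hwv j hj, map_zero, mul_zero, zero_smul, add_zero]
      exact hvE.zero (r, j) (Or.inr ⟨h, hj⟩)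
  · rw [transvec_apply, symp_swap, symp_single_inr]
    have : wE (Sum.inl P) ≠ 0 := by
      rw [Ne, map_eq_zero_iff _ (RingHom.injective _)]
      exact hwP
    simp [hε, this]
  · intro j
    rw [show (fun r => transvec (algebraMap (Polynomial L) E Polynomial.X)
      (fun r => algebraMap (Polynomial L) E (Polynomial.C (w r)))
      (fun r => algebraMap (Polynomial L) E (Polynomial.C (v j r))) r) =
      transvec ε wE fun r => ι (v j r) from rfl, symp_transvec, symp_single_inr, hP, map_zero]

/-- If all points admitting an orthogonal vector outside of the hyperplane on which the coordinate
`Sum.inl P` vanishes are specializations of `A`, then so are all points. -/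
theorem specializes_of_orthogonal {P : Fin n} {k : ℕ} {D : Type u} [CommRing D] [Algebra K D]
    {A : Fin m → Fin n ⊕ Fin n → D} (hk : ρ k ≤ P)
    (hgood : ∀ (L : Type u) [Field L] [Algebra K L] (v : Fin m → Fin n ⊕ Fin n → L),
      IsPoint ρ (deadX m P k) v → (∃ q₀ ∈ low n L (P + 1), q₀ (Sum.inl P) ≠ 0 ∧
        ∀ j, symp (v j) q₀ = 0) → Specializes K A v)
    {L : Type u} [Field L] [Algebra K L] {v : Fin m → Fin n ⊕ Fin n → L}
    (hv : IsPoint ρ (deadX m P k) v) : Specializes K A v := by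
  have hlow : ∀ j, v j ∈ low n L (P + 1) := fun j r hr => hv.zero (r, j) (Or.inl hr)
  by_cases hP : ∀ j, v j (Sum.inl P) = 0
  swap
  · push Not at hP
    obtain ⟨j, hj⟩ := hP
    exact hgood L v hv ⟨v j, hlow j, hj, fun i => hv.isotropic i j⟩
  let e : Fin n ⊕ Fin n → L := Pi.single (Sum.inr P) 1
  let F : Submodule L (Fin n ⊕ Fin n → L) := Submodule.span L (v '' {j | (j : ℕ) < k})
  have hvF : ∀ j : Fin m, (j : ℕ) < k → v j ∈ F := fun j hj => Submodule.subset_span ⟨j, hj, rfl⟩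
  have hFlow : F ≤ low n L (P + 1) := by
    rw [Submodule.span_le]
    rintro _ ⟨j, -, rfl⟩
    exact hlow j
  have hlowe : e ∈ low n L (P + 1) := single_inr_mem_low P
  by_cases he : e ∈ F
  swap
  · obtain ⟨f, hf, hfF⟩ := Submodule.exists_le_ker_of_notMem he
    obtain ⟨w, hw, hwf⟩ := exists_mem_low_symp_eq (P + 1) f
    refine specializes_of_orthogonal_first hgood hv hP hw ?_ fun j hj => ?_
    · have := hwf e hlowe
      rw [symp_swap, symp_single_inr] at this
      exact fun h => hf (by rw [← this, h, neg_zero])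
    · rw [hwf _ (hlow j)]
      exact hfF (hvF j hj)
  obtain ⟨b, hb, hbv, hbP, hbF⟩ : ∃ b ∈ low n L (P + 1), (∀ j, symp (v j) b = 0) ∧
      b (Sum.inl P) = 0 ∧ b ∉ F := by
    by_cases hall : ∀ j, v j ∈ F
    · have hF : Module.finrank L F < P + 1 :=
        Nat.lt_succ_of_le (((isPoint_iff.mp hv).2.1 k).trans hk)
      obtain ⟨b, hb, hbF, hb'⟩ := exists_mem_orthogonal_notMem P.2 F hF
      refine ⟨b, hb, fun j => hbF _ (hall j), ?_, hb'⟩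
      have := hbF e he
      rwa [symp_swap, symp_single_inr, neg_eq_zero] at this
    · push Not at hall
      obtain ⟨j, hj⟩ := hall
      exact ⟨v j, hlow j, fun i => hv.isotropic i j, hP j, hj⟩
  obtain ⟨f, hf, hfb⟩ : ∃ f : (Fin n ⊕ Fin n → L) →ₗ[L] L, f e ≠ 0 ∧ f b = 0 := by
    have : e ∉ Submodule.span L {b} := by
      intro h
      obtain ⟨c, hc⟩ := Submodule.mem_span_singleton.mp h
      have hc0 : c ≠ 0 := by
        rintro rfl
        have := congrFun hc (Sum.inr P)
        simp [e] at this
      refine hbF ?_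
      rw [← inv_smul_smul₀ hc0 b, hc]
      exact F.smul_mem _ he
    obtain ⟨f, hf, hfb⟩ := Submodule.exists_le_ker_of_notMem this
    exact ⟨f, hf, hfb (Submodule.mem_span_singleton_self b)⟩
  obtain ⟨g, hg, hgF⟩ := Submodule.exists_le_ker_of_notMem hbF
  obtain ⟨y, hy, hyf⟩ := exists_mem_low_symp_eq (P + 1) f
  obtain ⟨z, hz, hzg⟩ := exists_mem_low_symp_eq (P + 1) g
  have hzF : ∀ u ∈ F, symp u z = 0 := fun u hu => by
    rw [hzg u (hFlow hu)]
    exact hgF hu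
  have hyb : symp b y = 0 := by rw [hyf b hb, hfb]
  have hye : y (Sum.inl P) ≠ 0 := by
    have := hyf e hlowe
    rw [symp_swap, symp_single_inr] at this
    exact fun h => hf (by rw [← this, h, neg_zero])
  have hze : z (Sum.inl P) = 0 := by
    have := hzF e he
    rwa [symp_swap, symp_single_inr, neg_eq_zero] at this
  have hbz : symp b z ≠ 0 := by rwa [hzg b hb]
  let E := FractionRing (Polynomial L)
  let ι : L →+* E := (algebraMap (Polynomial L) E).comp Polynomial.C
  have hι : Function.Injective ι := RingHom.injective _
  let ε : E := algebraMap (Polynomial L) E Polynomial.X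
  have hε : ε ≠ 0 := by
    rw [Ne, map_eq_zero_iff _ (IsFractionRing.injective _ _)]
    exact Polynomial.X_ne_zero
  let yE : Fin n ⊕ Fin n → E := fun r => ι (y r)
  let zE : Fin n ⊕ Fin n → E := fun r => ι (z r)
  let bE : Fin n ⊕ Fin n → E := fun r => ι (b r)
  have hyE : yE ∈ low n E (P + 1) := map_mem_low ι hy
  have hzE : zE ∈ low n E (P + 1) := map_mem_low ι hz
  have hbE : bE ∈ low n E (P + 1) := map_mem_low ι hb
  refine Specializes.of_family (fun j r => shear Polynomial.X (fun r => Polynomial.C (y r))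
    (fun r => Polynomial.C (b r)) (fun r => Polynomial.C (v j r)) r) (fun j r => ?_) ?_
  · have := shear_map (Polynomial.evalRingHom (0 : L)) Polynomial.X (fun r => Polynomial.C (y r))
      (fun r => Polynomial.C (b r)) (fun r => Polynomial.C (v j r)) r
    simp only [Polynomial.coe_evalRingHom, Polynomial.eval_X, Polynomial.eval_C] at this
    rw [this, shear_apply]
    simp
  simp only [shear_map]
  have hvE := hv.map ι
  let vE : Fin m → Fin n ⊕ Fin n → E := fun j r => ι (v j r)
  have hlowE : ∀ j, vE j ∈ low n E (P + 1) := fun j => map_mem_low ι (hlow j)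
  have hvb : ∀ j, symp (vE j) bE = 0 := fun j => by rw [symp_map, hbv, map_zero]
  have hbyE : symp bE yE = 0 := by rw [symp_map, hyb, map_zero]
  have hPE : ∀ j, shear ε yE bE (vE j) (Sum.inl P) = 0 := fun j => by
    simp [shear_apply, vE, bE, hP, hbP]
  refine specializes_of_orthogonal_first hgood
    (hvE.linearMap (shear ε yE bE) (fun i j => ?_) ?_) hPE
    (w := zE - (ε * symp bE zE) • yE) (sub_mem hzE (Submodule.smul_mem _ _ hyE)) ?_ ?_
  · change symp (shear ε yE bE (vE i)) (shear ε yE bE (vE j)) = 0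
    have : symp bE (vE j) = 0 := by rw [symp_swap, hvb, neg_zero]
    have h0 : symp (vE i) (vE j) = 0 := hvE.isotropic i j
    simp only [shear_apply, map_add, map_smul, LinearMap.add_apply, LinearMap.smul_apply, hvb,
      symp_self, this, h0, smul_zero, add_zero]
  · rintro ⟨r, j⟩ (h | ⟨h, hj⟩)
    · refine (?_ : shear ε yE bE (vE j) ∈ low n E (P + 1)) r h
      rw [shear_apply]
      exact add_mem (hlowE j) (Submodule.smul_mem _ _ hbE)
    · obtain rfl : r = Sum.inl P := h
      exact hPE j
  · have h1 : zE (Sum.inl P) = 0 := by simp [zE, hze]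
    have h2 : yE (Sum.inl P) ≠ 0 := (map_ne_zero_iff ι hι).mpr hye
    have h3 : symp bE zE ≠ 0 := by
      rw [symp_map]
      exact (map_ne_zero_iff ι hι).mpr hbz
    simp [h1, h2, h3, hε]
  · intro j hj
    change symp (shear ε yE bE (vE j)) (zE - (ε * symp bE zE) • yE) = 0
    have : symp (vE j) zE = 0 := by rw [symp_map, hzF _ (hvF j hj), map_zero]
    simp only [shear_apply, map_add, map_sub, map_smul, LinearMap.add_apply, LinearMap.smul_apply,
      hbyE, this, smul_eq_mul]
    ring

end Points

variable {K : Type u} [Field K] {n m : ℕ} {ρ : ℕ → ℕ} {Z : Set ((Fin n ⊕ Fin n) × Fin m)}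

theorem isPoint_of_aeval {L : Type*} [CommRing L] [Algebra K L]
    (v : MvPolynomial ((Fin n ⊕ Fin n) × Fin m) K →ₐ[K] L)
    (h : locusIdeal K ρ Z ≤ RingHom.ker (v : MvPolynomial ((Fin n ⊕ Fin n) × Fin m) K →+* L)) :
    IsPoint ρ Z fun j r => v (X (r, j)) :=
  (locusIdeal_le_ker_iff _).mp h

/-- The radical of the ideal of a degeneracy locus is prime if there is a generic point. -/
theorem radical_isPrime_of_specializes {D : Type u} [CommRing D] [IsDomain D] [Algebra K D]
    {A : Fin m → Fin n ⊕ Fin n → D} (hA : IsPoint ρ Z A)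
    (h : ∀ (L : Type u) [Field L] [Algebra K L] (v : Fin m → Fin n ⊕ Fin n → L), IsPoint ρ Z v →
      Specializes K A v) : (locusIdeal K ρ Z).radical.IsPrime := by
  rw [radical_eq_ker_of_generic (aeval fun s => A s.2 s.1)]
  · exact RingHom.ker_isPrime _
  · rw [locusIdeal_le_ker_iff]
    simpa using hA
  · intro L _ _ v hv f hf
    have h1 := h L _ (isPoint_of_aeval v hv) f hf
    have h2 : (aeval fun s : (Fin n ⊕ Fin n) × Fin m => v (X (s.1, s.2))) = v := by
      ext s
      simp
    rwa [h2] at h1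

/-- The variable in row `a` and column `k` does not vanish on the degeneracy locus. -/
theorem X_notMem_radical (hρ : Monotone ρ) {k : Fin m} (hk : 1 ≤ ρ (k + 1)) {a : Fin n ⊕ Fin n}
    (ha : (a, k) ∉ Z) : X (a, k) ∉ (locusIdeal K ρ Z).radical := by
  classical
  let v : Fin m → Fin n ⊕ Fin n → K := fun j => if j = k then Pi.single a 1 else 0
  have hv : IsPoint ρ Z v := by
    refine isPoint_iff.mpr ⟨fun i j => ?_, fun l => ?_, ?_⟩
    · simp only [v]
      split_ifs <;> simp
    · by_cases hl : (k : ℕ) < l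
      · have h1 : Submodule.span K (v '' {j | (j : ℕ) < l}) ≤
            Submodule.span K {Pi.single a 1} := by
          rw [Submodule.span_le]
          rintro _ ⟨j, -, rfl⟩
          simp only [v]
          split_ifs
          · exact Submodule.mem_span_singleton_self _
          · exact zero_mem _
        exact (Submodule.finrank_mono h1).trans
          ((finrank_span_le_card _).trans ((by simpa using hk : _ ≤ _).trans (hρ hl)))
      · have h1 : Submodule.span K (v '' {j | (j : ℕ) < l}) = ⊥ := by
          rw [Submodule.span_eq_bot]
          rintro _ ⟨j, hj, rfl⟩
          refine if_neg ?_
          rintro rfl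
          exact hl hj
        rw [h1, finrank_bot]
        exact Nat.zero_le _
    · rintro ⟨r, j⟩ hs
      simp only [v]
      split_ifs with h
      · subst h
        rw [Pi.single_apply, if_neg]
        rintro rfl
        exact ha hs
      · rfl
  let φ : MvPolynomial ((Fin n ⊕ Fin n) × Fin m) K →+* K := eval fun s => v s.2 s.1
  have h1 : locusIdeal K ρ Z ≤ RingHom.ker φ := by
    rw [locusIdeal_le_ker_iff]
    simpa [φ] using hv
  intro h
  have h2 := Ideal.radical_mono h1 h
  rw [(RingHom.ker_isPrime φ).isRadical.radical, RingHom.mem_ker] at h2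
  simp [φ, v] at h2

theorem symp_eq_zero_of_mem_span {L : Type*} [CommRing L] {S : Set (Fin n ⊕ Fin n → L)}
    (h : ∀ u ∈ S, ∀ w ∈ S, symp u w = 0) {u w : Fin n ⊕ Fin n → L} (hu : u ∈ Submodule.span L S)
    (hw : w ∈ Submodule.span L S) : symp u w = 0 := by
  induction hu using Submodule.span_induction with
  | mem u hu =>
    induction hw using Submodule.span_induction with
    | mem w hw => exact h u hu w hw
    | zero => simp
    | add x y _ _ hx hy => rw [map_add, hx, hy, add_zero]
    | smul c x _ hx => rw [map_smul, hx, smul_zero]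
  | zero => simp
  | add x y _ _ hx hy => rw [map_add, LinearMap.add_apply, hx, hy, add_zero]
  | smul c x _ hx => rw [map_smul, LinearMap.smul_apply, hx, smul_zero]

theorem radical_isPrime_deadX (P : Fin n) (hρ : Monotone ρ) (h0 : ρ 0 = 0) {k s : ℕ}
    (hk : ρ k = s) (hk1 : ρ (k + 1) = s + 1) (hs : s ≤ P) :
    (locusIdeal K ρ (deadX m P k)).radical.IsPrime := by
  obtain ⟨D, _, _, _, Q, hQ⟩ := exists_isUniversalFrame K n P P.2.le
  obtain ⟨D₁, _, _, _, q, hlow, hq0, hsymp, hchart⟩ := hQ.exists_chart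
  obtain ⟨D₂, _, _, _, A, hA, hgen⟩ := exists_generic_of_frame (K := K) hρ h0 hk hk1 (deadX m P k) q hsymp
    (by
      rintro ⟨r, j⟩ (h | ⟨h, -⟩) i
      · exact hlow _ r h
      · rw [show r = Sum.inl P from h, hq0])
    (by
      rintro ⟨r, j⟩ (h | ⟨-, h⟩) hj
      · exact hlow _ r h
      · exact absurd h (not_lt.mpr hj))
  refine radical_isPrime_of_specializes hA fun L _ _ v hv => ?_
  refine specializes_of_orthogonal (hk.trans_le hs) (fun L _ _ v hv => ?_) hv
  rintro ⟨q₀, hq₀, hP, horth⟩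
  have hvlow : ∀ j, v j ∈ low n L (P + 1) := fun j r hr => hv.zero (r, j) (Or.inl hr)
  obtain ⟨φ, hφ1, hφ2⟩ := hchart L (Submodule.span L (insert q₀ (Set.range v)))
    (by
      rw [Submodule.span_le]
      rintro _ (rfl | ⟨j, rfl⟩)
      · exact hq₀
      · exact hvlow j)
    (by
      intro u hu w hw
      refine symp_eq_zero_of_mem_span ?_ hu hw
      rintro _ (rfl | ⟨i, rfl⟩) _ (rfl | ⟨j, rfl⟩)
      · exact symp_self _
      · rw [symp_swap, horth, neg_zero]
      · exact horth i
      · exact hv.isotropic i j)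
    q₀ (Submodule.subset_span (Set.mem_insert _ _)) hP
  have hmem : ∀ j, v j ∈ Submodule.span L (insert q₀ (Set.range v)) := fun j =>
    Submodule.subset_span (Set.mem_insert_of_mem _ ⟨j, rfl⟩)
  obtain ⟨ψ, hψ⟩ := hgen L φ v hv
    (fun j hj => hφ1 _ (hmem j) (hv.zero (Sum.inl P, j) (Or.inr ⟨rfl, hj⟩)))
    fun j => hφ2 _ (hmem j)
  exact Specializes.of_hom ψ hψ

theorem radical_isPrime_deadY (P : Fin n) (hρ : Monotone ρ) (h0 : ρ 0 = 0) {k s : ℕ}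
    (hk : ρ k = s) (hk1 : ρ (k + 1) = s + 1) :
    (locusIdeal K ρ (deadY m P k)).radical.IsPrime := by
  obtain ⟨D, _, _, _, Q, hQ⟩ := exists_isUniversalFrame K n P P.2.le
  have hQP : ∀ i, symp (Q i) (Pi.single (Sum.inr P) 1) = 0 := fun i => by
    rw [symp_single_inr]
    exact hQ.mem_low i _ le_rfl
  obtain ⟨D₂, _, _, _, A, hA, hgen⟩ := exists_generic_of_frame (K := K) hρ h0 hk hk1 (deadY m P k)
    (fun o => o.elim (Pi.single (Sum.inr P) 1) Q)
    (by
      rintro (_ | i) (_ | j)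
      · exact symp_self _
      · change symp (Pi.single (Sum.inr P) 1) (Q j) = 0
        rw [symp_swap, hQP, neg_zero]
      · exact hQP i
      · exact hQ.symp_eq_zero i j)
    (by
      rintro ⟨r, j⟩ h i
      refine hQ.mem_low i r ?_
      rcases h with h | h | ⟨h, -⟩
      · exact le_of_lt h
      · rw [show r = Sum.inl P from h]
        exact le_rfl
      · rw [show r = Sum.inr P from h]
        exact le_rfl)
    (by
      rintro ⟨r, j⟩ (h | h | ⟨-, h⟩) hj
      · exact single_inr_mem_low P r h
      · rw [show r = Sum.inl P from h]
        simp
      · exact absurd h (not_lt.mpr hj))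
  refine radical_isPrime_of_specializes hA fun L _ _ v hv => ?_
  have hvlow : ∀ j, v j ∈ low n L (P + 1) := fun j r hr => hv.zero (r, j) (Or.inl hr)
  have hvP : ∀ j, v j (Sum.inl P) = 0 := fun j => hv.zero (_, j) (Or.inr (Or.inl rfl))
  obtain ⟨φ, hφ⟩ := hQ.exists_hom L (Submodule.span L (Set.range fun j => trunc P (v j)))
    (by
      rw [Submodule.span_le]
      rintro _ ⟨j, rfl⟩
      exact trunc_mem_low _ _)
    (by
      intro u hu w hw
      refine symp_eq_zero_of_mem_span ?_ hu hw
      rintro _ ⟨i, rfl⟩ _ ⟨j, rfl⟩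
      have := symp_eq_of_mem_low P (hvlow i) (v j)
      rw [hv.isotropic, hvP, hvP] at this
      simpa using this.symm)
  have hmem : ∀ j, trunc P (v j) ∈ Submodule.span L (Set.range fun i r => φ (Q i r)) := fun j =>
    hφ (Submodule.subset_span ⟨j, rfl⟩)
  obtain ⟨ψ, hψ⟩ := hgen L φ v hv
    (fun j hj => by
      rw [eq_trunc_add_single (hvlow j) (hvP j), hv.zero (Sum.inr P, j) (Or.inr (Or.inr ⟨rfl, hj⟩)),
        zero_smul, add_zero]
      exact hmem j)
    (fun j => by
      rw [eq_trunc_add_single (hvlow j) (hvP j)]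
      refine add_mem (Submodule.span_mono ?_ (hmem j))
        (Submodule.smul_mem _ _ (Submodule.subset_span ⟨none, ?_⟩))
      · rintro _ ⟨i, rfl⟩
        exact ⟨some i, rfl⟩
      · ext r
        simp only [Option.elim_none, Pi.single_apply]
        split_ifs <;> simp)
  exact Specializes.of_hom ψ hψ

section Colon

variable {K : Type u} [Field K] {n m : ℕ} {ρ : ℕ → ℕ} {Z : Set ((Fin n ⊕ Fin n) × Fin m)}

/-- Rank functions growing by at most one in each step. -/
structure IsRankFunction (ρ : ℕ → ℕ) : Prop where
  monotone : Monotone ρ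
  zero : ρ 0 = 0
  succ_le : ∀ l, ρ (l + 1) ≤ ρ l + 1

theorem locusIdeal_insert (s : (Fin n ⊕ Fin n) × Fin m) :
    locusIdeal K ρ (insert s Z) = locusIdeal K ρ Z ⊔ Ideal.span {X s} := by
  rw [locusIdeal, locusIdeal, Set.image_insert_eq, ← Ideal.span_union, Set.union_insert,
    Set.union_singleton]

theorem IsPoint.minorsVanish {A : Type*} [CommRing A] {v : Fin m → Fin n ⊕ Fin n → A}
    (h : IsPoint ρ Z v) (l : ℕ) : MinorsVanish v (ρ l + 1) {j | (j : ℕ) < l} :=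
  h.minors l

theorem MinorsVanish.mul_det_eq_zero {ι κ A : Type*} [CommRing A] {v : κ → ι → A} {q : ℕ}
    {S : Set κ} {k : κ} {a : ι} (h : MinorsVanish v (q + 1) (Insert.insert k S))
    (h0 : ∀ i ∈ S, v i a = 0) (f : Fin q → ι) (g : Fin q → κ) (hg : ∀ i, g i ∈ S) :
    v k a * (Matrix.of fun i j => v (g j) (f i)).det = 0 := by
  have h2 := h (Fin.cons a f) (Fin.cons k g)
    (Fin.cases (Set.mem_insert _ _) fun i => Set.mem_insert_of_mem _ (hg i))
  rw [Matrix.det_succ_row_zero, Fin.sum_univ_succ, Finset.sum_eq_zero, add_zero] at h2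
  · simpa [Matrix.submatrix] using h2
  · intro j _
    simp [h0 _ (hg j)]

theorem isRadical_of_colon (hρ : IsRankFunction ρ) {a : Fin n ⊕ Fin n} {k : Fin m} {s : ℕ}
    (ha : (a, k) ∉ Z)
    (hrad : ∀ ρ : ℕ → ℕ, IsRankFunction ρ → (locusIdeal K ρ (insert (a, k) Z)).IsRadical)
    (hprime : ∀ ρ : ℕ → ℕ, Monotone ρ → ρ 0 = 0 → ρ k = s → ρ (k + 1) = s + 1 →
      (locusIdeal K ρ Z).radical.IsPrime)
    (hs : s + 1 ≤ ρ k)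
    (hmul : ∀ (f : Fin (s + 1) → Fin n ⊕ Fin n) (g : Fin (s + 1) → Fin m),
      (∀ i, (g i : ℕ) < k) →
      X (a, k) * (Matrix.of fun i j => X (f i, g j)).det ∈ locusIdeal K ρ Z) :
    (locusIdeal K ρ Z).IsRadical := by
  let J := locusIdeal K ρ Z
  let ρ' : ℕ → ℕ := fun l => min (ρ l) (s + (l - k))
  have hρ' : IsRankFunction ρ' := by
    refine ⟨fun i j hij => ?_, ?_, fun l => ?_⟩
    · have := hρ.monotone hij
      simp only [ρ']
      omega
    · simp [ρ', hρ.zero]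
    · have := hρ.succ_le l
      simp only [ρ']
      omega
  have hk1 := hρ.monotone (Nat.le_succ k)
  have hρk : ρ' k = s := by
    simp only [ρ']
    omega
  have hρk1 : ρ' (k + 1) = s + 1 := by
    simp only [ρ', Nat.succ_eq_add_one] at hk1 ⊢
    omega
  let J' := locusIdeal K ρ' Z
  have hP := hprime ρ' hρ'.monotone hρ'.zero hρk hρk1
  have hx : X (a, k) ∉ J'.radical := X_notMem_radical hρ'.monotone (by omega) ha
  have hJ'rad : J'.IsRadical :=
    isRadical_of_isHomogeneous (locusIdeal_isHomogeneous _ _) hP hx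
      (by rw [← locusIdeal_insert]; exact hrad ρ' hρ')
  rw [hJ'rad.radical] at hP hx
  refine isRadical_of_mul_mem (J' := J') ?_ hP hx ?_ (by rw [← locusIdeal_insert]; exact hrad ρ hρ)
  · have h := isPoint_mk (le_refl J')
    rw [← Ideal.mk_ker (I := J'), locusIdeal_le_ker_iff]
    exact ⟨h.isotropic, fun l => (h.minorsVanish l).of_le (Nat.succ_le_succ (min_le_left _ _)),
      h.zero⟩
  · let Q : Ideal (MvPolynomial ((Fin n ⊕ Fin n) × Fin m) K) :=
      Submodule.comap (LinearMap.mulLeft _ (X (a, k))) J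
    have hJQ : J ≤ Q := fun y hy => Ideal.mul_mem_left _ _ hy
    have h := isPoint_mk hJQ
    suffices J' ≤ Q from fun y hy => this hy
    rw [← Ideal.mk_ker (I := Q), locusIdeal_le_ker_iff]
    have hmin : MinorsVanish (fun j r => Ideal.Quotient.mk Q (X (r, j))) (s + 1)
        {j : Fin m | (j : ℕ) < k} := by
      intro f g hg
      rw [det_map_of (Ideal.Quotient.mk Q) fun j r => X (r, j), Ideal.Quotient.eq_zero_iff_mem]
      exact hmul f g hg
    suffices ∀ l, MinorsVanish (fun j r => Ideal.Quotient.mk Q (X (r, j))) (ρ' l + 1)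
      {j : Fin m | (j : ℕ) < l} from ⟨h.isotropic, this, h.zero⟩
    intro l
    by_cases hl : ρ l ≤ s + (l - k)
    · rw [show ρ' l = ρ l from min_eq_left hl]
      exact h.minorsVanish l
    · rw [show ρ' l + 1 = s + 1 + (l - k) by simp only [ρ']; omega]
      refine (hmin.add_columns (l - k)).mono fun j hj => ?_
      have hj' : (j : ℕ) < l := hj
      exact (show (j : ℕ) < k + (l - k) by omega)

/-- One step of the principal radical system: the passage from `insert (a, k) Z` to `Z`. -/
theorem isRadical_of_insert {a : Fin n ⊕ Fin n} {k : Fin m} {p : ℕ} (ha : (a, k) ∉ Z)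
    (hcell : ∀ i : Fin m, (i : ℕ) < k → (a, i) ∈ Z)
    (hrad : ∀ ρ : ℕ → ℕ, IsRankFunction ρ → (locusIdeal K ρ (insert (a, k) Z)).IsRadical)
    (hprime : ∀ ρ : ℕ → ℕ, Monotone ρ → ρ 0 = 0 → ∀ s ≤ p, ρ k = s → ρ (k + 1) = s + 1 →
      (locusIdeal K ρ Z).radical.IsPrime)
    (hmul : ∀ ρ : ℕ → ℕ, ∀ (f : Fin (p + 1) → Fin n ⊕ Fin n) (g : Fin (p + 1) → Fin m),
      (∀ i, (g i : ℕ) < k) →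
      X (a, k) * (Matrix.of fun i j => X (f i, g j)).det ∈ locusIdeal K ρ Z)
    (ρ : ℕ → ℕ) (hρ : IsRankFunction ρ) : (locusIdeal K ρ Z).IsRadical := by
  have hk1 := hρ.monotone (Nat.le_succ k)
  have hk2 := hρ.succ_le k
  simp only [Nat.succ_eq_add_one] at hk1
  by_cases hp : p + 1 ≤ ρ k
  · exact isRadical_of_colon hρ ha hrad (fun ρ h1 h2 => hprime ρ h1 h2 p le_rfl) hp (hmul ρ)
  by_cases hstep : ρ (k + 1) = ρ k + 1
  · exact isRadical_of_isHomogeneous (locusIdeal_isHomogeneous _ _)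
      (hprime ρ hρ.monotone hρ.zero _ (by omega) rfl hstep)
      (X_notMem_radical hρ.monotone (by omega) ha)
      (by rw [← locusIdeal_insert]; exact hrad ρ hρ)
  have heq : ρ (k + 1) = ρ k := by omega
  have hpt := isPoint_mk (le_refl (locusIdeal K ρ Z))
  obtain h0 | ⟨s, hs⟩ : ρ k = 0 ∨ ∃ s, ρ k = s + 1 := by
    rcases ρ k with _ | s
    · exact Or.inl rfl
    · exact Or.inr ⟨s, rfl⟩
  · have hx : X (a, k) ∈ locusIdeal K ρ Z := by
      rw [← Ideal.Quotient.eq_zero_iff_mem]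
      have h1 := hpt.minorsVanish (k + 1)
      rw [heq, h0] at h1
      have := h1 (fun _ => a) (fun _ => k) fun _ => Nat.lt_succ_self _
      simpa using this
    have h2 := hrad ρ hρ
    rwa [locusIdeal_insert, sup_eq_left.mpr] at h2
    rwa [Ideal.span_singleton_le_iff_mem]
  · refine isRadical_of_colon hρ ha hrad
      (fun ρ h1 h2 => hprime ρ h1 h2 s (by omega)) hs.ge fun f g hg => ?_
    rw [← Ideal.Quotient.eq_zero_iff_mem, map_mul,
      ← det_map_of (Ideal.Quotient.mk (locusIdeal K ρ Z)) fun j r => X (r, j)]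
    have h1 := hpt.minorsVanish (k + 1)
    rw [heq, hs] at h1
    have h2 : insert k {j : Fin m | (j : ℕ) < k} ⊆ {j : Fin m | (j : ℕ) < k + 1} := by
      rintro j (rfl | hj)
      · exact Nat.lt_succ_self _
      · exact Nat.lt_succ_of_lt hj
    have h3 : ∀ i ∈ {j : Fin m | (j : ℕ) < k},
        Ideal.Quotient.mk (locusIdeal K ρ Z) (X (a, i)) = 0 := fun i hi =>
      hpt.zero (a, i) (hcell i hi)
    exact (h1.mono h2).mul_det_eq_zero h3 f g hg

end Colon

section LowRank

variable {K : Type u} [Field K] {n m : ℕ}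

/-- The entries above the first `p` pairs. -/
def deadN (n m p : ℕ) : Set ((Fin n ⊕ Fin n) × Fin m) :=
  {s | p ≤ pairIdx s.1}

/-- Isotropic matrices supported on the first `p` pairs have vanishing `(p + 1)`-minors. -/
theorem det_eq_zero_of_isotropic {p : ℕ} (hp : p ≤ n)
    (hrad : (locusIdeal K id (deadN n m p)).IsRadical) {A : Type*} [CommRing A] [Algebra K A]
    (v : Fin m → Fin n ⊕ Fin n → A) (hlow : ∀ j, v j ∈ low n A p)
    (hiso : ∀ i j, symp (v i) (v j) = 0) (f : Fin (p + 1) → Fin n ⊕ Fin n)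
    (g : Fin (p + 1) → Fin m) : (Matrix.of fun i j => v (g j) (f i)).det = 0 := by
  have h1 : (Matrix.of fun i j => (X (f i, g j) : MvPolynomial ((Fin n ⊕ Fin n) × Fin m) K)).det ∈
      locusIdeal K id (deadN n m p) := by
    rw [← hrad.radical]
    refine mem_radical_of_forall_field fun L _ _ w hw => ?_
    have hpt := isPoint_of_aeval w hw
    have h2 : Module.finrank L (Submodule.span L ((fun j r => w (X (r, j))) '' Set.univ)) ≤ p := by
      refine finrank_le_of_isotropic hp ?_ ?_
      · rw [Submodule.span_le]
        rintro _ ⟨j, -, rfl⟩ r hr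
        exact hpt.zero (r, j) hr
      · intro u hu w hw
        refine symp_eq_zero_of_mem_span ?_ hu hw
        rintro _ ⟨i, -, rfl⟩ _ ⟨j, -, rfl⟩
        exact hpt.isotropic i j
    have h3 := (minors_eq_zero_iff_finrank_span_le _ _ _).mpr h2 f g fun _ => Set.mem_univ _
    exact (det_map_of (w : MvPolynomial ((Fin n ⊕ Fin n) × Fin m) K →+* L)
      (fun j r => X (r, j)) f g).symm.trans h3
  let φ : MvPolynomial ((Fin n ⊕ Fin n) × Fin m) K →+* A :=
    ((aeval fun s => v s.2 s.1 : MvPolynomial ((Fin n ⊕ Fin n) × Fin m) K →ₐ[K] A) :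
      MvPolynomial ((Fin n ⊕ Fin n) × Fin m) K →+* A)
  have hφ : ∀ j r, φ (X (r, j)) = v j r := fun j r => aeval_X _ _
  have h4 : locusIdeal K id (deadN n m p) ≤ RingHom.ker φ := by
    rw [locusIdeal_le_ker_iff]
    simp only [hφ]
    refine ⟨hiso, fun l f g hg => ?_, fun s hs => hlow _ _ hs⟩
    obtain ⟨i, j, hij, he⟩ := Fintype.exists_ne_map_eq_of_card_lt
      (fun i : Fin (l + 1) => (⟨g i, hg i⟩ : Fin l)) (by simp)
    refine Matrix.det_zero_of_column_eq hij fun r => ?_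
    have : g i = g j := Fin.ext (Fin.mk.inj_iff.mp he)
    simp [this]
  have h5 := h4 h1
  rw [RingHom.mem_ker, ← det_map_of φ fun j r => X (r, j)] at h5
  simpa only [hφ] using h5

theorem det_eq_zero_of_isotropic_of_lt {P : Fin n}
    (hrad : (locusIdeal K id (deadN n m P)).IsRadical) {A : Type*} [CommRing A] [Algebra K A]
    {v : Fin m → Fin n ⊕ Fin n → A} (hlow : ∀ j, v j ∈ low n A (P + 1))
    (hiso : ∀ i j, symp (v i) (v j) = 0) {k : ℕ}
    (hP : ∀ j : Fin m, (j : ℕ) < k → v j (Sum.inl P) = 0)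
    (f : Fin (P + 1 : ℕ) → Fin n ⊕ Fin n) (g : Fin (P + 1 : ℕ) → Fin m)
    (hf : ∀ i, pairIdx (f i) < P) (hg : ∀ i, (g i : ℕ) < k) :
    (Matrix.of fun i j => v (g j) (f i)).det = 0 := by
  have h := det_eq_zero_of_isotropic P.2.le hrad
    (fun j => if (j : ℕ) < k then trunc P (v j) else 0)
    (fun j => by
      split_ifs
      · exact trunc_mem_low _ _
      · exact zero_mem _)
    (fun i j => by
      split_ifs with hi hj
      · have := symp_eq_of_mem_low P (hlow i) (v j)
        rw [hiso, hP i hi, hP j hj] at this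
        simpa using this.symm
      all_goals simp) f g
  simpa [hg, trunc_apply, hf] using h

theorem mul_det_eq_zero {P : Fin n}
    (hrad : (locusIdeal K id (deadN n m P)).IsRadical) {A : Type*} [CommRing A] [Algebra K A]
    {v : Fin m → Fin n ⊕ Fin n → A} (hlow : ∀ j, v j ∈ low n A (P + 1))
    (hiso : ∀ i j, symp (v i) (v j) = 0) {k : Fin m}
    (hP : ∀ j : Fin m, (j : ℕ) < k → v j (Sum.inl P) = 0)
    (f : Fin (P + 1 : ℕ) → Fin n ⊕ Fin n) (g : Fin (P + 1 : ℕ) → Fin m)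
    (hg : ∀ i, (g i : ℕ) < k) :
    v k (Sum.inl P) * (Matrix.of fun i j => v (g j) (f i)).det = 0 := by
  classical
  by_cases hf : ∀ i, pairIdx (f i) < P
  · rw [det_eq_zero_of_isotropic_of_lt hrad hlow hiso hP f g hf hg, mul_zero]
  push Not at hf
  obtain ⟨i₀, hi₀⟩ := hf
  by_cases hbad : ∃ i, ∀ j, v (g j) (f i) = 0
  · obtain ⟨i, hi⟩ := hbad
    rw [Matrix.det_eq_zero_of_row_eq_zero i hi, mul_zero]
  push Not at hbad
  have hfi : ∀ i, (P : ℕ) ≤ pairIdx (f i) → f i = Sum.inr P := by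
    intro i hi
    obtain ⟨j, hj⟩ := hbad i
    have h1 : ¬ (P : ℕ) + 1 ≤ pairIdx (f i) := fun h => hj (hlow _ _ h)
    have h2 : f i ≠ Sum.inl P := fun h => hj (h ▸ hP _ (hg j))
    generalize f i = r at *
    rcases r with r | r
    · refine absurd (congrArg Sum.inl (Fin.ext ?_)) h2
      simp only [pairIdx_inl] at hi h1
      omega
    · refine congrArg Sum.inr (Fin.ext ?_)
      simp only [pairIdx_inr] at hi h1
      omega
  by_cases hdup : ∃ i, i ≠ i₀ ∧ f i = Sum.inr P
  · obtain ⟨i, hne, hi⟩ := hdup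
    rw [Matrix.det_zero_of_row_eq hne (funext fun j => by
      rw [Matrix.of_apply, Matrix.of_apply, hi, hfi i₀ hi₀]), mul_zero]
  push Not at hdup
  have hlt : ∀ i, i ≠ i₀ → pairIdx (f i) < P := fun i hi => by
    by_contra h
    exact hdup i hi (hfi i (not_lt.mp h))
  set M : Matrix (Fin (P + 1 : ℕ)) (Fin (P + 1 : ℕ)) A := Matrix.of fun i j => v (g j) (f i)
    with hM
  let d : Fin n ⊕ Fin n → A := fun r => -symp (trunc P (v k)) (Pi.single r 1)
  have hrow : v k (Sum.inl P) • M i₀ = ∑ r, d r • fun j => trunc P (v (g j)) r := by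
    ext j
    have h1 := symp_eq_of_mem_low P (hlow k) (v (g j))
    rw [hiso, hP _ (hg j), mul_zero, sub_zero] at h1
    have h2 : symp (trunc P (v k)) (trunc P (v (g j))) =
        ∑ r, trunc P (v (g j)) r * symp (trunc P (v k)) (Pi.single r 1) := by
      conv_lhs => rw [pi_eq_sum_univ' (trunc P (v (g j)))]
      simp only [map_sum, map_smul, smul_eq_mul]
    rw [h2] at h1
    simp only [Pi.smul_apply, Finset.sum_apply, smul_eq_mul, d, hM, Matrix.of_apply, hfi i₀ hi₀]
    rw [eq_neg_of_add_eq_zero_left h1.symm, ← Finset.sum_neg_distrib]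
    exact Finset.sum_congr rfl fun r _ => by ring
  let ℓ : (Fin (P + 1 : ℕ) → A) →ₗ[A] A :=
    (Matrix.detRowAlternating (R := A) (n := Fin (P + 1 : ℕ))).toMultilinearMap.toLinearMap M i₀
  have hℓ : ∀ y, ℓ y = (M.updateRow i₀ y).det := fun y => rfl
  calc v k (Sum.inl P) * M.det = ℓ (v k (Sum.inl P) • M i₀) := by
        rw [map_smul, hℓ, Matrix.updateRow_eq_self, smul_eq_mul]
    _ = 0 := by
        rw [hrow, map_sum]
        refine Finset.sum_eq_zero fun r _ => ?_
        rw [map_smul, hℓ]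
        by_cases hr : pairIdx r < P
        · have h3 := det_eq_zero_of_isotropic_of_lt hrad hlow hiso hP (Function.update f i₀ r) g
            (fun i => by
              rcases eq_or_ne i i₀ with rfl | hi
              · simpa using hr
              · simpa [hi] using hlt i hi) hg
          have h4 : M.updateRow i₀ (fun j => trunc P (v (g j)) r) =
              Matrix.of fun i j => v (g j) (Function.update f i₀ r i) := by
            ext i j
            rcases eq_or_ne i i₀ with rfl | hi
            · simp [trunc_apply, hr]
            · simp [hi, hM]
          rw [h4, h3, smul_zero]
        · rw [Matrix.det_eq_zero_of_row_eq_zero i₀ (by simp [trunc_apply, hr]), smul_zero]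

end LowRank

variable {K : Type u} [Field K] {n m : ℕ}

theorem deadX_succ (P : Fin n) (k : Fin m) :
    deadX m P (k + 1) = insert (Sum.inl P, k) (deadX m P k) := by
  ext ⟨r, j⟩
  simp only [deadX, Set.mem_insert_iff, Set.mem_ofPred_eq, Prod.mk.injEq, Fin.ext_iff]
  by_cases hr : r = Sum.inl P
  · simp only [hr, true_and, pairIdx_inl]
    omega
  · simp [hr]

theorem deadY_succ (P : Fin n) (k : Fin m) :
    deadY m P (k + 1) = insert (Sum.inr P, k) (deadY m P k) := by
  ext ⟨r, j⟩
  simp only [deadY, Set.mem_insert_iff, Set.mem_ofPred_eq, Prod.mk.injEq, Fin.ext_iff]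
  by_cases hr : r = Sum.inr P
  · simp only [hr, true_and, pairIdx_inr, reduceCtorEq, false_or]
    omega
  · simp [hr]

theorem deadX_zero (P : Fin n) : deadX m P 0 = deadN n m (P + 1) := by
  ext ⟨r, j⟩
  simp [deadX, deadN]

theorem deadX_last (P : Fin n) : deadX m P m = deadY m P 0 := by
  ext ⟨r, j⟩
  simp [deadX, deadY]

theorem deadY_last (P : Fin n) : deadY m P m = deadN n m P := by
  ext ⟨r, j⟩
  rcases r with r | r
  · simp only [deadY, deadN, Set.mem_ofPred_eq, pairIdx_inl, Sum.inl.injEq, reduceCtorEq,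
      false_and, or_false, Fin.ext_iff]
    omega
  · simp only [deadY, deadN, Set.mem_ofPred_eq, pairIdx_inr, Sum.inr.injEq, reduceCtorEq,
      false_or, Fin.ext_iff, j.2, and_true]
    omega

theorem isRankFunction_id : IsRankFunction id :=
  ⟨monotone_id, rfl, fun _ => le_rfl⟩

theorem ker_constantCoeff_le {σ : Type*} {J : Ideal (MvPolynomial σ K)} (hX : ∀ s, X s ∈ J) :
    RingHom.ker (constantCoeff : MvPolynomial σ K →+* K) ≤ J := by
  intro f hf
  rw [RingHom.mem_ker] at hf
  rw [f.as_sum]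
  refine sum_mem fun d hd => ?_
  have hd0 : d ≠ 0 := by
    rintro rfl
    rw [constantCoeff_eq] at hf
    exact mem_support_iff.mp hd hf
  obtain ⟨i, hi⟩ := Finsupp.ne_iff.mp hd0
  refine Ideal.mem_of_dvd _ ?_ (hX i)
  rw [X_dvd_monomial]
  exact Or.inr hi

theorem locusIdeal_le_ker_constantCoeff (ρ : ℕ → ℕ) (Z : Set ((Fin n ⊕ Fin n) × Fin m)) :
    locusIdeal K ρ Z ≤
      RingHom.ker (constantCoeff : MvPolynomial ((Fin n ⊕ Fin n) × Fin m) K →+* K) := by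
  rw [locusIdeal_le_ker_iff]
  simp only [constantCoeff_X]
  refine ⟨fun i j => by simp, fun l f g _ => ?_, fun _ _ => rfl⟩
  exact Matrix.det_eq_zero_of_row_eq_zero 0 fun _ => rfl

theorem isRadical_deadN_zero (ρ : ℕ → ℕ) : (locusIdeal K ρ (deadN n m 0)).IsRadical := by
  have hX : ∀ s, X s ∈ locusIdeal K ρ (deadN n m 0) := fun s =>
    ((locusIdeal_le_iff _).mp le_rfl).2.2 s (Nat.zero_le _)
  rw [le_antisymm (locusIdeal_le_ker_constantCoeff ρ _) (ker_constantCoeff_le hX)]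
  exact (RingHom.ker_isPrime _).isRadical

theorem isRadical_deadY {P : Fin n}
    (hrad : ∀ ρ, IsRankFunction ρ → (locusIdeal K ρ (deadN n m P)).IsRadical) {k : ℕ} (hk : k ≤ m) :
    ∀ ρ, IsRankFunction ρ → (locusIdeal K ρ (deadY m P k)).IsRadical := by
  induction hk using Nat.decreasingInduction with
  | self => rwa [deadY_last]
  | of_succ k hk ih =>
    let k' : Fin m := ⟨k, hk⟩
    change ∀ ρ, IsRankFunction ρ → (locusIdeal K ρ (deadY m P k')).IsRadical
    change ∀ ρ, IsRankFunction ρ → (locusIdeal K ρ (deadY m P (k' + 1))).IsRadical at ih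
    rw [deadY_succ] at ih
    refine isRadical_of_insert (p := P) (by simp [deadY]) (fun i hi => Or.inr (Or.inr ⟨rfl, hi⟩)) ih
      (fun ρ h1 h2 s _ h3 h4 => radical_isPrime_deadY P h1 h2 h3 h4) fun ρ f g hg => ?_
    refine Ideal.mul_mem_left _ _ ?_
    have hpt := isPoint_mk (le_refl (locusIdeal K ρ (deadY m P k')))
    rw [← Ideal.Quotient.eq_zero_iff_mem,
      ← det_map_of (Ideal.Quotient.mk (locusIdeal K ρ (deadY m P k'))) fun j r => X (r, j)]
    by_cases hf : ∀ i, pairIdx (f i) < P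
    · exact det_eq_zero_of_isotropic_of_lt (hrad id isRankFunction_id)
        (v := fun j r => Ideal.Quotient.mk (locusIdeal K ρ (deadY m P k')) (X (r, j)))
        (fun j r hr => hpt.zero (r, j) (Or.inl hr)) hpt.isotropic
        (fun j _ => hpt.zero (Sum.inl P, j) (Or.inr (Or.inl rfl))) f g hf hg
    · push Not at hf
      obtain ⟨i, hi⟩ := hf
      refine Matrix.det_eq_zero_of_row_eq_zero i fun j => ?_
      have h1 := deadY_last (m := m) P
      have h2 : (f i, g j) ∈ deadY m P m := h1 ▸ hi
      refine hpt.zero (f i, g j) ?_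
      rcases h2 with h2 | h2 | h2
      · exact Or.inl h2
      · exact Or.inr (Or.inl h2)
      · exact Or.inr (Or.inr ⟨h2.1, hg j⟩)

theorem isRadical_deadX {P : Fin n}
    (hrad : ∀ ρ, IsRankFunction ρ → (locusIdeal K ρ (deadN n m P)).IsRadical) {k : ℕ} (hk : k ≤ m) :
    ∀ ρ, IsRankFunction ρ → (locusIdeal K ρ (deadX m P k)).IsRadical := by
  induction hk using Nat.decreasingInduction with
  | self =>
    rw [deadX_last]
    exact isRadical_deadY hrad (Nat.zero_le _)
  | of_succ k hk ih =>
    let k' : Fin m := ⟨k, hk⟩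
    change ∀ ρ, IsRankFunction ρ → (locusIdeal K ρ (deadX m P k')).IsRadical
    change ∀ ρ, IsRankFunction ρ → (locusIdeal K ρ (deadX m P (k' + 1))).IsRadical at ih
    rw [deadX_succ] at ih
    refine isRadical_of_insert (p := P) (by simp [deadX]) (fun i hi => Or.inr ⟨rfl, hi⟩) ih
      (fun ρ h1 h2 s hs h3 h4 => radical_isPrime_deadX P h1 h2 h3 h4 hs) fun ρ f g hg => ?_
    have hpt := isPoint_mk (le_refl (locusIdeal K ρ (deadX m P k')))
    rw [← Ideal.Quotient.eq_zero_iff_mem, map_mul,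
      ← det_map_of (Ideal.Quotient.mk (locusIdeal K ρ (deadX m P k'))) fun j r => X (r, j)]
    exact mul_det_eq_zero (hrad id isRankFunction_id)
      (v := fun j r => Ideal.Quotient.mk (locusIdeal K ρ (deadX m P k')) (X (r, j)))
      (fun j r hr => hpt.zero (r, j) (Or.inl hr)) hpt.isotropic
      (fun j hj => hpt.zero (Sum.inl P, j) (Or.inr ⟨rfl, hj⟩)) f g hg

theorem isRadical_deadN {p : ℕ} (hp : p ≤ n) :
    ∀ ρ, IsRankFunction ρ → (locusIdeal K ρ (deadN n m p)).IsRadical := by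
  induction p with
  | zero => exact fun ρ _ => isRadical_deadN_zero ρ
  | succ p ih =>
    have h := isRadical_deadX (P := ⟨p, hp⟩) (ih (Nat.le_of_succ_le hp)) (Nat.zero_le m)
    rwa [deadX_zero] at h

theorem deadN_self : deadN n m n = ∅ := by
  ext ⟨r, j⟩
  simp [deadN, pairIdx_lt]

/-- The isotropic degeneracy ideal is prime. -/
theorem locusIdeal_isPrime {ρ : ℕ → ℕ} (hρ : IsRankFunction ρ) (h1 : ρ 1 = 1) :
    (locusIdeal K ρ (∅ : Set ((Fin (n + 1) ⊕ Fin (n + 1)) × Fin m))).IsPrime := by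
  have h := radical_isPrime_deadX (K := K) (m := m) (Fin.last n) hρ.monotone hρ.zero hρ.zero h1
    (Nat.zero_le _)
  rw [deadX_zero, Fin.val_last, deadN_self] at h
  have h2 := isRadical_deadN (K := K) (m := m) (le_refl (n + 1)) ρ hρ
  rw [deadN_self] at h2
  rwa [h2.radical] at h

theorem locusIdeal_sup_isRadical {ρ : ℕ → ℕ} (hρ : IsRankFunction ρ) :
    (locusIdeal K ρ (∅ : Set ((Fin (n + 1) ⊕ Fin (n + 1)) × Fin (m + 1))) ⊔
      Ideal.span {X (Sum.inl (Fin.last n), 0)}).IsRadical := by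
  have h := isRadical_deadX (K := K) (P := Fin.last n) (isRadical_deadN (Fin.last n).2.le)
    (Nat.succ_le_succ (Nat.zero_le m)) ρ hρ
  rw [show Nat.succ 0 = ((0 : Fin (m + 1)) : ℕ) + 1 from rfl, deadX_succ, Fin.val_zero, deadX_zero,
    Fin.val_last, deadN_self, locusIdeal_insert] at h
  exact h

theorem X_notMem_locusIdeal {ρ : ℕ → ℕ} (hρ : IsRankFunction ρ) (h1 : ρ 1 = 1)
    (a : Fin n ⊕ Fin n) :
    X (a, 0) ∉ locusIdeal K ρ (∅ : Set ((Fin n ⊕ Fin n) × Fin (m + 1))) :=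
  fun h => X_notMem_radical hρ.monotone (k := 0) h1.ge (Set.notMem_empty _) (Ideal.le_radical h)

theorem injective_of_surjective_endomorphism {M : Type*} [CommRing M] [IsNoetherianRing M]
    (f : M →+* M) (hf : Function.Surjective f) : Function.Injective f := by
  have hsurj : ∀ n : ℕ, Function.Surjective (f ^ n : M →+* M) := by
    intro n
    rw [RingHom.coe_pow]
    exact hf.iterate n
  obtain ⟨n, hn⟩ := monotone_stabilizes_iff_noetherian.mpr (inferInstanceAs (IsNoetherian M M))
    ⟨fun n => RingHom.ker (f ^ n), monotone_nat_of_le_succ fun n x hx => by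
      rw [RingHom.mem_ker] at hx ⊢
      rw [pow_succ', RingHom.mul_def, RingHom.comp_apply, hx, map_zero]⟩
  rw [injective_iff_map_eq_zero]
  intro a ha
  obtain ⟨b, rfl⟩ := hsurj n a
  have h1 : b ∈ RingHom.ker (f ^ (n + 1)) := by
    rw [RingHom.mem_ker, pow_succ', RingHom.mul_def, RingHom.comp_apply, ha]
  have h2 := hn (n + 1) (Nat.le_succ n)
  simp only [OrderHom.coe_mk] at h2
  rw [← h2] at h1
  exact h1

/-- If inverting `x` embeds a domain `A` in a normal domain and `A / xA` is reduced, then `A` is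
normal. -/
theorem isIntegrallyClosed_of_isRadical_span {A N : Type*} [CommRing A] [IsDomain A] [CommRing N]
    [IsDomain N] [IsIntegrallyClosed N] (x : A) (hx0 : x ≠ 0) (hx : (Ideal.span {x}).IsRadical)
    (φ : A →+* N) (hφ : Function.Injective φ) (hsurj : ∀ z, ∃ k a, φ x ^ k * z = φ a) :
    IsIntegrallyClosed A := by
  have key : ∀ (k : ℕ) (a b : A) (z : N), φ b * z = φ a → b = x ^ k →
      (φ.IsIntegralElem z) → ∃ c, φ c = z := by
    intro k
    induction k with
    | zero =>
      intro a b z h hb _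
      rw [hb, pow_zero, map_one, one_mul] at h
      exact ⟨a, h.symm⟩
    | succ k ih =>
      intro a b z h hb hz
      have hrel : a ∈ Ideal.span {x} := by
        apply hx
        obtain ⟨p, hp, hpz⟩ := hz
        have hroot : (p.scaleRoots b).IsRoot a := by
          apply hφ
          rw [map_zero, ← Polynomial.eval₂_hom, ← h]
          exact Polynomial.scaleRoots_eval₂_eq_zero φ hpz
        have hb' : b ∈ Ideal.span {x} := by
          rw [hb, pow_succ]
          exact Ideal.mul_mem_left _ _ (Ideal.mem_span_singleton_self x)
        exact ⟨_, (Polynomial.scaleRoots.isWeaklyEisensteinAt p hb').pow_natDegree_le_of_root_of_monic_mem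
          hroot ((Polynomial.monic_scaleRoots_iff b).mpr hp) _ le_rfl⟩
      obtain ⟨a', rfl⟩ := Ideal.mem_span_singleton'.mp hrel
      refine ih a' (x ^ k) z ?_ rfl hz
      have hφx : φ x ≠ 0 := (map_ne_zero_iff φ hφ).mpr hx0
      apply mul_left_cancel₀ hφx
      rw [← mul_assoc, ← map_mul, ← pow_succ', ← hb, h, map_mul, mul_comm]
  rw [isIntegrallyClosed_iff (FractionRing A)]
  intro z hz
  let g : FractionRing A →+* FractionRing N :=
    IsFractionRing.lift (g := (algebraMap N (FractionRing N)).comp φ)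
      ((IsFractionRing.injective N (FractionRing N)).comp hφ)
  have hg : ∀ a, g (algebraMap A _ a) = algebraMap N _ (φ a) := fun a =>
    IsFractionRing.lift_algebraMap _ a
  obtain ⟨p, hp, hpz⟩ := hz
  have hgz : IsIntegral N (g z) := by
    refine ⟨p.map φ, hp.map φ, ?_⟩
    rw [Polynomial.eval₂_map, show (algebraMap N (FractionRing N)).comp φ =
      g.comp (algebraMap A _) from RingHom.ext fun a => (hg a).symm, ← Polynomial.hom_eval₂, hpz,
      map_zero]
  obtain ⟨y, hy⟩ := (isIntegrallyClosed_iff (FractionRing N)).mp inferInstance hgz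
  have hyint : φ.IsIntegralElem y := by
    refine ⟨p, hp, ?_⟩
    apply IsFractionRing.injective N (FractionRing N)
    rw [Polynomial.hom_eval₂, hy, map_zero, show (algebraMap N (FractionRing N)).comp φ =
      g.comp (algebraMap A _) from RingHom.ext fun a => (hg a).symm, ← Polynomial.hom_eval₂, hpz,
      map_zero]
  obtain ⟨k, a, hka⟩ := hsurj y
  obtain ⟨c, hc⟩ := key k a (x ^ k) y (by rw [map_pow, hka]) rfl hyint
  refine ⟨c, g.injective ?_⟩
  rw [hg, hc, hy]

instance mvPolynomial_isIntegrallyClosed {σ D : Type*} [Finite σ] [CommRing D] [IsDomain D]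
    [IsIntegrallyClosed D] : IsIntegrallyClosed (MvPolynomial σ D) := by
  induction σ using Finite.induction_empty_option with
  | of_equiv e H => exact IsIntegrallyClosed.of_equiv (renameEquiv D e).toRingEquiv
  | h_empty => exact IsIntegrallyClosed.of_equiv (isEmptyRingEquiv D PEmpty).symm
  | h_option IH => exact IsIntegrallyClosed.of_equiv (optionEquivLeft D _).symm.toRingEquiv

section Height

variable {σ D : Type*} [CommRing D]

open Classical in
/-- Setting the variables in `s` to zero. -/
def killVars (D : Type*) [CommRing D] (s : Set σ) : MvPolynomial σ D →ₐ[D] MvPolynomial σ D :=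
  aeval fun i => if i ∈ s then 0 else X i

theorem killVars_X_of_mem {s : Set σ} {i : σ} (h : i ∈ s) : killVars D s (X i) = 0 := by
  rw [killVars, aeval_X, if_pos h]

theorem killVars_X_of_notMem {s : Set σ} {i : σ} (h : i ∉ s) : killVars D s (X i) = X i := by
  rw [killVars, aeval_X, if_neg h]

theorem ker_killVars (s : Set σ) :
    RingHom.ker (killVars D s) = Ideal.span ((X : σ → MvPolynomial σ D) '' s) := by
  apply le_antisymm
  · intro f hf
    have h : (Ideal.Quotient.mkₐ D (Ideal.span ((X : σ → MvPolynomial σ D) '' s))).comp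
        (killVars D s) = Ideal.Quotient.mkₐ D _ := by
      ext i
      rw [AlgHom.comp_apply]
      by_cases hi : i ∈ s
      · rw [killVars_X_of_mem hi, map_zero, eq_comm, Ideal.Quotient.mkₐ_eq_mk,
          Ideal.Quotient.eq_zero_iff_mem]
        exact Ideal.subset_span ⟨i, hi, rfl⟩
      · rw [killVars_X_of_notMem hi]
    have h2 := congrArg (fun g => g f) h
    rw [RingHom.mem_ker] at hf
    simp only [AlgHom.comp_apply, hf, map_zero] at h2
    rw [← Ideal.Quotient.eq_zero_iff_mem]
    exact h2.symm
  · rw [Ideal.span_le]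
    rintro _ ⟨i, hi, rfl⟩
    exact killVars_X_of_mem hi

theorem isPrime_span_X_image [IsDomain D] (s : Set σ) :
    (Ideal.span ((X : σ → MvPolynomial σ D) '' s)).IsPrime := by
  rw [← ker_killVars]
  exact RingHom.ker_isPrime _

theorem height_span_X_image [IsDomain D] [IsNoetherianRing D] [Finite σ] (s : Finset σ) :
    (Ideal.span ((X : σ → MvPolynomial σ D) '' s)).height = s.card := by
  classical
  apply le_antisymm
  · have h := isPrime_span_X_image (D := D) (s : Set σ)
    have h2 := Ideal.height_le_card_of_mem_minimalPrimes_span_finset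
      (p := Ideal.span ((X : σ → MvPolynomial σ D) '' s)) (s := s.image X)
      (by rw [Finset.coe_image, Ideal.minimalPrimes_eq_subsingleton_self]; rfl)
    exact h2.trans (Nat.cast_le.mpr Finset.card_image_le)
  · induction s using Finset.induction_on with
    | empty => simp
    | insert i s hi ih =>
      have h1 := isPrime_span_X_image (D := D) (s : Set σ)
      have h2 := isPrime_span_X_image (D := D) ((insert i s : Finset σ) : Set σ)
      rw [Finset.card_insert_of_notMem hi, Nat.cast_add, Nat.cast_one]
      refine (add_le_add_left ih 1).trans
        (Ideal.height_add_one_le_of_lt_of_isPrime (lt_of_le_of_ne ?_ ?_))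
      · exact Ideal.span_mono (Set.image_mono (by simp))
      · intro h
        have h3 : (X i : MvPolynomial σ D) ∈ Ideal.span ((X : σ → MvPolynomial σ D) '' s) := by
          rw [h]
          exact Ideal.subset_span ⟨i, by simp, rfl⟩
        rw [← ker_killVars, RingHom.mem_ker, killVars_X_of_notMem (by simpa using hi)] at h3
        exact X_ne_zero i h3

/-- The ideal of `B[σ]` generated by the ideal `q` of `B` and by the variables in `s`. -/
def extVars {B : Type*} [CommRing B] (q : Ideal B) (s : Set σ) : Ideal (MvPolynomial σ B) :=
  q.map C ⊔ Ideal.span (X '' s)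

variable {B : Type*} [CommRing B] (q : Ideal B)

theorem extVars_eq_comap (s : Set σ) :
    extVars q s = (Ideal.span (X '' s)).comap (MvPolynomial.map (σ := σ) (Ideal.Quotient.mk q)) := by
  have hs : Function.Surjective (MvPolynomial.map (σ := σ) (Ideal.Quotient.mk q)) :=
    map_surjective _ Ideal.Quotient.mk_surjective
  have h : Ideal.span ((X : σ → MvPolynomial σ (B ⧸ q)) '' s) =
      (Ideal.span ((X : σ → MvPolynomial σ B) '' s)).map
        (MvPolynomial.map (σ := σ) (Ideal.Quotient.mk q)) := by
    rw [Ideal.map_span, ← Set.image_comp]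
    congr 2
    ext i
    simp
  rw [h, Ideal.comap_map_of_surjective' _ hs, extVars, sup_comm, MvPolynomial.ker_map,
    Ideal.mk_ker]

theorem isPrime_extVars [q.IsPrime] (s : Set σ) : (extVars q s).IsPrime := by
  rw [extVars_eq_comap]
  have := isPrime_span_X_image (D := B ⧸ q) s
  exact Ideal.comap_isPrime _ _

theorem extVars_le_ker_iff {A : Type*} [CommRing A] (s : Set σ) (g : MvPolynomial σ B →+* A) :
    extVars q s ≤ RingHom.ker g ↔ q ≤ RingHom.ker (g.comp C) ∧ ∀ i ∈ s, g (X i) = 0 := by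
  rw [extVars, sup_le_iff, Ideal.map_le_iff_le_comap, Ideal.span_le, Set.image_subset_iff,
    RingHom.comap_ker]
  rfl

theorem X_notMem_extVars [q.IsPrime] {s : Set σ} {i : σ} (h : i ∉ s) : X i ∉ extVars q s := by
  rw [extVars_eq_comap, Ideal.mem_comap, map_X, ← ker_killVars, RingHom.mem_ker,
    killVars_X_of_notMem h]
  exact X_ne_zero i

theorem height_extVars [IsNoetherianRing B] [Finite σ] [hq : q.IsPrime] (s : Finset σ) :
    (extVars q (s : Set σ)).height = q.height + s.card := by
  have h := isPrime_extVars q (s : Set σ)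
  have hover : (extVars q (s : Set σ)).LiesOver q := by
    constructor
    ext b
    rw [Ideal.under_def, Ideal.mem_comap, extVars_eq_comap, Ideal.mem_comap, ← ker_killVars,
      RingHom.mem_ker, algebraMap_eq, map_C, ← algebraMap_eq, AlgHom.commutes, algebraMap_eq,
      C_eq_zero, Ideal.Quotient.eq_zero_iff_mem]
  rw [Ideal.height_eq_height_add_of_liesOver_of_hasGoingDown q (extVars q (s : Set σ))]
  congr 1
  have hs : Function.Surjective (MvPolynomial.map (σ := σ) (Ideal.Quotient.mk q)) :=
    map_surjective _ Ideal.Quotient.mk_surjective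
  let e := RingHom.quotientKerEquivOfSurjective hs
  have hk : q.map (algebraMap B (MvPolynomial σ B)) =
      RingHom.ker (MvPolynomial.map (σ := σ) (Ideal.Quotient.mk q)) := by
    rw [MvPolynomial.ker_map, Ideal.mk_ker, algebraMap_eq]
  rw [← height_span_X_image (D := B ⧸ q) s, hk, ← RingEquiv.height_comap e]
  congr 1
  have h2 := extVars_eq_comap q (s : Set σ)
  have h3 : extVars q (s : Set σ) = ((Ideal.span (X '' s)).comap e).comap (Ideal.Quotient.mk
      (RingHom.ker (MvPolynomial.map (σ := σ) (Ideal.Quotient.mk q)))) := h2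
  rw [h3, Ideal.map_comap_of_surjective _ Ideal.Quotient.mk_surjective]

/-- Polynomial extensions and killing variables preserve normality. -/
theorem isIntegrallyClosed_quotient_extVars {τ κ : Type*} [Finite τ] [q.IsPrime]
    [IsIntegrallyClosed (B ⧸ q)] :
    IsIntegrallyClosed (MvPolynomial (τ ⊕ κ) B ⧸ extVars q (Set.range (Sum.inr : κ → τ ⊕ κ))) := by
  let π : MvPolynomial (τ ⊕ κ) B →+* MvPolynomial τ (B ⧸ q) :=
    eval₂Hom (C.comp (Ideal.Quotient.mk q)) (Sum.elim X fun _ => 0)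
  let ι : MvPolynomial τ (B ⧸ q) →+*
      MvPolynomial (τ ⊕ κ) B ⧸ extVars q (Set.range (Sum.inr : κ → τ ⊕ κ)) :=
    eval₂Hom (Ideal.Quotient.lift q ((Ideal.Quotient.mk _).comp C) fun b hb => by
      rw [RingHom.comp_apply, Ideal.Quotient.eq_zero_iff_mem]
      exact Ideal.mem_sup_left (Ideal.mem_map_of_mem _ hb))
      fun i => Ideal.Quotient.mk _ (X (Sum.inl i))
  have hιπ : ι.comp π = Ideal.Quotient.mk _ := by
    apply MvPolynomial.ringHom_ext
    · intro b
      simp [ι, π]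
    · rintro (i | i)
      · simp [ι, π]
      · simp only [RingHom.comp_apply, coe_eval₂Hom, eval₂_X, Sum.elim_inr, map_zero, π]
        rw [eq_comm, Ideal.Quotient.eq_zero_iff_mem]
        exact Ideal.mem_sup_right (Ideal.subset_span ⟨_, ⟨i, rfl⟩, rfl⟩)
  have hπ : ∀ f ∈ extVars q (Set.range (Sum.inr : κ → τ ⊕ κ)), π f = 0 := by
    refine (extVars_le_ker_iff q _ π).mpr ⟨fun b hb => ?_, ?_⟩
    · simp only [RingHom.mem_ker, RingHom.comp_apply, coe_eval₂Hom, eval₂_C, π]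
      rw [Ideal.Quotient.eq_zero_iff_mem.mpr hb, map_zero]
    · rintro _ ⟨i, rfl⟩
      simp [π]
  refine IsIntegrallyClosed.of_equiv (RingEquiv.ofRingHom ι (Ideal.Quotient.lift _ π hπ) ?_ ?_)
  · apply Ideal.Quotient.ringHom_ext
    rw [RingHom.comp_assoc, Ideal.Quotient.lift_comp_mk, hιπ]
    rfl
  · apply MvPolynomial.ringHom_ext
    · intro b
      obtain ⟨b, rfl⟩ := Ideal.Quotient.mk_surjective b
      simp [ι, π]
    · intro i
      simp [ι, π]

end Height

theorem disjoint_powers {R : Type*} [CommRing R] {I : Ideal R} (hI : I.IsPrime) {x : R}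
    (hx : x ∉ I) : Disjoint (Submonoid.powers x : Set R) I := by
  rw [Set.disjoint_left]
  rintro _ ⟨k, rfl⟩ h
  exact hx (hI.mem_of_pow_mem k h)

/-- Height and normality can be transferred along an isomorphism after inverting an element. -/
theorem height_eq_and_isIntegrallyClosed {R S M : Type u} [CommRing R] [IsNoetherianRing R]
    [CommRing S] [CommRing M] [Algebra R M] (e : R ≃+* S) (x : R)
    [IsLocalization.Away x M] (ψ : S →+* M) (hx : ψ (e x) = algebraMap R M x)
    (hsurj : ∀ θ : M →+* M, (∀ f, θ (algebraMap R M f) = ψ (e f)) → Function.Surjective θ)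
    (I : Ideal R) (P : Ideal S) [hI : I.IsPrime] [hP : P.IsPrime] (hxI : x ∉ I) (hxP : e x ∉ P)
    (hIP : ∀ (L : Type u) [Field L] (g : M →+* L),
      I ≤ RingHom.ker (g.comp (algebraMap R M)) ↔ P ≤ RingHom.ker (g.comp ψ)) :
    I.height = P.height ∧ (IsIntegrallyClosed (S ⧸ P) →
      IsIntegrallyClosed (M ⧸ I.map (algebraMap R M))) := by
  have hunit : IsUnit ((ψ.comp (e : R →+* S)) x) := by
    change IsUnit (ψ (e x))
    rw [hx]
    exact IsLocalization.Away.algebraMap_isUnit x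
  let θ : M →+* M := IsLocalization.Away.lift x hunit
  have hθ : ∀ f, θ (algebraMap R M f) = ψ (e f) := fun f => IsLocalization.Away.lift_eq x hunit f
  have : IsNoetherianRing M := IsLocalization.isNoetherianRing (Submonoid.powers x) M inferInstance
  have hbij : Function.Bijective θ :=
    ⟨injective_of_surjective_endomorphism θ (hsurj θ hθ), hsurj θ hθ⟩
  let Θ : M ≃+* M := RingEquiv.ofBijective θ hbij
  have hΘ : ∀ f, Θ (algebraMap R M f) = ψ (e f) := hθ
  let P' : Ideal R := P.comap e
  have hP' : P'.IsPrime := Ideal.comap_isPrime _ _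
  have dI := disjoint_powers hI hxI
  have dP : Disjoint (Submonoid.powers x : Set R) P' := disjoint_powers hP' hxP
  let IM := I.map (algebraMap R M)
  let PM := P'.map (algebraMap R M)
  have hIM : IM.IsPrime := IsLocalization.isPrime_of_isPrime_disjoint (Submonoid.powers x) M I hI dI
  have hPM : PM.IsPrime :=
    IsLocalization.isPrime_of_isPrime_disjoint (Submonoid.powers x) M P' hP' dP
  have ker_frac : ∀ (J : Ideal M) [J.IsPrime], RingHom.ker
      ((algebraMap (M ⧸ J) (FractionRing (M ⧸ J))).comp (Ideal.Quotient.mk J)) = J := by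
    intro J _
    ext z
    rw [RingHom.mem_ker, RingHom.comp_apply,
      map_eq_zero_iff _ (IsFractionRing.injective (M ⧸ J) (FractionRing (M ⧸ J))),
      Ideal.Quotient.eq_zero_iff_mem]
  have key : IM.comap Θ = PM := by
    apply le_antisymm
    · have h := (hIP _ (((algebraMap (M ⧸ PM) (FractionRing (M ⧸ PM))).comp
        (Ideal.Quotient.mk PM)).comp (Θ.symm : M →+* M))).mpr ?_
      · rw [← RingHom.comap_ker, ← Ideal.map_le_iff_le_comap] at h
        intro z hz
        have h2 := h hz
        rw [← RingHom.comap_ker, ker_frac, Ideal.mem_comap] at h2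
        simpa using h2
      · intro p hp
        obtain ⟨f, rfl⟩ := e.surjective p
        rw [RingHom.mem_ker, RingHom.comp_apply, ← RingHom.mem_ker, ← RingHom.comap_ker, ker_frac,
          Ideal.mem_comap, ← hΘ]
        simp only [RingHom.coe_coe, RingEquiv.symm_apply_apply]
        exact Ideal.mem_map_of_mem _ hp
    · rw [Ideal.map_le_iff_le_comap]
      intro f hf
      have h := (hIP _ ((algebraMap (M ⧸ IM) (FractionRing (M ⧸ IM))).comp
        (Ideal.Quotient.mk IM))).mp (by
          rw [← RingHom.comap_ker, ker_frac]
          exact Ideal.le_comap_map)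
      have h2 := h (show e f ∈ P from hf)
      rw [← RingHom.comap_ker, ker_frac, Ideal.mem_comap, ← hΘ] at h2
      exact h2
  constructor
  · rw [← IsLocalization.height_map_of_disjoint (S := M) (Submonoid.powers x) I dI,
      ← RingEquiv.height_comap Θ, key,
      IsLocalization.height_map_of_disjoint (S := M) (Submonoid.powers x) P' dP,
      RingEquiv.height_comap]
  · intro hN
    have : IsIntegrallyClosed (R ⧸ P') :=
      IsIntegrallyClosed.of_equiv (Ideal.quotientEquiv P' P e
        (Ideal.map_comap_of_surjective e e.surjective P).symm).symm
    have : IsIntegrallyClosed (M ⧸ PM) := by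
      refine isIntegrallyClosed_of_isLocalization (R := R ⧸ P') (M ⧸ PM)
        (Algebra.algebraMapSubmonoid (R ⧸ P') (Submonoid.powers x)) ?_
      rintro _ ⟨y, hy, rfl⟩
      refine mem_nonZeroDivisors_of_ne_zero fun h => ?_
      exact Set.disjoint_left.mp dP hy (Ideal.Quotient.eq_zero_iff_mem.mp h)
    refine IsIntegrallyClosed.of_equiv (Ideal.quotientEquiv PM IM Θ ?_)
    rw [← key]
    exact (Ideal.map_comap_of_surjective Θ Θ.surjective IM).symm

/-- Normality of `R / I` from normality after inverting `x` and reducedness modulo `x`. -/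
theorem isIntegrallyClosed_quotient_of_away {R M : Type u} [CommRing R] [CommRing M] [Algebra R M]
    (x : R) [IsLocalization.Away x M] (I : Ideal R) [hI : I.IsPrime] (hxI : x ∉ I)
    (hrad : (I ⊔ Ideal.span {x}).IsRadical)
    (hN : IsIntegrallyClosed (M ⧸ I.map (algebraMap R M))) : IsIntegrallyClosed (R ⧸ I) := by
  have dI := disjoint_powers hI hxI
  have hIM : (I.map (algebraMap R M)).IsPrime :=
    IsLocalization.isPrime_of_isPrime_disjoint (Submonoid.powers x) M I hI dI
  refine isIntegrallyClosed_of_isRadical_span (Ideal.Quotient.mk I x) ?_ ?_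
    (algebraMap (R ⧸ I) (M ⧸ I.map (algebraMap R M))) ?_ ?_
  · rwa [Ne, Ideal.Quotient.eq_zero_iff_mem]
  · rintro a ⟨k, hk⟩
    obtain ⟨a, rfl⟩ := Ideal.Quotient.mk_surjective a
    have h : ∀ b : R, Ideal.Quotient.mk I b ∈ Ideal.span {Ideal.Quotient.mk I x} ↔
        b ∈ I ⊔ Ideal.span {x} := by
      intro b
      rw [← Set.image_singleton, ← Ideal.map_span, ← Ideal.mem_comap,
        Ideal.comap_map_of_surjective' _ Ideal.Quotient.mk_surjective, Ideal.mk_ker, sup_comm]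
    rw [h]
    rw [← map_pow, h] at hk
    exact hrad ⟨k, hk⟩
  · rw [injective_iff_map_eq_zero]
    intro a ha
    obtain ⟨a, rfl⟩ := Ideal.Quotient.mk_surjective a
    have h : Ideal.Quotient.mk (I.map (algebraMap R M)) (algebraMap R M a) = 0 := ha
    rw [Ideal.Quotient.eq_zero_iff_mem] at h ⊢
    rw [← IsLocalization.under_map_of_isPrime_disjoint (Submonoid.powers x) M hI dI]
    exact h
  · intro z
    obtain ⟨z, rfl⟩ := Ideal.Quotient.mk_surjective z
    obtain ⟨k, a, h⟩ := IsLocalization.Away.surj x z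
    refine ⟨k, Ideal.Quotient.mk I a, ?_⟩
    have h2 := congrArg (Ideal.Quotient.mk (I.map (algebraMap R M))) h
    rw [map_mul, map_pow, mul_comm] at h2
    exact h2

theorem isRankFunction_min (r : ℕ) : IsRankFunction fun l => min l r :=
  ⟨fun a b h => min_le_min_right r h, by simp, fun l => by omega⟩

/-- With rank function `min · r`, only the total rank is constrained. -/
theorem isPoint_min_iff {n m r : ℕ} {L : Type*} [Field L] {v : Fin m → Fin n ⊕ Fin n → L} :
    IsPoint (fun l => min l r) ∅ v ↔ (∀ i j, symp (v i) (v j) = 0) ∧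
      Module.finrank L (Submodule.span L (Set.range v)) ≤ r := by
  rw [isPoint_iff]
  refine and_congr_right fun _ => ?_
  constructor
  · rintro ⟨h, -⟩
    have := h m
    rw [show {j : Fin m | (j : ℕ) < m} = Set.univ from Set.eq_univ_of_forall fun j => j.2,
      Set.image_univ] at this
    exact this.trans (min_le_right _ _)
  · intro h
    refine ⟨fun l => le_min ?_ ?_, by simp⟩
    · have := Fintype.ofFinite (v '' {j | (j : ℕ) < l})
      refine (finrank_span_le_card _).trans ?_
      rw [Set.toFinset_card, ← Nat.card_eq_fintype_card]
      refine (Nat.card_image_le (Set.toFinite _)).trans ?_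
      refine (Nat.card_le_card_of_injective
        (fun j : {j : Fin m | (j : ℕ) < l} => (⟨j.1, j.2⟩ : Fin l)) ?_).trans (by simp)
      intro i j hij
      exact Subtype.ext (Fin.ext (by simpa using hij))
    · exact (Submodule.finrank_mono (Submodule.span_mono (Set.image_subset_range _ _))).trans h

section Reduction

variable {n m : ℕ} {A : Type*} [CommRing A]

/-- The inclusion of the rows other than those of the last hyperbolic pair. -/
def lowRow : Fin n ⊕ Fin n → Fin (n + 1) ⊕ Fin (n + 1) :=
  Sum.map Fin.castSucc Fin.castSucc

theorem symp_eq_add_lowRow (u w : Fin (n + 1) ⊕ Fin (n + 1) → A) :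
    symp u w = symp (u ∘ lowRow) (w ∘ lowRow) +
      (u (Sum.inl (Fin.last n)) * w (Sum.inr (Fin.last n)) -
        u (Sum.inr (Fin.last n)) * w (Sum.inl (Fin.last n))) := by
  rw [symp_apply, symp_apply, Fin.sum_univ_castSucc]
  rfl

/-- Clear the row `inl (last n)` in the columns after the first one, where `y` is the inverse
of the pivot. -/
def clearPivot (y : A) (v : Fin (m + 1) → Fin (n + 1) ⊕ Fin (n + 1) → A) (i : Fin m) :
    Fin (n + 1) ⊕ Fin (n + 1) → A :=
  v i.succ - (v i.succ (Sum.inl (Fin.last n)) * y) • v 0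

theorem clearPivot_apply {y : A} {v : Fin (m + 1) → Fin (n + 1) ⊕ Fin (n + 1) → A}
    (hy : v 0 (Sum.inl (Fin.last n)) * y = 1) (i : Fin m) :
    clearPivot y v i (Sum.inl (Fin.last n)) = 0 := by
  simp only [clearPivot, Pi.sub_apply, Pi.smul_apply, smul_eq_mul]
  linear_combination (- v i.succ (Sum.inl (Fin.last n))) * hy

theorem symp_clearPivot_right (y : A) (v : Fin (m + 1) → Fin (n + 1) ⊕ Fin (n + 1) → A) (i : Fin m) :
    symp (v 0) (clearPivot y v i) = symp (v 0) (v i.succ) := by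
  simp [clearPivot]

theorem symp_clearPivot_clearPivot {y : A} {v : Fin (m + 1) → Fin (n + 1) ⊕ Fin (n + 1) → A}
    (h : ∀ i : Fin m, symp (v 0) (v i.succ) = 0) (i j : Fin m) :
    symp (clearPivot y v i) (clearPivot y v j) = symp (v i.succ) (v j.succ) := by
  have h' : symp (v i.succ) (v 0) = 0 := by rw [symp_swap, h, neg_zero]
  simp [clearPivot, h, h']

theorem symp_clearPivot_lowRow {y : A} {v : Fin (m + 1) → Fin (n + 1) ⊕ Fin (n + 1) → A}
    (hy : v 0 (Sum.inl (Fin.last n)) * y = 1) (h : ∀ i : Fin m, symp (v 0) (v i.succ) = 0)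
    (i j : Fin m) :
    symp (clearPivot y v i ∘ lowRow) (clearPivot y v j ∘ lowRow) = symp (v i.succ) (v j.succ) := by
  rw [← symp_clearPivot_clearPivot h, symp_eq_add_lowRow, clearPivot_apply hy, clearPivot_apply hy]
  ring

variable {L : Type*} [Field L]

theorem finrank_span_range_eq_clearPivot {y : L} {v : Fin (m + 1) → Fin (n + 1) ⊕ Fin (n + 1) → L}
    (hy : v 0 (Sum.inl (Fin.last n)) * y = 1) (h : ∀ i : Fin m, symp (v 0) (v i.succ) = 0) :
    Module.finrank L (Submodule.span L (Set.range v)) =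
      Module.finrank L (Submodule.span L (Set.range fun i => clearPivot y v i ∘ lowRow)) + 1 := by
  have hx : v 0 (Sum.inl (Fin.last n)) ≠ 0 := left_ne_zero_of_mul_eq_one hy
  set W := Submodule.span L (Set.range (clearPivot y v)) with hW
  let res : (Fin (n + 1) ⊕ Fin (n + 1) → L) →ₗ[L] (Fin n ⊕ Fin n → L) := LinearMap.funLeft L L lowRow
  have hpivot : ∀ z ∈ W, z (Sum.inl (Fin.last n)) = 0 := by
    have : W ≤ LinearMap.ker (LinearMap.proj (Sum.inl (Fin.last n)) :
        (Fin (n + 1) ⊕ Fin (n + 1) → L) →ₗ[L] L) := by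
      rw [hW, Submodule.span_le]
      rintro _ ⟨i, rfl⟩
      exact clearPivot_apply hy i
    exact this
  have horth : ∀ z ∈ W, symp (v 0) z = 0 := by
    have : W ≤ LinearMap.ker (symp (v 0)) := by
      rw [hW, Submodule.span_le]
      rintro _ ⟨i, rfl⟩
      exact (symp_clearPivot_right y v i).trans (h i)
    exact this
  have hres : Submodule.span L (Set.range fun i => clearPivot y v i ∘ lowRow) = W.map res := by
    rw [hW, Submodule.map_span, ← Set.range_comp]
    rfl
  have hinj : Function.Injective (res.domRestrict W) := by
    rw [injective_iff_map_eq_zero]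
    rintro ⟨z, hz⟩ h0
    have h0 : z ∘ lowRow = 0 := h0
    have h1 := horth z hz
    rw [symp_eq_add_lowRow, h0, map_zero, hpivot z hz, mul_zero, sub_zero, zero_add] at h1
    have h2 := (mul_eq_zero.mp h1).resolve_left hx
    ext s
    rcases s with k | k <;> induction k using Fin.lastCases with
    | last => first | exact hpivot z hz | exact h2
    | cast k => first | exact congrFun h0 (Sum.inl k) | exact congrFun h0 (Sum.inr k)
  have hdim : Module.finrank L (W.map res) = Module.finrank L W := by
    rw [← LinearMap.finrank_range_of_inj hinj, LinearMap.range_domRestrict]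
  have hspan : Submodule.span L (Set.range v) = Submodule.span L {v 0} ⊔ W := by
    apply le_antisymm
    · rw [Submodule.span_le]
      rintro _ ⟨i, rfl⟩
      have h0 : v 0 ∈ Submodule.span L {v 0} ⊔ W :=
        Submodule.mem_sup_left (Submodule.mem_span_singleton_self _)
      induction i using Fin.cases with
      | zero => exact h0
      | succ i =>
        have h1 : clearPivot y v i ∈ Submodule.span L {v 0} ⊔ W :=
          Submodule.mem_sup_right (Submodule.subset_span ⟨i, rfl⟩)
        have h2 := Submodule.add_mem _ h1
          (Submodule.smul_mem _ (v i.succ (Sum.inl (Fin.last n)) * y) h0)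
        simpa [clearPivot] using h2
    · refine sup_le ?_ ?_
      · rw [Submodule.span_singleton_le_iff_mem]
        exact Submodule.subset_span ⟨0, rfl⟩
      · rw [hW, Submodule.span_le]
        rintro _ ⟨i, rfl⟩
        exact Submodule.sub_mem _ (Submodule.subset_span ⟨_, rfl⟩)
          (Submodule.smul_mem _ _ (Submodule.subset_span ⟨_, rfl⟩))
  have hdisj : Submodule.span L {v 0} ⊓ W = ⊥ := by
    rw [Submodule.eq_bot_iff]
    rintro z ⟨hz1, hz2⟩
    obtain ⟨c, rfl⟩ := Submodule.mem_span_singleton.mp hz1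
    have h3 : c * v 0 (Sum.inl (Fin.last n)) = 0 := hpivot _ hz2
    rw [(mul_eq_zero.mp h3).resolve_right hx, zero_smul]
  have hv0 : v 0 ≠ 0 := fun h0 => hx (congrFun h0 _)
  have h4 := Submodule.finrank_sup_add_finrank_inf_eq (Submodule.span L {v 0}) W
  rw [hdisj, finrank_bot, finrank_span_singleton hv0] at h4
  rw [hspan, hres, hdim]
  omega

theorem isPoint_min_succ_iff {r : ℕ} {y : L} {v : Fin (m + 1) → Fin (n + 1) ⊕ Fin (n + 1) → L}
    (hy : v 0 (Sum.inl (Fin.last n)) * y = 1) :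
    IsPoint (fun l => min l (r + 1)) ∅ v ↔ (∀ i : Fin m, symp (v 0) (v i.succ) = 0) ∧
      IsPoint (fun l => min l r) ∅ fun i => clearPivot y v i ∘ lowRow := by
  rw [isPoint_min_iff, isPoint_min_iff]
  constructor
  · rintro ⟨h1, h2⟩
    have h : ∀ i : Fin m, symp (v 0) (v i.succ) = 0 := fun i => h1 _ _
    rw [finrank_span_range_eq_clearPivot hy h] at h2
    exact ⟨h, fun i j => by rw [symp_clearPivot_lowRow hy h, h1], by omega⟩
  · rintro ⟨h, h1, h2⟩
    rw [finrank_span_range_eq_clearPivot hy h]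
    refine ⟨fun i j => ?_, by omega⟩
    induction i using Fin.cases with
    | zero =>
      induction j using Fin.cases with
      | zero => exact symp_self _
      | succ j => exact h j
    | succ i =>
      induction j using Fin.cases with
      | zero => rw [symp_swap, h, neg_zero]
      | succ j => rw [← symp_clearPivot_lowRow hy h, h1]

end Reduction

section Pivot

variable {n m : ℕ}

/-- The partition of the entries of a matrix into the first column together with the row
`inl (last n)`, the row `inr (last n)`, and the remaining entries. -/
def entryOfBlock (n m : ℕ) :
    (((Fin (n + 1) ⊕ Fin (n + 1)) ⊕ Fin m) ⊕ Fin m) ⊕ ((Fin n ⊕ Fin n) × Fin m) →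
      (Fin (n + 1) ⊕ Fin (n + 1)) × Fin (m + 1)
  | Sum.inl (Sum.inl (Sum.inl s)) => (s, 0)
  | Sum.inl (Sum.inl (Sum.inr i)) => (Sum.inl (Fin.last n), i.succ)
  | Sum.inl (Sum.inr i) => (Sum.inr (Fin.last n), i.succ)
  | Sum.inr (s, i) => (lowRow s, i.succ)

theorem entryOfBlock_bijective (n m : ℕ) : Function.Bijective (entryOfBlock n m) := by
  constructor
  · rintro (((s | i) | i) | ⟨s | s, i⟩) (((s' | i') | i') | ⟨s' | s', i'⟩) h <;>
      simp_all [entryOfBlock, lowRow, Fin.castSucc_ne_last, (Fin.castSucc_ne_last _).symm,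
        (Fin.succ_ne_zero _).symm]
  · rintro ⟨s, j⟩
    induction j using Fin.cases with
    | zero => exact ⟨Sum.inl (Sum.inl (Sum.inl s)), rfl⟩
    | succ i =>
      rcases s with k | k <;> induction k using Fin.lastCases with
      | last => first
        | exact ⟨Sum.inl (Sum.inl (Sum.inr i)), rfl⟩
        | exact ⟨Sum.inl (Sum.inr i), rfl⟩
      | cast k => first
        | exact ⟨Sum.inr (Sum.inl k, i), rfl⟩
        | exact ⟨Sum.inr (Sum.inr k, i), rfl⟩

variable (K : Type u) [Field K]

/-- The polynomial ring in the entries, as an iterated polynomial ring. -/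
def blockEquiv (n m : ℕ) : MvPolynomial ((Fin (n + 1) ⊕ Fin (n + 1)) × Fin (m + 1)) K ≃ₐ[K]
    MvPolynomial (((Fin (n + 1) ⊕ Fin (n + 1)) ⊕ Fin m) ⊕ Fin m)
      (MvPolynomial ((Fin n ⊕ Fin n) × Fin m) K) :=
  (renameEquiv K (Equiv.ofBijective _ (entryOfBlock_bijective n m)).symm).trans
    (sumAlgEquiv K _ _)

theorem blockEquiv_X_inl (t : ((Fin (n + 1) ⊕ Fin (n + 1)) ⊕ Fin m) ⊕ Fin m) :
    blockEquiv K n m (X (entryOfBlock n m (Sum.inl t))) = X t := by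
  rw [blockEquiv, AlgEquiv.trans_apply, renameEquiv_apply, rename_X,
    Equiv.ofBijective_symm_apply_apply]
  exact sumAlgEquiv_X_inl K _ _ t

theorem blockEquiv_X_inr (t : (Fin n ⊕ Fin n) × Fin m) :
    blockEquiv K n m (X (entryOfBlock n m (Sum.inr t))) = C (X t) := by
  rw [blockEquiv, AlgEquiv.trans_apply, renameEquiv_apply, rename_X,
    Equiv.ofBijective_symm_apply_apply]
  exact sumAlgEquiv_X_inr K _ _ t

theorem blockEquiv_C (c : K) : blockEquiv K n m (C c) = C (C c) := by
  have h := (blockEquiv K n m).commutes c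
  exact h

variable {K} {M : Type u} [CommRing M]
  [Algebra (MvPolynomial ((Fin (n + 1) ⊕ Fin (n + 1)) × Fin (m + 1)) K) M]

variable (K) in
/-- The columns of the generic matrix, with entries in a localization. -/
def genCol (M : Type u) [CommRing M]
    [Algebra (MvPolynomial ((Fin (n + 1) ⊕ Fin (n + 1)) × Fin (m + 1)) K) M] (j : Fin (m + 1))
    (s : Fin (n + 1) ⊕ Fin (n + 1)) : M :=
  algebraMap (MvPolynomial ((Fin (n + 1) ⊕ Fin (n + 1)) × Fin (m + 1)) K) M (X (s, j))

/-- The coordinate change given by clearing the pivot row and recording the values of the form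
on the first column. -/
def pivotHom (y : M) : MvPolynomial (((Fin (n + 1) ⊕ Fin (n + 1)) ⊕ Fin m) ⊕ Fin m)
    (MvPolynomial ((Fin n ⊕ Fin n) × Fin m) K) →+* M :=
  eval₂Hom (eval₂Hom ((algebraMap (MvPolynomial ((Fin (n + 1) ⊕ Fin (n + 1)) × Fin (m + 1)) K)
      M).comp C) fun t => clearPivot y (genCol (n := n) (m := m) K M) t.2 (lowRow t.1))
    (Sum.elim (Sum.elim (genCol (n := n) (m := m) K M 0) fun i => genCol (n := n) (m := m) K M i.succ (Sum.inl (Fin.last n)))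
      fun i => symp (genCol (n := n) (m := m) K M 0) (genCol (n := n) (m := m) K M i.succ))

theorem surjective_of_eq_pivotHom {y : M}
    (hy : genCol (n := n) (m := m) K M 0 (Sum.inl (Fin.last n)) * y = 1)
    [IsLocalization.Away (X (Sum.inl (Fin.last n), 0) :
      MvPolynomial ((Fin (n + 1) ⊕ Fin (n + 1)) × Fin (m + 1)) K) M] (θ : M →+* M)
    (hθ : ∀ f : MvPolynomial ((Fin (n + 1) ⊕ Fin (n + 1)) × Fin (m + 1)) K,
      θ (algebraMap _ M f) = pivotHom y (blockEquiv K n m f)) : Function.Surjective θ := by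
  have hl : ∀ t, θ (algebraMap _ M (X (entryOfBlock n m (Sum.inl t)) :
      MvPolynomial ((Fin (n + 1) ⊕ Fin (n + 1)) × Fin (m + 1)) K)) =
      pivotHom (n := n) (m := m) (K := K) y (X t) := fun t => by
    rw [hθ, blockEquiv_X_inl]
  have hr : ∀ t, θ (algebraMap _ M (X (entryOfBlock n m (Sum.inr t)) :
      MvPolynomial ((Fin (n + 1) ⊕ Fin (n + 1)) × Fin (m + 1)) K)) =
      pivotHom (n := n) (m := m) (K := K) y (C (X t)) := fun t => by
    rw [hθ, blockEquiv_X_inr]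
  have h0 : ∀ s, genCol (n := n) (m := m) K M 0 s ∈ θ.range := fun s =>
    ⟨_, (hl (Sum.inl (Sum.inl s))).trans (by simp [pivotHom])⟩
  have ha : ∀ i : Fin m, genCol (n := n) (m := m) K M i.succ (Sum.inl (Fin.last n)) ∈ θ.range := fun i =>
    ⟨_, (hl (Sum.inl (Sum.inr i))).trans (by simp [pivotHom])⟩
  have hω : ∀ i : Fin m, symp (genCol (n := n) (m := m) K M 0) (genCol K M i.succ) ∈ θ.range := fun i =>
    ⟨_, (hl (Sum.inr i)).trans (by simp [pivotHom])⟩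
  have hc : ∀ (i : Fin m) (s : Fin n ⊕ Fin n), clearPivot y (genCol K M) i (lowRow s) ∈ θ.range :=
    fun i s => ⟨_, (hr (s, i)).trans (by simp [pivotHom])⟩
  have hyθ : y ∈ θ.range := by
    refine ⟨y, ?_⟩
    have h1 := congrArg θ hy
    have h2 : θ (genCol (n := n) (m := m) K M 0 (Sum.inl (Fin.last n))) =
        genCol (n := n) (m := m) K M 0 (Sum.inl (Fin.last n)) :=
      (hl (Sum.inl (Sum.inl (Sum.inl (Fin.last n))))).trans (by simp [pivotHom])
    rw [map_mul, h2, map_one] at h1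
    linear_combination y * h1 - θ y * hy
  have hlow : ∀ (i : Fin m) (s : Fin n ⊕ Fin n), genCol K M i.succ (lowRow s) ∈ θ.range := by
    intro i s
    have h1 := add_mem (hc i s) (mul_mem (mul_mem (ha i) hyθ) (h0 (lowRow s)))
    simpa [clearPivot] using h1
  have hb : ∀ i : Fin m, genCol (n := n) (m := m) K M i.succ (Sum.inr (Fin.last n)) ∈ θ.range := by
    intro i
    have h1 : symp (genCol (n := n) (m := m) K M 0 ∘ lowRow) (genCol K M i.succ ∘ lowRow) ∈ θ.range := by
      rw [symp_apply]
      exact sum_mem fun k _ => sub_mem (mul_mem (h0 _) (hlow _ _)) (mul_mem (h0 _) (hlow _ _))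
    have h2 := mul_mem hyθ (add_mem (sub_mem (hω i) h1)
      (mul_mem (h0 (Sum.inr (Fin.last n))) (ha i)))
    convert h2 using 1
    rw [symp_eq_add_lowRow]
    linear_combination (- genCol (n := n) (m := m) K M i.succ (Sum.inr (Fin.last n))) * hy
  have hX : ∀ t, algebraMap (MvPolynomial ((Fin (n + 1) ⊕ Fin (n + 1)) × Fin (m + 1)) K) M (X t) ∈
      θ.range := by
    intro t
    obtain ⟨t, rfl⟩ := (entryOfBlock_bijective n m).2 t
    rcases t with ((s | i) | i) | ⟨s, i⟩
    exacts [h0 s, ha i, hb i, hlow i s]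
  have hR : ∀ f : MvPolynomial ((Fin (n + 1) ⊕ Fin (n + 1)) × Fin (m + 1)) K,
      algebraMap _ M f ∈ θ.range := by
    intro f
    induction f using MvPolynomial.induction_on with
    | C c => exact ⟨algebraMap _ M (C c), by rw [hθ, blockEquiv_C]; simp [pivotHom]⟩
    | add f g hf hg => rw [map_add]; exact add_mem hf hg
    | mul_X f i hf => rw [map_mul]; exact mul_mem hf (hX i)
  intro z
  obtain ⟨k, f, h⟩ := IsLocalization.Away.surj (X (Sum.inl (Fin.last n), 0) :
      MvPolynomial ((Fin (n + 1) ⊕ Fin (n + 1)) × Fin (m + 1)) K) z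
  have h1 := mul_mem (hR f) (pow_mem hyθ k)
  rw [← h, mul_assoc, ← mul_pow] at h1
  have h2 : algebraMap (MvPolynomial ((Fin (n + 1) ⊕ Fin (n + 1)) × Fin (m + 1)) K) M
    (X (Sum.inl (Fin.last n), 0)) * y = 1 := hy
  rw [h2, one_pow, mul_one] at h1
  exact h1

theorem le_ker_iff_pivotHom {r : ℕ} {y : M}
    (hy : genCol (n := n) (m := m) K M 0 (Sum.inl (Fin.last n)) * y = 1)
    {L : Type*} [Field L] (g : M →+* L) :
    locusIdeal K (fun l => min l (r + 1)) ∅ ≤ RingHom.ker (g.comp (algebraMap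
      (MvPolynomial ((Fin (n + 1) ⊕ Fin (n + 1)) × Fin (m + 1)) K) M)) ↔
    extVars (locusIdeal K (fun l => min l r) ∅) (Set.range Sum.inr) ≤
      RingHom.ker (g.comp (pivotHom (n := n) (m := m) (K := K) y)) := by
  rw [extVars_le_ker_iff, locusIdeal_le_ker_iff, locusIdeal_le_ker_iff]
  have hy' : (fun j s => g (genCol (n := n) (m := m) K M j s)) 0 (Sum.inl (Fin.last n)) * g y = 1 := by
    rw [← map_mul, hy, map_one]
  refine (isPoint_min_succ_iff hy').trans ?_
  rw [and_comm]
  refine and_congr ?_ ?_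
  · refine Eq.to_iff (congrArg _ ?_)
    funext i s
    simp [pivotHom, clearPivot, genCol]
  · rw [Set.forall_mem_range]
    refine forall_congr' fun i => ?_
    change symp (fun s => g (genCol K M 0 s)) (fun s => g (genCol K M i.succ s)) = 0 ↔ _
    rw [symp_map]
    simp [pivotHom]

/-- The induction step: the height and normality of the locus of rank `r + 1` are determined by
those of the locus of rank `r` with one hyperbolic pair and one column removed. -/
theorem locusIdeal_min_succ {r : ℕ}
    (hP : (locusIdeal K (fun l => min l r) (∅ : Set ((Fin n ⊕ Fin n) × Fin m))).IsPrime)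
    (hN : IsIntegrallyClosed (MvPolynomial ((Fin n ⊕ Fin n) × Fin m) K ⧸
      locusIdeal K (fun l => min l r) (∅ : Set ((Fin n ⊕ Fin n) × Fin m)))) :
    (locusIdeal K (fun l => min l (r + 1))
      (∅ : Set ((Fin (n + 1) ⊕ Fin (n + 1)) × Fin (m + 1)))).IsPrime ∧
    IsIntegrallyClosed (MvPolynomial ((Fin (n + 1) ⊕ Fin (n + 1)) × Fin (m + 1)) K ⧸
      locusIdeal K (fun l => min l (r + 1))
        (∅ : Set ((Fin (n + 1) ⊕ Fin (n + 1)) × Fin (m + 1)))) ∧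
    (locusIdeal K (fun l => min l (r + 1))
      (∅ : Set ((Fin (n + 1) ⊕ Fin (n + 1)) × Fin (m + 1)))).height =
    (locusIdeal K (fun l => min l r) (∅ : Set ((Fin n ⊕ Fin n) × Fin m))).height + m := by
  have hI := locusIdeal_isPrime (K := K) (n := n) (m := m + 1) (isRankFunction_min (r + 1)) (by simp)
  let x : MvPolynomial ((Fin (n + 1) ⊕ Fin (n + 1)) × Fin (m + 1)) K := X (Sum.inl (Fin.last n), 0)
  let M := Localization.Away x
  let y : M := IsLocalization.Away.invSelf x
  have hy : genCol (n := n) (m := m) K M 0 (Sum.inl (Fin.last n)) * y = 1 :=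
    IsLocalization.Away.mul_invSelf x
  let P := extVars (locusIdeal K (fun l => min l r) (∅ : Set ((Fin n ⊕ Fin n) × Fin m)))
    (Set.range (Sum.inr : Fin m → ((Fin (n + 1) ⊕ Fin (n + 1)) ⊕ Fin m) ⊕ Fin m))
  have hPP : P.IsPrime := isPrime_extVars _ _
  have hxI := X_notMem_locusIdeal (K := K) (n := n + 1) (m := m) (isRankFunction_min (r + 1))
    (by simp) (Sum.inl (Fin.last n))
  have hex : blockEquiv K n m x = X (Sum.inl (Sum.inl (Sum.inl (Fin.last n)))) :=
    blockEquiv_X_inl K (Sum.inl (Sum.inl (Sum.inl (Fin.last n))))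
  obtain ⟨hht, hnorm⟩ := height_eq_and_isIntegrallyClosed (blockEquiv K n m).toRingEquiv x
    (pivotHom (K := K) y)
    (by
      change pivotHom y (blockEquiv K n m x) = _
      rw [hex]
      simp [pivotHom, genCol, x])
    (fun θ hθ => surjective_of_eq_pivotHom hy θ hθ)
    (locusIdeal K (fun l => min l (r + 1)) ∅) P hxI
    (by
      change blockEquiv K n m x ∉ P
      rw [hex]
      exact X_notMem_extVars _ (by simp))
    (fun L _ g => le_ker_iff_pivotHom hy g)
  refine ⟨hI, ?_, ?_⟩
  · exact isIntegrallyClosed_quotient_of_away (M := M) x _ hxI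
      (locusIdeal_sup_isRadical (isRankFunction_min (r + 1)))
      (hnorm (isIntegrallyClosed_quotient_extVars _))
  · rw [hht]
    have h := height_extVars (locusIdeal K (fun l => min l r) (∅ : Set ((Fin n ⊕ Fin n) × Fin m)))
      (Finset.univ.map (Function.Embedding.inr :
        Fin m ↪ ((Fin (n + 1) ⊕ Fin (n + 1)) ⊕ Fin m) ⊕ Fin m))
    rw [Finset.card_map, Finset.card_univ, Fintype.card_fin, Finset.coe_map, Finset.coe_univ,
      Set.image_univ] at h
    exact h

end Pivot

section Main

variable {K : Type u} [Field K] {n m : ℕ}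

theorem X_mem_locusIdeal_min_zero (s : (Fin n ⊕ Fin n) × Fin m) :
    X s ∈ locusIdeal K (fun l => min l 0) (∅ : Set ((Fin n ⊕ Fin n) × Fin m)) := by
  rw [show (fun l => min l 0) = fun _ : ℕ => 0 from funext fun l => Nat.min_zero l]
  have h := ((locusIdeal_le_iff (K := K) (ρ := fun _ => 0)
    (Z := (∅ : Set ((Fin n ⊕ Fin n) × Fin m))) _).mp le_rfl).2.1 m (fun _ => s.1) (fun _ => s.2)
    fun _ => s.2.2
  simpa [Matrix.det_fin_one] using h

theorem locusIdeal_min_zero : locusIdeal K (fun l => min l 0) (∅ : Set ((Fin n ⊕ Fin n) × Fin m)) =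
    RingHom.ker (constantCoeff : MvPolynomial ((Fin n ⊕ Fin n) × Fin m) K →+* K) :=
  le_antisymm (locusIdeal_le_ker_constantCoeff _ _)
    (ker_constantCoeff_le X_mem_locusIdeal_min_zero)

theorem height_ker_constantCoeff {σ : Type*} [Fintype σ] :
    (RingHom.ker (constantCoeff : MvPolynomial σ K →+* K)).height = Fintype.card σ := by
  rw [← Finset.card_univ, ← height_span_X_image (D := K) (Finset.univ : Finset σ)]
  congr 1
  refine le_antisymm (ker_constantCoeff_le fun s => Ideal.subset_span ⟨s, by simp, rfl⟩) ?_
  rw [Ideal.span_le]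
  rintro _ ⟨s, -, rfl⟩
  exact constantCoeff_X (R := K) s

theorem isIntegrallyClosed_quotient_ker {R k : Type*} [CommRing R] [CommRing k] [IsDomain k]
    [IsIntegrallyClosed k] (f : R →+* k) (hf : Function.Surjective f) :
    IsIntegrallyClosed (R ⧸ RingHom.ker f) :=
  IsIntegrallyClosed.of_equiv (RingHom.quotientKerEquivOfSurjective hf).symm

theorem isIntegrallyClosed_quotient_map {R S : Type*} [CommRing R] [CommRing S] (e : R ≃+* S)
    (I : Ideal R) [IsIntegrallyClosed (R ⧸ I)] : IsIntegrallyClosed (S ⧸ I.map e) :=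
  IsIntegrallyClosed.of_equiv (Ideal.quotientEquiv _ _ e rfl)

theorem height_map_equiv {R S : Type*} [CommRing R] [CommRing S] (e : R ≃+* S) (I : Ideal R) :
    (I.map e).height = I.height := by
  rw [← RingEquiv.height_comap e, Ideal.comap_map_of_bijective _ e.bijective]

theorem locusIdeal_min_spec (K : Type u) [Field K] (r : ℕ) : ∀ m n : ℕ, r ≤ m → m ≤ n →
    (locusIdeal K (fun l => min l r) (∅ : Set ((Fin n ⊕ Fin n) × Fin m))).IsPrime ∧
    IsIntegrallyClosed (MvPolynomial ((Fin n ⊕ Fin n) × Fin m) K ⧸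
      locusIdeal K (fun l => min l r) (∅ : Set ((Fin n ⊕ Fin n) × Fin m))) ∧
    (locusIdeal K (fun l => min l r) (∅ : Set ((Fin n ⊕ Fin n) × Fin m))).height =
      ((m - r) * (2 * n - r) + r * (r - 1) / 2 : ℕ) := by
  induction r with
  | zero =>
    intro m n _ _
    rw [locusIdeal_min_zero]
    refine ⟨RingHom.ker_isPrime _, ?_, ?_⟩
    · exact isIntegrallyClosed_quotient_ker _ fun c => ⟨C c, constantCoeff_C _ c⟩
    · rw [height_ker_constantCoeff]
      simp only [Fintype.card_prod, Fintype.card_sum, Fintype.card_fin]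
      congr 1
      simp only [Nat.sub_zero, Nat.zero_mul, Nat.zero_div, Nat.add_zero]
      ring
  | succ r ih =>
    intro m n hrm hmn
    obtain ⟨m, rfl⟩ := Nat.exists_eq_add_one_of_ne_zero (by omega : m ≠ 0)
    obtain ⟨n, rfl⟩ := Nat.exists_eq_add_one_of_ne_zero (by omega : n ≠ 0)
    obtain ⟨h1, h2, h3⟩ := ih m n (by omega) (by omega)
    obtain ⟨h4, h5, h6⟩ := locusIdeal_min_succ h1 h2
    refine ⟨h4, h5, ?_⟩
    rw [h6, h3, ← Nat.cast_add, Nat.triangle_succ, Nat.add_sub_add_right,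
      show 2 * (n + 1) - (r + 1) = (2 * n - r) + 1 by omega, mul_add]
    congr 1
    omega

/-- The identification of the two indexings of the rows. -/
def rowEquiv (n : ℕ) : Fin n ⊕ Fin n ≃ Fin (2 * n) :=
  finSumFinEquiv.trans (finCongr (two_mul n).symm)

/-- The renaming of the variables along `rowEquiv`. -/
def rowRename (K : Type u) [Field K] (n m : ℕ) :
    MvPolynomial ((Fin n ⊕ Fin n) × Fin m) K ≃ₐ[K] MvPolynomial (Fin (2 * n) × Fin m) K :=
  renameEquiv K ((rowEquiv n).prodCongr (Equiv.refl _))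

theorem rowRename_X (s : Fin n ⊕ Fin n) (j : Fin m) :
    rowRename K n m (X (s, j)) = X (rowEquiv n s, j) := by
  rw [rowRename, renameEquiv_apply, rename_X]
  rfl

theorem rowRename_symp (i j : Fin m) :
    rowRename K n m (symp (fun s => X (s, i)) fun s => X (s, j)) = sympQuad K n m i j := by
  rw [symp_apply, map_sum, sympQuad]
  refine Finset.sum_congr rfl fun k _ => ?_
  rw [map_sub, map_mul, map_mul, rowRename_X, rowRename_X, rowRename_X, rowRename_X]
  rfl

theorem rowRename_det {q : ℕ} (f : Fin q → Fin n ⊕ Fin n) (g : Fin q → Fin m) :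
    rowRename K n m (Matrix.of fun i j => X (f i, g j)).det =
      ((genMatrix K (2 * n) m).submatrix (fun i => rowEquiv n (f i)) g).det := by
  rw [AlgEquiv.map_det]
  congr 1
  ext1 i j
  exact rowRename_X _ _

theorem sympQuad_mem_sympIdeal (r : ℕ) (i j : Fin m) : sympQuad K n m i j ∈ sympIdeal K r m n := by
  have h : ∀ i j : Fin m, i < j → sympQuad K n m i j ∈ sympIdeal K r m n := fun i j hij =>
    Ideal.subset_span (Or.inl ⟨i, j, hij, rfl⟩)
  rcases lt_trichotomy i j with hij | rfl | hij
  · exact h i j hij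
  · rw [← rowRename_symp, symp_self, map_zero]
    exact zero_mem _
  · rw [← rowRename_symp, symp_swap, map_neg, rowRename_symp]
    exact neg_mem (h j i hij)

theorem det_submatrix_mem_sympIdeal {r q : ℕ} (hq : q = r + 1) (f : Fin q → Fin (2 * n))
    (g : Fin q → Fin m) : ((genMatrix K (2 * n) m).submatrix f g).det ∈ sympIdeal K r m n := by
  subst hq
  by_cases hf : Function.Injective f
  · by_cases hg : Function.Injective g
    · exact Ideal.subset_span (Or.inr ⟨f, g, hf, hg, rfl⟩)
    · obtain ⟨i, j, hij, hne⟩ := Function.not_injective_iff.mp hg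
      rw [Matrix.det_zero_of_column_eq hne fun k => by simp [hij]]
      exact zero_mem _
  · obtain ⟨i, j, hij, hne⟩ := Function.not_injective_iff.mp hf
    rw [Matrix.det_zero_of_row_eq hne (by ext k; simp [hij])]
    exact zero_mem _

theorem map_rowRename_locusIdeal {r : ℕ} (hrm : r ≤ m) :
    (locusIdeal K (fun l => min l r) (∅ : Set ((Fin n ⊕ Fin n) × Fin m))).map (rowRename K n m) =
      sympIdeal K r m n := by
  apply le_antisymm
  · rw [Ideal.map_le_iff_le_comap, locusIdeal_le_iff]
    simp only [Ideal.mem_comap]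
    refine ⟨fun i j => ?_, fun l f g hg => ?_, by simp⟩
    · rw [rowRename_symp]
      exact sympQuad_mem_sympIdeal r i j
    · rw [rowRename_det]
      rcases le_or_gt r l with hl | hl
      · exact det_submatrix_mem_sympIdeal (by rw [min_eq_right hl]) _ _
      · have hg' : ¬ Function.Injective g := by
          intro hinj
          have h := Fintype.card_le_of_injective (fun i => (⟨g i, hg i⟩ : Fin l)) fun i j hij =>
            hinj (Fin.ext (by simpa using hij))
          rw [Fintype.card_fin, Fintype.card_fin] at h
          omega
        obtain ⟨i, j, hij, hne⟩ := Function.not_injective_iff.mp hg'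
        rw [Matrix.det_zero_of_column_eq hne fun k => by simp [hij]]
        exact zero_mem _
  · obtain ⟨h1, h2, -⟩ := (locusIdeal_le_iff (K := K) (ρ := fun l => min l r)
      (Z := (∅ : Set ((Fin n ⊕ Fin n) × Fin m))) _).mp le_rfl
    rw [sympIdeal, Ideal.span_le]
    rintro p (⟨i, j, -, rfl⟩ | ⟨f, g, -, -, rfl⟩)
    · rw [← rowRename_symp]
      exact Ideal.mem_map_of_mem _ (h1 i j)
    · have h3 : ∀ q, min m r = q → ∀ (f : Fin (q + 1) → Fin n ⊕ Fin n) (g : Fin (q + 1) → Fin m),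
          (Matrix.of fun i j => X (f i, g j)).det ∈
            locusIdeal K (fun l => min l r) (∅ : Set ((Fin n ⊕ Fin n) × Fin m)) := by
        rintro q rfl f g
        exact h2 m f g fun i => (g i).2
      have h4 := Ideal.mem_map_of_mem (rowRename K n m)
        (h3 r (min_eq_right hrm) (fun i => (rowEquiv n).symm (f i)) g)
      rw [rowRename_det] at h4
      simp only [Equiv.apply_symm_apply] at h4
      exact h4

theorem sympIdeal_spec (K : Type u) [Field K] {r m n : ℕ} (hrm : r ≤ m) (hmn : m ≤ n) :
    (sympIdeal K r m n).IsPrime ∧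
    IsIntegrallyClosed (MvPolynomial (Fin (2 * n) × Fin m) K ⧸ sympIdeal K r m n) ∧
    (sympIdeal K r m n).height = ((m - r) * (2 * n - r) + r * (r - 1) / 2 : ℕ) := by
  obtain ⟨h1, h2, h3⟩ := locusIdeal_min_spec K r m n hrm hmn
  have h : sympIdeal K r m n = (locusIdeal K (fun l => min l r) ∅).map
      (rowRename K n m).toRingEquiv := (map_rowRename_locusIdeal hrm).symm
  rw [h]
  exact ⟨Ideal.map_isPrime_of_equiv _, isIntegrallyClosed_quotient_map _ _,
    (height_map_equiv _ _).trans h3⟩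

end Main

end IsotropicMaps

/-- `I_{r,m,n}` is prime of height `(m−r)(2n−r) + r(r−1)/2`, with integrally closed
(normal) quotient domain. -/
theorem statement1 (K : Type*) [Field K] (r m n : ℕ) (hrm : r ≤ m) (hmn : m ≤ n) :
    ∃ hP : (sympIdeal K r m n).IsPrime,
      Order.height (⟨sympIdeal K r m n, hP⟩ :
          PrimeSpectrum (MvPolynomial (Fin (2 * n) × Fin m) K)) =
        ((m - r) * (2 * n - r) + r * (r - 1) / 2 : ℕ) ∧
      IsDomain ((MvPolynomial (Fin (2 * n) × Fin m) K) ⧸ sympIdeal K r m n) ∧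
      IsIntegrallyClosed ((MvPolynomial (Fin (2 * n) × Fin m) K) ⧸ sympIdeal K r m n) := by
  obtain ⟨hP, hN, hh⟩ := IsotropicMaps.sympIdeal_spec K hrm hmn
  refine ⟨hP, ?_, Ideal.Quotient.isDomain _, hN⟩
  rw [← PrimeSpectrum.height_eq_orderHeight]
  exact hh
end
end
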